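/- Let G be a finite group with T(G) > (1/4)·|G|. Then either G is solvable of Fitting height at most 4, i.e., there exists a chain 1 = N₀ ≤ N₁ ≤ N₂ ≤ N₃ ≤ N₄ = G of normal subgroups of G such that each quotient N_{i+1}/N_i is nilpotent, or G is isomorphic to A₅ × Z for some abelian group Z, where A₅ is the alternating group on 5 letters. -/

import Mathlib

open CategoryTheory

/-- `χ : G → ℂ` is an irreducible complex character of the group `G`, i.e. the character of
an irreducible (simple) finite-dimensional complex representation of `G`. -/
def IsIrrChar (G : Type) [Group G] (χ : G → ℂ) : Prop :=
  ∃ V : FDRep ℂ G, Simple V ∧ χ = FDRep.character V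

/-- `charDegSum G` is `T(G)`, the sum of the degrees `χ(1)` of the irreducible complex
characters of `G`. -/
noncomputable def charDegSum (G : Type) [Group G] : ℝ :=
  ∑ᶠ χ ∈ {χ : G → ℂ | IsIrrChar G χ}, (χ 1).re

open CategoryTheory

section CharFoundations
variable {G : Type} [Group G]

/-- characters of finite dimensional representations -/
def IsChar (θ : G → ℂ) : Prop := ∃ V : FDRep ℂ G, θ = FDRep.character V

theorem IsIrrChar.isChar {χ : G → ℂ} (h : IsIrrChar G χ) : IsChar χ := by
  obtain ⟨V, _, h⟩ := h
  exact ⟨V, h⟩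

theorem isChar_of_rep {V : Type} [AddCommGroup V] [Module ℂ V] [FiniteDimensional ℂ V]
    (ρ : Representation ℂ G V) : IsChar ρ.character := ⟨FDRep.of ρ, rfl⟩

variable [Fintype G]

/-- the bilinear form on functions on the group -/
noncomputable def cip (f h : G → ℂ) : ℂ := (Nat.card G : ℂ)⁻¹ * ∑ g : G, f g * h g⁻¹

theorem card_ne : (Nat.card G : ℂ) ≠ 0 := by
  simp

theorem cip_comm (f h : G → ℂ) : cip f h = cip h f := by
  unfold cip
  congr 1
  rw [← Equiv.sum_comp (Equiv.inv G)]
  simp [mul_comm]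

theorem cip_add_left (f f' h : G → ℂ) : cip (f + f') h = cip f h + cip f' h := by
  simp [cip, add_mul, Finset.sum_add_distrib, mul_add]

theorem cip_add_right (f h h' : G → ℂ) : cip f (h + h') = cip f h + cip f h' := by
  simp [cip, mul_add, Finset.sum_add_distrib]

theorem cip_smul_left (c : ℂ) (f h : G → ℂ) : cip (c • f) h = c * cip f h := by
  simp only [cip, Pi.smul_apply, smul_eq_mul, mul_assoc, ← Finset.mul_sum]
  ring

theorem cip_smul_right (c : ℂ) (f h : G → ℂ) : cip f (c • h) = c * cip f h := by
  rw [cip_comm, cip_smul_left, cip_comm]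

theorem cip_sub_left (f f' h : G → ℂ) : cip (f - f') h = cip f h - cip f' h := by
  simp [cip, sub_mul, Finset.sum_sub_distrib, mul_sub]

theorem cip_sum_left {ι : Type*} (s : Finset ι) (f : ι → G → ℂ) (h : G → ℂ) :
    cip (∑ i ∈ s, f i) h = ∑ i ∈ s, cip (f i) h := by
  simp only [cip, Finset.sum_apply, Finset.sum_mul, ← Finset.mul_sum]
  rw [Finset.sum_comm]

theorem cip_sum_right {ι : Type*} (s : Finset ι) (f : ι → G → ℂ) (h : G → ℂ) :
    cip h (∑ i ∈ s, f i) = ∑ i ∈ s, cip h (f i) := by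
  rw [cip_comm, cip_sum_left]
  simp [cip_comm]

theorem IsChar.cip_nat {θ η : G → ℂ} (h : IsChar θ) (h' : IsChar η) :
    ∃ n : ℕ, cip θ η = n := by
  obtain ⟨V, rfl⟩ := h
  obtain ⟨W, rfl⟩ := h'
  have := invertibleOfNonzero (card_ne (G := G))
  exact ⟨_, FDRep.scalar_product_char_eq_finrank_equivariant W V⟩

theorem isIrrChar_iff {χ : G → ℂ} : IsIrrChar G χ ↔ IsChar χ ∧ cip χ χ = 1 := by
  constructor
  · rintro ⟨V, hV, rfl⟩
    refine ⟨⟨V, rfl⟩, ?_⟩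
    rw [FDRep.simple_iff_char_is_norm_one] at hV
    unfold cip
    rw [hV, inv_mul_cancel₀ card_ne]
  · rintro ⟨⟨V, rfl⟩, h⟩
    refine ⟨V, ?_, rfl⟩
    rw [FDRep.simple_iff_char_is_norm_one]
    unfold cip at h
    rwa [inv_mul_eq_one₀ card_ne, eq_comm] at h

theorem IsIrrChar.cip_self {χ : G → ℂ} (h : IsIrrChar G χ) : cip χ χ = 1 :=
  (isIrrChar_iff.1 h).2

theorem IsIrrChar.cip_ne {χ ψ : G → ℂ} (h : IsIrrChar G χ) (h' : IsIrrChar G ψ) (hne : χ ≠ ψ) :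
    cip χ ψ = 0 := by
  obtain ⟨V, hV, rfl⟩ := h
  obtain ⟨W, hW, rfl⟩ := h'
  have := invertibleOfNonzero (card_ne (G := G))
  have := FDRep.char_orthonormal V W
  unfold cip
  rw [this, if_neg]
  rintro ⟨i⟩
  exact hne (FDRep.char_iso i)

theorem isIrrChar_of_isIrreducible {V : Type} [AddCommGroup V] [Module ℂ V] [FiniteDimensional ℂ V]
    (ρ : Representation ℂ G V) [ρ.IsIrreducible] : IsIrrChar G ρ.character := by
  refine isIrrChar_iff.2 ⟨isChar_of_rep ρ, ?_⟩
  have := invertibleOfNonzero (card_ne (G := G))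
  unfold cip
  rw [Representation.card_inv_mul_sum_char_mul_char_eq_finrank]
  simp

/-- class functions -/
def IsClassFn (f : G → ℂ) : Prop := ∀ g h : G, f (h * g * h⁻¹) = f g

theorem IsChar.isClassFn {θ : G → ℂ} (h : IsChar θ) : IsClassFn θ := by
  obtain ⟨V, rfl⟩ := h
  intro g h
  exact FDRep.char_conj V g h

theorem simple_smul_eq_zero {f : G → ℂ} (h : ∀ χ, IsIrrChar G χ → cip f χ = 0)
    (S : Type) [AddCommGroup S] [Module ℂ S] [Module (MonoidAlgebra ℂ G) S]
    [IsScalarTower ℂ (MonoidAlgebra ℂ G) S] [hS : IsSimpleModule (MonoidAlgebra ℂ G) S] (s : S)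
    (hcomm : ∀ x : G, MonoidAlgebra.of ℂ G x * (∑ g : G, MonoidAlgebra.single g (f g⁻¹)) =
      (∑ g : G, MonoidAlgebra.single g (f g⁻¹)) * MonoidAlgebra.of ℂ G x) :
    (∑ g : G, MonoidAlgebra.single g (f g⁻¹)) • s = 0 := by
  set a : MonoidAlgebra ℂ G := ∑ g : G, MonoidAlgebra.single g (f g⁻¹) with ha
  let ρ := Representation.ofModule' (k := ℂ) (G := G) S
  have hρ : ∀ (r : MonoidAlgebra ℂ G) (x : S), ρ.asAlgebraHom r x = r • x := by
    intro r x
    have : ρ.asAlgebraHom = Algebra.lsmul ℂ ℂ S :=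
      (MonoidAlgebra.lift ℂ (Module.End ℂ S) G).apply_symm_apply _
    rw [this]; rfl
  let e : ρ.asModule ≃ₗ[MonoidAlgebra ℂ G] S :=
    { ρ.asModuleEquiv with
      map_smul' := by
        intro r x
        exact (ρ.asModuleEquiv_map_smul r x).trans (hρ r _) }
  have hirr : ρ.IsIrreducible := by
    rw [Representation.irreducible_iff_isSimpleModule_asModule]
    exact IsSimpleModule.congr e
  have hfin : FiniteDimensional ℂ S := Module.Finite.trans (MonoidAlgebra ℂ G) _
  let A : ρ.IntertwiningMap ρ := ⟨ρ.asAlgebraHom a, by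
    intro g
    have := congrArg ρ.asAlgebraHom (hcomm g)
    rw [map_mul, map_mul, Representation.asAlgebraHom_of] at this
    exact this.symm⟩
  obtain ⟨c, hc⟩ :=
    (Representation.IsIrreducible.algebraMap_intertwiningMap_bijective_of_isAlgClosed
      (ρ := ρ)).2 A
  have hc2 : ρ.asAlgebraHom a = c • (LinearMap.id) := by
    have := congrArg (fun B => B.toLinearMap) hc
    exact this.symm
  have htr : LinearMap.trace ℂ _ (ρ.asAlgebraHom a) = 0 := by
    have h1 := h _ (isIrrChar_of_isIrreducible ρ)
    rw [cip_comm] at h1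
    unfold cip at h1
    rw [mul_eq_zero, or_iff_right (by simp)] at h1
    rw [← h1, ha, map_sum, map_sum]
    refine Finset.sum_congr rfl fun g _ => ?_
    rw [Representation.asAlgebraHom_single, map_smul, smul_eq_mul, mul_comm]
    rfl
  rw [hc2, map_smul, LinearMap.trace_id, smul_eq_mul, mul_eq_zero] at htr
  have hnt : Nontrivial S := hS.nontrivial
  have hc0 : c = 0 := by
    refine htr.resolve_right ?_
    exact_mod_cast (Module.finrank_pos (R := ℂ)).ne'
  rw [hc0, zero_smul] at hc2
  rw [← hρ, hc2]
  rfl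

open MonoidAlgebra in
theorem classFn_eq_zero {f : G → ℂ} (hf : IsClassFn f)
    (h : ∀ χ, IsIrrChar G χ → cip f χ = 0) : f = 0 := by
  classical
  set a : MonoidAlgebra ℂ G := ∑ g : G, MonoidAlgebra.single g (f g⁻¹) with ha
  have hcomm : ∀ x : G, MonoidAlgebra.of ℂ G x * a = a * MonoidAlgebra.of ℂ G x := by
    intro x
    rw [ha, Finset.mul_sum, Finset.sum_mul]
    simp only [MonoidAlgebra.of_apply, MonoidAlgebra.single_mul_single, one_mul, mul_one]
    rw [← Equiv.sum_comp (MulAut.conj x).toEquiv (fun i => MonoidAlgebra.single (i * x) (f i⁻¹))]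
    refine Finset.sum_congr rfl fun g _ => ?_
    simp only [MulEquiv.toEquiv_eq_coe, MulEquiv.coe_toEquiv, MulAut.conj_apply, inv_mul_cancel_right]
    congr 1
    have := hf g⁻¹ x
    rw [← this]; congr 1; group
  have hcomm' : ∀ r : MonoidAlgebra ℂ G, r * a = a * r := by
    intro r
    induction r using MonoidAlgebra.induction_on with
    | of g => exact hcomm g
    | add p q hp hq => rw [add_mul, mul_add, hp, hq]
    | smul c p hp => rw [smul_mul_assoc, mul_smul_comm, hp]
  have key : ∀ S : Submodule (MonoidAlgebra ℂ G) (MonoidAlgebra ℂ G),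
      IsSimpleModule (MonoidAlgebra ℂ G) S → ∀ s ∈ S, a * s = 0 := by
    intro S hS s hs
    have := simple_smul_eq_zero h S ⟨s, hs⟩ hcomm
    exact congrArg Subtype.val this
  have htop := IsSemisimpleModule.sSup_simples_eq_top (MonoidAlgebra ℂ G) (MonoidAlgebra ℂ G)
  let K : Submodule (MonoidAlgebra ℂ G) (MonoidAlgebra ℂ G) :=
    { carrier := {s | a * s = 0}
      add_mem' := by intro x y hx hy; simp only [Set.mem_ofPred_eq] at *; rw [mul_add, hx, hy, add_zero]
      zero_mem' := by simp
      smul_mem' := by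
        intro c x hx
        simp only [Set.mem_ofPred_eq, smul_eq_mul] at *
        rw [← mul_assoc, ← hcomm', mul_assoc, hx, mul_zero] }
  have hK : K = ⊤ := by
    rw [eq_top_iff, ← htop]
    apply sSup_le
    intro S hS s hs
    exact key S hS s hs
  have ha0 : a = 0 := by
    have : (1 : MonoidAlgebra ℂ G) ∈ K := by rw [hK]; trivial
    have h2 : a * 1 = 0 := this
    rwa [mul_one] at h2
  funext g
  have := congrArg (fun b : MonoidAlgebra ℂ G => b.coeff g⁻¹) ha0
  rw [ha] at this
  simp only [MonoidAlgebra.coeff_sum, Finset.sum_apply', MonoidAlgebra.coeff_single, Finsupp.single_apply] at this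
  simpa using this

end CharFoundations

open CategoryTheory
set_option linter.unusedSectionVars false

section CharExpansion
variable {G : Type} [Group G]

/-- The type of irreducible characters -/
structure Irr (G : Type) [Group G] : Type where
  /-- the function -/
  val : G → ℂ
  /-- it is an irreducible character -/
  irr : IsIrrChar G val

instance : CoeFun (Irr G) (fun _ => G → ℂ) := ⟨fun χ => χ.1⟩

theorem Irr.ext {χ ψ : Irr G} (h : χ.1 = ψ.1) : χ = ψ := by
  cases χ; cases ψ; cases h; rfl

variable [Fintype G]

open Classical in
theorem Irr.cip (χ ψ : Irr G) : cip χ.1 ψ.1 = if χ = ψ then 1 else 0 := by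
  split_ifs with h
  · subst h; exact χ.2.cip_self
  · exact χ.2.cip_ne ψ.2 (fun h' => h (Irr.ext h'))

theorem Irr.linearIndependent : LinearIndependent ℂ (fun χ : Irr G => χ.1) := by
  classical
  rw [linearIndependent_iff']
  intro s c h χ hχ
  have := congrArg (fun f => _root_.cip f χ.1) h
  simp only [cip_sum_left, cip_smul_left, Irr.cip] at this
  simpa [hχ, _root_.cip] using this

instance : Finite (Irr G) := (Irr.linearIndependent (G := G)).finite

noncomputable instance : Fintype (Irr G) := Fintype.ofFinite _

noncomputable instance : DecidableEq (Irr G) := Classical.decEq _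

theorem IsChar.deg_nat {θ : G → ℂ} (h : IsChar θ) : ∃ n : ℕ, θ 1 = n := by
  obtain ⟨V, rfl⟩ := h
  exact ⟨_, FDRep.char_one V⟩

/-- degree of an irreducible character -/
noncomputable def Irr.dg (χ : Irr G) : ℕ := χ.2.isChar.deg_nat.choose

theorem Irr.one_eq (χ : Irr G) : χ.1 1 = χ.dg := χ.2.isChar.deg_nat.choose_spec

theorem IsClassFn.sub {f h : G → ℂ} (hf : IsClassFn f) (hh : IsClassFn h) : IsClassFn (f - h) := by
  intro a b; simp [hf a b, hh a b]
theorem IsClassFn.add {f h : G → ℂ} (hf : IsClassFn f) (hh : IsClassFn h) : IsClassFn (f + h) := by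
  intro a b; simp [hf a b, hh a b]
theorem IsClassFn.mul {f h : G → ℂ} (hf : IsClassFn f) (hh : IsClassFn h) : IsClassFn (f * h) := by
  intro a b; simp [hf a b, hh a b]
theorem IsClassFn.smul {f : G → ℂ} (c : ℂ) (hf : IsClassFn f) : IsClassFn (c • f) := by
  intro a b; simp [hf a b]
theorem IsClassFn.sum {ι : Type*} (s : Finset ι) {f : ι → G → ℂ} (hf : ∀ i ∈ s, IsClassFn (f i)) :
    IsClassFn (∑ i ∈ s, f i) := by
  intro a b
  simp only [Finset.sum_apply]
  exact Finset.sum_congr rfl fun i hi => hf i hi a b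
theorem Irr.classFn (χ : Irr G) : IsClassFn χ.1 := χ.2.isChar.isClassFn

theorem IsClassFn.expand {f : G → ℂ} (hf : IsClassFn f) :
    f = ∑ χ : Irr G, cip f χ.1 • χ.1 := by
  rw [← sub_eq_zero]
  refine classFn_eq_zero (hf.sub (IsClassFn.sum _ fun χ _ => (Irr.classFn χ).smul _)) ?_
  intro χ hχ
  rw [cip_sub_left, cip_sum_left]
  simp only [cip_smul_left]
  have : ∀ ψ : Irr G, cip ψ.1 χ = if ψ = (⟨χ, hχ⟩ : Irr G) then 1 else 0 := fun ψ => Irr.cip ψ ⟨χ, hχ⟩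
  simp [this]

theorem IsClassFn.cip_eq {f h : G → ℂ} (hf : IsClassFn f) :
    cip f h = ∑ χ : Irr G, cip f χ.1 * cip h χ.1 := by
  conv_lhs => rw [hf.expand]
  rw [cip_sum_left]
  simp only [cip_smul_left]
  exact Finset.sum_congr rfl fun χ _ => by rw [cip_comm χ.1 h]

theorem IsClassFn.apply_eq {f : G → ℂ} (hf : IsClassFn f) (g : G) :
    f g = ∑ χ : Irr G, cip f χ.1 * χ.1 g := by
  conv_lhs => rw [hf.expand]
  simp

/-- column orthogonality, first column -/
theorem sum_dg_mul (g : G) [Decidable (g = 1)] :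
    ∑ χ : Irr G, (χ.dg : ℂ) * χ.1 g = if g = 1 then (Nat.card G : ℂ) else 0 := by
  classical
  have h : IsClassFn (fun g : G => if g = 1 then (1 : ℂ) else 0) := by
    intro a b; simp
  have h2 := h.apply_eq g
  have h3 : ∀ χ : Irr G, cip (fun g : G => if g = 1 then (1 : ℂ) else 0) χ.1 =
      (Nat.card G : ℂ)⁻¹ * χ.dg := by
    intro χ
    simp [cip, χ.one_eq]
  simp only [h3] at h2
  have h4 : (if g = 1 then (Nat.card G : ℂ) else 0) = Nat.card G * (if g = 1 then (1:ℂ) else 0) := by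
    simp
  have h5 : (if g = 1 then (1:ℂ) else 0) = ∑ x : Irr G, (Nat.card G : ℂ)⁻¹ * x.dg * x.1 g := by
    rw [← h2]; split_ifs <;> rfl
  rw [h4, h5, Finset.mul_sum]
  refine Finset.sum_congr rfl fun χ _ => ?_
  rw [mul_assoc, mul_inv_cancel_left₀ card_ne]

theorem sum_dg_sq : ∑ χ : Irr G, χ.dg ^ 2 = Nat.card G := by
  classical
  have := sum_dg_mul (1 : G)
  simp only [Irr.one_eq, if_true] at this
  rw [← Nat.cast_inj (R := ℂ), ← this]
  push_cast
  exact Finset.sum_congr rfl fun χ _ => by ring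

/-- general column orthogonality at an element -/
theorem sum_mul_inv (x : G) : ∑ χ : Irr G, χ.1 x * χ.1 x⁻¹ = Nat.card (Subgroup.centralizer {x}) := by
  classical
  have h : IsClassFn (fun g : G => if IsConj x g then (1 : ℂ) else 0) := by
    intro a b
    have : IsConj x (b * a * b⁻¹) ↔ IsConj x a := by
      have h1 : IsConj a (b * a * b⁻¹) := isConj_iff.2 ⟨b, rfl⟩
      exact ⟨fun h => h.trans h1.symm, fun h => h.trans h1⟩
    simp only [this]
  have h2 := h.apply_eq x
  have h5 : (Nat.card (Subgroup.centralizer {x}) : ℂ) *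
     (Finset.univ.filter (fun g => IsConj x g)).card = Nat.card G := by
    have h6 := Subgroup.nat_card_centralizer_nat_card_stabilizer x
    have h7 := MulAction.card_orbit_mul_card_stabilizer_eq_card_group (ConjAct G) x
    have h8 : Fintype.card (MulAction.orbit (ConjAct G) x) =
        (Finset.univ.filter (fun g => IsConj x g)).card := by
      rw [Fintype.card_subtype]
      congr 1
      ext g
      simp only [Finset.mem_filter, Finset.mem_univ, true_and]
      rw [ConjAct.mem_orbit_conjAct]
      exact isConj_comm
    rw [h6, ← h8, ← Fintype.card_eq_nat_card, mul_comm]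
    have h9 : Fintype.card (ConjAct G) = Nat.card G := by
      rw [ConjAct.card, Fintype.card_eq_nat_card]
    rw [← h9]
    exact_mod_cast h7
  have h3 : ∀ χ : Irr G, cip (fun g : G => if IsConj x g then (1 : ℂ) else 0) χ.1 =
      (Nat.card G : ℂ)⁻¹ * ((Finset.univ.filter (fun g => IsConj x g)).card * χ.1 x⁻¹) := by
    intro χ
    simp only [cip, ite_mul, one_mul, zero_mul, ← Finset.sum_filter]
    congr 1
    rw [← nsmul_eq_mul]
    apply Finset.sum_eq_card_nsmul
    intro g hg
    obtain ⟨c, hc⟩ := isConj_iff.1 (Finset.mem_filter.1 hg).2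
    rw [← hc, ← Irr.classFn χ x⁻¹ c]
    congr 1; group
  simp only [h3, IsConj.refl, if_true] at h2
  set N : ℂ := ((Finset.univ.filter (fun g => IsConj x g)).card : ℂ) with hNdef
  have hc : (Nat.card (Subgroup.centralizer {x}) : ℂ) ≠ 0 := by
    intro h0
    rw [h0, zero_mul] at h5
    exact card_ne h5.symm
  have hN : N ≠ 0 := by
    intro h0
    rw [h0, mul_zero] at h5
    exact card_ne h5.symm
  have h6 : (1 : ℂ) = (Nat.card G : ℂ)⁻¹ * N * ∑ χ : Irr G, χ.1 x * χ.1 x⁻¹ := by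
    rw [Finset.mul_sum]
    refine h2.trans (Finset.sum_congr rfl fun χ _ => by ring)
  rw [← h5] at h6
  field_simp at h6
  exact h6.symm

theorem Irr.dg_pos (χ : Irr G) : 0 < χ.dg := by
  rcases Nat.eq_zero_or_pos χ.dg with h | h
  · exfalso
    obtain ⟨⟨V, hV⟩, h1⟩ := isIrrChar_iff.1 χ.2
    have h2 := χ.one_eq
    rw [h] at h2
    have hz : χ.1 = 0 := by
      rw [hV, FDRep.char_one] at h2
      have h3 : Module.finrank ℂ V = 0 := by exact_mod_cast h2
      have : Subsingleton V := Module.finrank_zero_iff.1 h3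
      rw [hV]
      funext g
      have : V.ρ g = 0 := Subsingleton.elim _ _
      simp [FDRep.character, this]
    rw [hz] at h1
    simp [_root_.cip] at h1
  · exact h

theorem charDegSum_eq : charDegSum G = ((∑ χ : Irr G, χ.dg : ℕ) : ℝ) := by
  unfold charDegSum
  have hr : {χ : G → ℂ | IsIrrChar G χ} = Set.range (fun χ : Irr G => χ.1) := by
    ext χ
    exact ⟨fun h => ⟨⟨χ, h⟩, rfl⟩, fun ⟨ψ, h⟩ => h ▸ ψ.2⟩
  rw [hr, finsum_mem_range (fun _ _ h => Irr.ext h), finsum_eq_sum_of_fintype]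
  push_cast
  exact Finset.sum_congr rfl fun χ _ => by rw [χ.one_eq]; simp

theorem card_irr : Fintype.card (Irr G) = Nat.card (ConjClasses G) := by
  classical
  have : Fintype (ConjClasses G) := Fintype.ofFinite _
  let F : (ConjClasses G → ℂ) →ₗ[ℂ] (Irr G → ℂ) :=
    { toFun := fun f χ => cip (fun g => f (ConjClasses.mk g)) χ.1
      map_add' := by
        intro f h; funext χ
        exact cip_add_left _ _ _
      map_smul' := by
        intro c f; funext χ
        exact cip_smul_left _ _ _ }
  have hcl : ∀ f : ConjClasses G → ℂ, IsClassFn (fun g => f (ConjClasses.mk g)) := by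
    intro f a b
    have : ConjClasses.mk (b * a * b⁻¹) = ConjClasses.mk a :=
      ConjClasses.mk_eq_mk_iff_isConj.2 (isConj_iff.2 ⟨b, rfl⟩).symm
    simp [this]
  have hinj : Function.Injective F := by
    rw [← LinearMap.ker_eq_bot, LinearMap.ker_eq_bot']
    intro f hf
    have := classFn_eq_zero (hcl f) (fun χ hχ => congrFun hf ⟨χ, hχ⟩)
    funext c
    obtain ⟨g, rfl⟩ := ConjClasses.exists_rep c
    exact congrFun this g
  have hsurj : Function.Surjective F := by
    intro a
    let s : G → ℂ := ∑ χ : Irr G, a χ • χ.1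
    have hs : IsClassFn s := IsClassFn.sum _ fun χ _ => (Irr.classFn χ).smul _
    refine ⟨fun c => Quotient.liftOn c s ?_, ?_⟩
    · intro x y hxy
      obtain ⟨c, hc⟩ := isConj_iff.1 hxy
      rw [← hc, hs x c]
    · funext χ
      change cip s χ.1 = a χ
      simp only [s, cip_sum_left, cip_smul_left, Irr.cip]
      simp
  have h1 := (LinearEquiv.ofBijective F ⟨hinj, hsurj⟩).finrank_eq
  simp only [Module.finrank_fintype_fun_eq_card] at h1
  rw [← h1, Fintype.card_eq_nat_card]

theorem deg_sum_sq_le : (∑ χ : Irr G, χ.dg) ^ 2 ≤ Nat.card (ConjClasses G) * Nat.card G := by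
  rw [← card_irr, ← sum_dg_sq]
  exact sq_sum_le_card_mul_sum_sq

end CharExpansion

open CategoryTheory
set_option linter.unusedSectionVars false

section NCharSec
variable {G : Type} [Group G]

theorem isChar_one : IsChar (1 : G → ℂ) := by
  have := isChar_of_rep (Representation.trivial ℂ G ℂ)
  convert this using 1
  funext g
  simp [Representation.character]

theorem IsChar.mul {f h : G → ℂ} (hf : IsChar f) (hh : IsChar h) : IsChar (f * h) := by
  obtain ⟨V, rfl⟩ := hf
  obtain ⟨W, rfl⟩ := hh
  have := isChar_of_rep (Representation.tprod V.ρ W.ρ)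
  rw [Representation.char_tensor] at this
  exact this

theorem IsChar.inv {f : G → ℂ} (hf : IsChar f) : IsChar (fun g => f g⁻¹) := by
  obtain ⟨V, rfl⟩ := hf
  have := isChar_of_rep (Representation.dual V.ρ)
  convert this using 1
  funext g
  exact (Representation.char_dual V.ρ g).symm

theorem IsChar.comp {H : Type} [Group H] {f : G → ℂ} (hf : IsChar f) (φ : H →* G) :
    IsChar (fun g => f (φ g)) := by
  obtain ⟨V, rfl⟩ := hf
  exact isChar_of_rep (V.ρ.comp φ : Representation ℂ H V)

variable [Fintype G]

/-- class function with natural multiplicities -/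
def NChar (f : G → ℂ) : Prop := IsClassFn f ∧ ∀ χ : Irr G, ∃ n : ℕ, cip f χ.1 = n

theorem IsChar.nchar {f : G → ℂ} (hf : IsChar f) : NChar f :=
  ⟨hf.isClassFn, fun χ => hf.cip_nat χ.2.isChar⟩

theorem Irr.nchar (χ : Irr G) : NChar χ.1 := χ.2.isChar.nchar

/-- the multiplicity of an irreducible character -/
noncomputable def mlt (f : G → ℂ) (χ : Irr G) : ℕ := ⌊(cip f χ.1).re⌋₊

theorem NChar.cip_eq_mlt {f : G → ℂ} (hf : NChar f) (χ : Irr G) : cip f χ.1 = mlt f χ := by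
  obtain ⟨n, hn⟩ := hf.2 χ
  rw [mlt, hn]; simp

theorem NChar.expand {f : G → ℂ} (hf : NChar f) : f = ∑ χ : Irr G, mlt f χ • χ.1 := by
  conv_lhs => rw [hf.1.expand]
  refine Finset.sum_congr rfl fun χ _ => ?_
  rw [hf.cip_eq_mlt]
  exact Nat.cast_smul_eq_nsmul ℂ _ _

theorem NChar.apply_eq {f : G → ℂ} (hf : NChar f) (g : G) : f g = ∑ χ : Irr G, mlt f χ * χ.1 g := by
  rw [hf.1.apply_eq]
  exact Finset.sum_congr rfl fun χ _ => by rw [hf.cip_eq_mlt]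

theorem NChar.one_eq {f : G → ℂ} (hf : NChar f) :
    f 1 = ((∑ χ : Irr G, mlt f χ * χ.dg : ℕ) : ℂ) := by
  rw [hf.apply_eq]
  push_cast
  exact Finset.sum_congr rfl fun χ _ => by rw [χ.one_eq]

theorem NChar.cip_eq {f h : G → ℂ} (hf : NChar f) (hh : NChar h) :
    cip f h = ((∑ χ : Irr G, mlt f χ * mlt h χ : ℕ) : ℂ) := by
  rw [hf.1.cip_eq]
  push_cast
  exact Finset.sum_congr rfl fun χ _ => by rw [hf.cip_eq_mlt, hh.cip_eq_mlt]

theorem NChar.zero : NChar (0 : G → ℂ) := ⟨fun _ _ => rfl, fun _ => ⟨0, by simp [cip]⟩⟩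

theorem NChar.add {f h : G → ℂ} (hf : NChar f) (hh : NChar h) : NChar (f + h) :=
  ⟨hf.1.add hh.1, fun χ => ⟨mlt f χ + mlt h χ, by
    rw [cip_add_left, hf.cip_eq_mlt, hh.cip_eq_mlt]; push_cast; rfl⟩⟩

theorem NChar.nsmul {f : G → ℂ} (n : ℕ) (hf : NChar f) : NChar (n • f) := by
  induction n with
  | zero => rw [zero_smul]; exact NChar.zero
  | succ n ih => rw [succ_nsmul]; exact ih.add hf

theorem NChar.sum {ι : Type*} (s : Finset ι) {f : ι → G → ℂ} (hf : ∀ i ∈ s, NChar (f i)) :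
    NChar (∑ i ∈ s, f i) := by
  classical
  induction s using Finset.induction_on with
  | empty => simpa using NChar.zero
  | insert a s ha ih =>
    rw [Finset.sum_insert ha]
    exact (hf a (by simp)).add (ih fun i hi => hf i (by simp [hi]))

theorem NChar.mul {f h : G → ℂ} (hf : NChar f) (hh : NChar h) : NChar (f * h) := by
  rw [hf.expand, hh.expand, Finset.sum_mul]
  refine NChar.sum _ fun χ _ => ?_
  rw [Finset.mul_sum]
  refine NChar.sum _ fun ψ _ => ?_
  rw [smul_mul_smul_comm]
  exact NChar.nsmul _ (χ.2.isChar.mul ψ.2.isChar).nchar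

theorem cip_inv_inv (f h : G → ℂ) : cip (fun g => f g⁻¹) (fun g => h g⁻¹) = cip f h := by
  unfold cip
  congr 1
  rw [← Equiv.sum_comp (Equiv.inv G)]
  simp

/-- the trivial character -/
noncomputable def Irr.triv : Irr G := ⟨1, isIrrChar_iff.2 ⟨isChar_one, by
  simp [_root_.cip]⟩⟩

@[simp] theorem Irr.triv_apply (g : G) : (Irr.triv : Irr G).1 g = 1 := rfl
theorem Irr.triv_val : (Irr.triv : Irr G).1 = 1 := rfl

@[simp] theorem Irr.triv_dg : (Irr.triv : Irr G).dg = 1 := by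
  have := (Irr.triv : Irr G).one_eq
  simp only [Irr.triv_apply] at this
  exact_mod_cast this.symm

/-- the dual character -/
noncomputable def Irr.dual (χ : Irr G) : Irr G := ⟨fun g => χ.1 g⁻¹, isIrrChar_iff.2
  ⟨χ.2.isChar.inv, by rw [cip_inv_inv]; exact χ.2.cip_self⟩⟩

theorem Irr.dual_apply (χ : Irr G) (g : G) : χ.dual.1 g = χ.1 g⁻¹ := rfl

@[simp] theorem Irr.dual_dual (χ : Irr G) : χ.dual.dual = χ := by
  apply Irr.ext
  funext g
  simp [Irr.dual_apply]

@[simp] theorem Irr.dual_dg (χ : Irr G) : χ.dual.dg = χ.dg := by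
  have h1 := χ.dual.one_eq
  rw [Irr.dual_apply, inv_one, χ.one_eq] at h1
  exact_mod_cast h1.symm

theorem NChar.inv {f : G → ℂ} (hf : NChar f) : NChar (fun g => f g⁻¹) := by
  refine ⟨?_, ?_⟩
  · intro a b
    have := hf.1 a⁻¹ b
    simp only
    rw [← this]; congr 1; group
  · intro χ
    refine ⟨mlt f χ.dual, ?_⟩
    rw [← hf.cip_eq_mlt, ← cip_inv_inv f]
    congr 1
    funext g
    simp [Irr.dual_apply]

theorem NChar.comp {H : Type} [Group H] [Fintype H] {f : G → ℂ} (hf : NChar f) (φ : H →* G) :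
    NChar (fun g => f (φ g)) := by
  have : (fun g => f (φ g)) = ∑ χ : Irr G, mlt f χ • (fun g => χ.1 (φ g)) := by
    funext g
    rw [hf.apply_eq]
    simp
  rw [this]
  exact NChar.sum _ fun χ _ => NChar.nsmul _ (χ.2.isChar.comp φ).nchar

/-- moving a factor across the form -/
theorem cip_mul_left (f h k : G → ℂ) : cip (f * h) k = cip h ((fun g => f g⁻¹) * k) := by
  unfold cip
  congr 1
  refine Finset.sum_congr rfl fun g _ => ?_
  simp only [Pi.mul_apply, inv_inv]
  ring

theorem NChar.eq_zero {f : G → ℂ} (hf : NChar f) (h : f 1 = 0) : f = 0 := by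
  rw [hf.one_eq] at h
  have h2 : ∑ χ : Irr G, mlt f χ * χ.dg = 0 := by exact_mod_cast h
  rw [Finset.sum_eq_zero_iff] at h2
  rw [hf.expand]
  refine Finset.sum_eq_zero fun χ hχ => ?_
  have := h2 χ hχ
  rw [Nat.mul_eq_zero] at this
  have h3 := χ.dg_pos
  rw [this.resolve_right (by omega)]
  simp

/-- removing a constituent -/
theorem NChar.sub_irr {f : G → ℂ} (hf : NChar f) (χ : Irr G) (h : cip f χ.1 ≠ 0) :
    NChar (f - χ.1) := by
  refine ⟨hf.1.sub χ.classFn, fun ψ => ?_⟩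
  rw [cip_sub_left, Irr.cip, hf.cip_eq_mlt]
  split_ifs with he
  · subst he
    rw [hf.cip_eq_mlt] at h
    have : 1 ≤ mlt f χ := Nat.one_le_iff_ne_zero.2 (by exact_mod_cast h)
    exact ⟨mlt f χ - 1, by push_cast [this]; rfl⟩
  · exact ⟨mlt f ψ, by simp⟩

theorem NChar.exists_constituent {f : G → ℂ} (hf : NChar f) (h : f ≠ 0) :
    ∃ χ : Irr G, cip f χ.1 ≠ 0 := by
  by_contra! h2
  exact h (classFn_eq_zero hf.1 fun χ hχ => h2 ⟨χ, hχ⟩)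

/-- a multiset of constituents -/
theorem NChar.exists_multiset {f : G → ℂ} (hf : NChar f) :
    ∃ s : Multiset (Irr G), f = (s.map (fun χ => χ.1)).sum := by
  refine ⟨∑ χ : Irr G, mlt f χ • {χ}, ?_⟩
  conv_lhs => rw [hf.expand]
  rw [← Multiset.coe_mapAddMonoidHom, map_sum, ← Multiset.coe_sumAddMonoidHom, map_sum]
  refine Finset.sum_congr rfl fun χ _ => ?_
  rw [map_nsmul, map_nsmul]
  simp

theorem nchar_multiset (s : Multiset (Irr G)) : NChar ((s.map (fun χ => χ.1)).sum) := by
  induction s using Multiset.induction_on with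
  | empty => simpa using NChar.zero
  | cons a s ih => simpa using a.nchar.add ih

open Classical in
theorem cip_multiset (s : Multiset (Irr G)) (χ : Irr G) :
    cip ((s.map (fun χ => χ.1)).sum) χ.1 = s.count χ := by
  induction s using Multiset.induction_on with
  | empty => simp [cip]
  | cons a s ih =>
    rw [Multiset.map_cons, Multiset.sum_cons, cip_add_left, ih, Irr.cip, Multiset.count_cons]
    push_cast
    rw [add_comm]
    congr 1
    by_cases h : χ = a
    · simp [h]
    · simp [h, Ne.symm h]

/-- Heredity to subgroups -/
theorem heredity (H : Subgroup G) [Fintype H] :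
    ∑ χ : Irr G, χ.dg ≤ H.index * ∑ ψ : Irr H, ψ.dg := by
  classical
  have hres : ∀ χ : Irr G, NChar (fun g : H => χ.1 (H.subtype g)) := fun χ => χ.nchar.comp _
  have h1 : ∀ ψ : Irr H, ∑ χ : Irr G, χ.dg * mlt (fun g : H => χ.1 (H.subtype g)) ψ =
      H.index * ψ.dg := by
    intro ψ
    have h2 : cip (∑ χ : Irr G, (χ.dg : ℂ) • (fun g : H => χ.1 (H.subtype g))) ψ.1 =
        H.index * ψ.dg := by
      have h3 : (∑ χ : Irr G, (χ.dg : ℂ) • (fun g : H => χ.1 (H.subtype g))) =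
         fun g : H => if g = 1 then (Nat.card G : ℂ) else 0 := by
        funext g
        have := sum_dg_mul (g : G)
        simp only [Finset.sum_apply, Pi.smul_apply, smul_eq_mul, Subgroup.coe_subtype]
        rw [this]
        simp
      rw [h3]
      simp only [cip, ite_mul, zero_mul]
      rw [Finset.sum_ite_eq' Finset.univ (1 : H)]
      have h4 : (Nat.card G : ℂ) = Nat.card H * H.index := by
        exact_mod_cast (Subgroup.card_mul_index H).symm
      simp only [Finset.mem_univ, if_true, inv_one, ψ.one_eq]
      rw [h4, mul_assoc, inv_mul_cancel_left₀ card_ne]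
    rw [cip_sum_left] at h2
    have : ((∑ χ : Irr G, χ.dg * mlt (fun g : H => χ.1 (H.subtype g)) ψ : ℕ) : ℂ) =
        ((H.index * ψ.dg : ℕ) : ℂ) := by
      push_cast
      rw [← h2]
      refine Finset.sum_congr rfl fun χ _ => ?_
      rw [cip_smul_left, (hres χ).cip_eq_mlt]
    exact_mod_cast this
  rw [Finset.mul_sum]
  calc ∑ χ : Irr G, χ.dg ≤ ∑ χ : Irr G, χ.dg * ∑ ψ : Irr H, mlt (fun g : H => χ.1 (H.subtype g)) ψ := by
        refine Finset.sum_le_sum fun χ _ => ?_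
        refine Nat.le_mul_of_pos_right _ ?_
        obtain ⟨ψ, hψ⟩ := (hres χ).exists_constituent (by
          intro h0
          have h1 := congrFun h0 1
          simp only [map_one, χ.one_eq, Pi.zero_apply] at h1
          have := χ.dg_pos
          have h2 : χ.dg = 0 := by exact_mod_cast h1
          omega)
        rw [(hres χ).cip_eq_mlt] at hψ
        have hψ' : mlt (fun g : H => χ.1 (H.subtype g)) ψ ≠ 0 := by exact_mod_cast hψ
        exact lt_of_lt_of_le (Nat.pos_of_ne_zero hψ')
          (Finset.single_le_sum (f := fun ψ => mlt (fun g : H => χ.1 (H.subtype g)) ψ)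
            (fun _ _ => Nat.zero_le _) (Finset.mem_univ ψ))
    _ = ∑ ψ : Irr H, ∑ χ : Irr G, χ.dg * mlt (fun g : H => χ.1 (H.subtype g)) ψ := by
        rw [Finset.sum_comm]
        exact Finset.sum_congr rfl fun χ _ => by rw [Finset.mul_sum]
    _ = ∑ ψ : Irr H, H.index * ψ.dg := Finset.sum_congr rfl fun ψ _ => h1 ψ

end NCharSec

open CategoryTheory
set_option linter.unusedSectionVars false

section LinAlg
variable {V : Type} [AddCommGroup V] [Module ℂ V] [FiniteDimensional ℂ V]

theorem charpoly_root_pow {A : Module.End ℂ V} {n : ℕ} (hA : A ^ n = 1) {μ : ℂ}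
    (hμ : μ ∈ A.charpoly.roots) : μ ^ n = 1 := by
  rw [Polynomial.mem_roots (LinearMap.charpoly_monic A).ne_zero,
    ← Module.End.hasEigenvalue_iff_isRoot_charpoly] at hμ
  obtain ⟨v, hv⟩ := hμ.exists_hasEigenvector
  have h1 := hv.pow_apply n
  rw [hA] at h1
  have h2 : (μ ^ n - 1) • v = 0 := by rw [sub_smul, ← h1]; simp
  rcases smul_eq_zero.1 h2 with h | h
  · exact sub_eq_zero.1 h
  · exact absurd h hv.2

theorem trace_eq_roots (A : Module.End ℂ V) : LinearMap.trace ℂ V A = A.charpoly.roots.sum :=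
  Module.End.trace_eq_sum_roots_charpoly_of_splits (IsAlgClosed.splits _)

theorem det_eq_roots (A : Module.End ℂ V) : LinearMap.det A = A.charpoly.roots.prod :=
  Module.End.det_eq_prod_roots_charpoly_of_splits (IsAlgClosed.splits _)

theorem card_charpoly_roots (A : Module.End ℂ V) :
    Multiset.card A.charpoly.roots = Module.finrank ℂ V := by
  rw [← Polynomial.Splits.natDegree_eq_card_roots (IsAlgClosed.splits _),
    LinearMap.charpoly_natDegree]

theorem eq_one_of_roots {A : Module.End ℂ V} {n : ℕ} (hn : n ≠ 0) (hA : A ^ n = 1)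
    (h : ∀ μ ∈ A.charpoly.roots, μ = 1) : A = 1 := by
  have h1 : A.charpoly = (Polynomial.X - Polynomial.C 1) ^ (Module.finrank ℂ V) := by
    have := (IsAlgClosed.splits A.charpoly).eq_prod_roots_of_monic (LinearMap.charpoly_monic A)
    rw [Multiset.eq_replicate.2 ⟨card_charpoly_roots A, h⟩] at this
    simpa using this
  have h2 : IsNilpotent (A - 1) := by
    refine ⟨Module.finrank ℂ V, ?_⟩
    have := LinearMap.aeval_self_charpoly A
    rw [h1] at this
    simpa using this
  have h3 : A.IsSemisimple := by
    refine Module.End.isSemisimple_of_squarefree_aeval_eq_zero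
      (p := Polynomial.X ^ n - 1) ?_ (by simp [hA])
    exact (Polynomial.X_pow_sub_one_separable_iff.2 (by exact_mod_cast hn)).squarefree
  have h4 : (A - algebraMap ℂ _ 1).IsSemisimple :=
    Module.End.isSemisimple_sub_algebraMap_iff.2 h3
  rw [map_one] at h4
  exact sub_eq_zero.1 (Module.End.eq_zero_of_isNilpotent_isSemisimple h2 h4)

theorem multiset_re_eq (s : Multiset ℂ) (h : ∀ μ ∈ s, ‖μ‖ = 1) :
    s.sum.re ≤ Multiset.card s ∧ (s.sum.re = Multiset.card s → ∀ μ ∈ s, μ = 1) := by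
  induction s using Multiset.induction_on with
  | empty => simp
  | cons a s ih =>
    have ih' := ih fun μ hμ => h μ (by simp [hμ])
    have ha : ‖a‖ = 1 := h a (by simp)
    have ha2 : a.re ≤ 1 := ha ▸ Complex.re_le_norm a
    refine ⟨?_, ?_⟩
    · simp only [Multiset.sum_cons, Complex.add_re, Multiset.card_cons, Nat.cast_add, Nat.cast_one]
      linarith [ih'.1]
    · simp only [Multiset.sum_cons, Complex.add_re, Multiset.card_cons, Nat.cast_add, Nat.cast_one]
      intro h2 μ hμ
      have h3 : a.re = 1 := by linarith [ih'.1]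
      have h4 : s.sum.re = Multiset.card s := by linarith
      rcases Multiset.mem_cons.1 hμ with rfl | hμ
      · have h5 := Complex.sq_norm_sub_sq_re μ
        rw [ha, h3] at h5
        have h6 : μ.im = 0 := by nlinarith
        exact Complex.ext (by simpa using h3) (by simpa using h6)
      · exact ih'.2 h4 μ hμ

theorem eq_one_of_trace {A : Module.End ℂ V} {n : ℕ} (hn : n ≠ 0) (hA : A ^ n = 1)
    (h : LinearMap.trace ℂ V A = Module.finrank ℂ V) : A = 1 := by
  apply eq_one_of_roots hn hA
  apply (multiset_re_eq _ _).2
  · rw [← trace_eq_roots, h, card_charpoly_roots]; simp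
  · intro μ hμ
    exact Complex.norm_eq_one_of_pow_eq_one (charpoly_root_pow hA hμ) hn

theorem multiset_pm (s : Multiset ℂ) (h : ∀ μ ∈ s, μ = 1 ∨ μ = -1) :
    ∃ m : ℕ, m ≤ Multiset.card s ∧ s.sum = Multiset.card s - 2 * m ∧ s.prod = (-1) ^ m ∧
      (m = 0 → ∀ μ ∈ s, μ = 1) := by
  induction s using Multiset.induction_on with
  | empty => exact ⟨0, by simp⟩
  | cons a s ih =>
    obtain ⟨m, h1, h2, h3, h4⟩ := ih fun μ hμ => h μ (by simp [hμ])
    rcases h a (by simp) with rfl | rfl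
    · refine ⟨m, by simp; omega, ?_, by simp [h3], ?_⟩
      · simp [h2]; ring
      · intro hm μ hμ
        rcases Multiset.mem_cons.1 hμ with rfl | hμ
        · rfl
        · exact h4 hm μ hμ
    · refine ⟨m + 1, by simp; omega, ?_, ?_, by simp⟩
      · simp [h2]; ring
      · simp [h3, pow_succ]

theorem involution_trace {A : Module.End ℂ V} (hA : A * A = 1) :
    ∃ m : ℕ, m ≤ Module.finrank ℂ V ∧ LinearMap.trace ℂ V A = Module.finrank ℂ V - 2 * m ∧
      LinearMap.det A = (-1) ^ m ∧ (m = 0 → A = 1) := by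
  have hA2 : A ^ 2 = 1 := by rw [pow_two, hA]
  obtain ⟨m, h1, h2, h3, h4⟩ := multiset_pm A.charpoly.roots (by
    intro μ hμ
    have := charpoly_root_pow hA2 hμ
    rcases mul_eq_zero.1 (show (μ - 1) * (μ + 1) = 0 by linear_combination this) with h | h
    · exact Or.inl (sub_eq_zero.1 h)
    · exact Or.inr (eq_neg_of_add_eq_zero_left h))
  rw [card_charpoly_roots] at h1 h2
  exact ⟨m, h1, by rw [trace_eq_roots, h2], by rw [det_eq_roots, h3],
    fun hm => eq_one_of_roots two_ne_zero hA2 (h4 hm)⟩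

theorem isIntegral_trace {A : Module.End ℂ V} {n : ℕ} (hn : n ≠ 0) (hA : A ^ n = 1) :
    IsIntegral ℤ (LinearMap.trace ℂ V A) := by
  rw [trace_eq_roots]
  apply IsIntegral.multiset_sum
  intro μ hμ
  refine IsIntegral.of_pow (Nat.pos_of_ne_zero hn) ?_
  rw [charpoly_root_pow hA hμ]
  exact isIntegral_one

end LinAlg

section Values
variable {G : Type} [Group G] [Fintype G]

theorem rho_pow_card (V : FDRep ℂ G) (g : G) : (V.ρ g) ^ (Nat.card G) = 1 := by
  rw [← map_pow, pow_card_eq_one', map_one]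

theorem IsChar.isIntegral {θ : G → ℂ} (h : IsChar θ) (g : G) : IsIntegral ℤ (θ g) := by
  obtain ⟨V, rfl⟩ := h
  exact isIntegral_trace (Nat.card_pos (α := G)).ne' (rho_pow_card V g)

theorem NChar.isIntegral {θ : G → ℂ} (h : NChar θ) (g : G) : IsIntegral ℤ (θ g) := by
  rw [h.apply_eq]
  refine IsIntegral.sum _ fun χ _ => ?_
  exact IsIntegral.mul (isIntegral_algebraMap (R := ℤ) (x := (mlt θ χ : ℤ))) (χ.2.isChar.isIntegral g)

theorem rho_eq_one (V : FDRep ℂ G) (g : G) (h : V.character g = V.character 1) : V.ρ g = 1 := by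
  refine eq_one_of_trace (Nat.card_pos (α := G)).ne' (rho_pow_card V g) ?_
  rw [FDRep.char_one] at h
  exact h

theorem IsChar.ker_mul {θ : G → ℂ} (hθ : IsChar θ) {g : G} (h : θ g = θ 1) (x : G) :
    θ (x * g) = θ x := by
  obtain ⟨V, rfl⟩ := hθ
  have := rho_eq_one V g h
  simp [FDRep.character, map_mul, this]

/-- the kernel of a character -/
def IsChar.ker {θ : G → ℂ} (hθ : IsChar θ) : Subgroup G where
  carrier := {g | θ g = θ 1}
  one_mem' := rfl
  mul_mem' := by
    intro a b ha hb
    exact (hθ.ker_mul hb a).trans ha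
  inv_mem' := by
    intro a ha
    have := hθ.ker_mul ha a⁻¹
    rw [inv_mul_cancel] at this
    exact this.symm

theorem IsChar.mem_ker {θ : G → ℂ} (hθ : IsChar θ) {g : G} : g ∈ hθ.ker ↔ θ g = θ 1 := Iff.rfl

instance IsChar.ker_normal {θ : G → ℂ} (hθ : IsChar θ) : hθ.ker.Normal := by
  refine ⟨fun n hn g => ?_⟩
  rw [IsChar.mem_ker] at *
  rw [hθ.isClassFn, hn]

/-- perfect groups have trivial homs to abelian groups -/
theorem perfect_hom {A : Type*} [CommGroup A] (hp : commutator G = ⊤) (f : G →* A) (g : G) :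
    f g = 1 := by
  have h := Abelianization.commutator_subset_ker f
  rw [hp] at h
  exact h (Subgroup.mem_top g)

theorem perfect_det (hp : commutator G = ⊤) (V : FDRep ℂ G) (g : G) : LinearMap.det (V.ρ g) = 1 := by
  have h := perfect_hom hp (((LinearMap.det).comp V.ρ).toHomUnits) g
  have := congrArg Units.val h
  simpa using this

theorem Irr.exists_rep (χ : Irr G) : ∃ V : FDRep ℂ G, χ.1 = V.character ∧
    Module.finrank ℂ V = χ.dg := by
  obtain ⟨V, hV, h⟩ := χ.2
  refine ⟨V, h, ?_⟩
  have h1 := χ.one_eq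
  rw [h, FDRep.char_one] at h1
  exact_mod_cast h1

theorem scalar_of_finrank_one {V : Type} [AddCommGroup V] [Module ℂ V] (h : Module.finrank ℂ V = 1)
    (A : Module.End ℂ V) : A = LinearMap.trace ℂ V A • 1 := by
  have : FiniteDimensional ℂ V := Module.finite_of_finrank_eq_succ h
  obtain ⟨v, hv, hs⟩ := finrank_eq_one_iff'.1 h
  obtain ⟨c, hc⟩ := hs (A v)
  have hA : A = c • 1 := by
    ext w
    obtain ⟨d, rfl⟩ := hs w
    rw [map_smul, ← hc, LinearMap.smul_apply, Module.End.one_apply, smul_comm]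
  rw [hA, map_smul]
  simp [h]

theorem perfect_dg_one (hp : commutator G = ⊤) (χ : Irr G) (h : χ.dg = 1) : χ = Irr.triv := by
  obtain ⟨V, hV, hd⟩ := χ.exists_rep
  apply Irr.ext
  funext g
  rw [h] at hd
  have h1 := scalar_of_finrank_one hd (V.ρ g)
  have h2 := perfect_det hp V g
  rw [h1, LinearMap.det_smul, hd] at h2
  rw [hV, Irr.triv_apply]
  simpa [FDRep.character] using h2

/-- involution values for irreducible characters of perfect groups -/
theorem Irr.involution (hp : commutator G = ⊤) (χ : Irr G) (x : G) (hx : χ.1 (x * x) = χ.dg) :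
    ∃ m : ℕ, 2 * m ≤ χ.dg ∧ χ.1 x = χ.dg - 4 * m ∧ (m = 0 → χ.1 x = χ.dg) := by
  obtain ⟨V, hV, hd⟩ := χ.exists_rep
  have hx2 : V.ρ x * V.ρ x = 1 := by
    rw [← map_mul]
    apply rho_eq_one
    rw [← hV, hx, χ.one_eq]
  obtain ⟨m, h1, h2, h3, h4⟩ := involution_trace hx2
  rw [perfect_det hp] at h3
  have heven : Even m := by
    by_contra ho
    rw [Nat.not_even_iff_odd] at ho
    rw [ho.neg_one_pow] at h3
    norm_num at h3
  obtain ⟨k, rfl⟩ := heven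
  refine ⟨k, by omega, ?_, ?_⟩
  · have : χ.1 x = _ := (congrFun hV x).trans h2
    rw [this, hd]; push_cast; ring
  · intro hk
    have : V.ρ x = 1 := h4 (by omega)
    rw [hV, ← χ.one_eq, hV]
    simp [FDRep.character, this]

/-- central elements act by scalars -/
theorem central_scalar (χ : Irr G) (z : G) (hz : z ∈ Subgroup.center G) :
    ∃ V : FDRep ℂ G, χ.1 = V.character ∧ Module.finrank ℂ V = χ.dg ∧
      ∃ c : ℂ, V.ρ z = c • 1 := by
  obtain ⟨V, hV, h⟩ := χ.2
  have h1 := χ.one_eq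
  rw [h, FDRep.char_one] at h1
  refine ⟨V, h, by exact_mod_cast h1, ?_⟩
  have h2 := finrank_endomorphism_simple_eq_one ℂ V
  let A : V ⟶ V := ⟨FGModuleCat.ofHom (V.ρ z), by
    intro g
    ext v
    have := congrArg (fun B : Module.End ℂ V => B v) (congrArg V.ρ (Subgroup.mem_center_iff.1 hz g))
    simp only [map_mul] at this
    exact this.symm⟩
  have hid : (𝟙 V : V ⟶ V) ≠ 0 := id_nonzero V
  obtain ⟨c, hc⟩ := (finrank_eq_one_iff_of_nonzero' _ hid).1 h2 A
  refine ⟨c, ?_⟩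
  have h3 := congrArg (fun B : V ⟶ V => B.hom.hom.hom) hc
  exact h3.symm

end Values

open CategoryTheory
set_option linter.unusedSectionVars false
set_option linter.unusedSimpArgs false

section CommProb
open Classical in
/-- number of commuting pairs over a pair of elements of the quotient -/
noncomputable def cc {G Q : Type} [Group G] [Group Q] [Fintype G] (π : G →* Q) (X Y : Q) : ℕ :=
  (Finset.univ.filter (fun p : G × G => π p.1 = X ∧ π p.2 = Y ∧ Commute p.1 p.2)).card

variable {G Q : Type} [Group G] [Group Q] [Fintype G] (π : G →* Q)

theorem cc_comm (X Y : Q) : cc π X Y = cc π Y X := by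
  classical
  unfold cc
  apply Finset.card_bij (fun p _ => (p.2, p.1))
  · intro a ha; simp at ha ⊢; exact ⟨ha.2.1, ha.1, ha.2.2.symm⟩
  · intro a ha b hb h; simp at h; ext <;> simp [h]
  · intro b hb; simp at hb; exact ⟨(b.2, b.1), by simp; exact ⟨hb.2.1, hb.1, hb.2.2.symm⟩, rfl⟩

theorem cc_zero {X Y : Q} (h : ¬ Commute X Y) : cc π X Y = 0 := by
  classical
  unfold cc
  rw [Finset.card_eq_zero, Finset.filter_eq_empty_iff]
  rintro p - ⟨h1, h2, h3⟩
  exact h (h1 ▸ h2 ▸ h3.map π)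

open Classical in
theorem cc_eq_sum (X Y : Q) : cc π X Y = ∑ x ∈ Finset.univ.filter (fun x => π x = X),
    (Finset.univ.filter (fun y => π y = Y ∧ Commute x y)).card := by
  unfold cc
  rw [← Finset.card_sigma]
  apply Finset.card_bij (fun p _ => ⟨p.1, p.2⟩)
  · intro a ha; simpa using ha
  · intro a ha b hb h; simp at h; ext <;> simp [h]
  · intro b hb; simp at hb; exact ⟨(b.1, b.2), by simpa using hb, rfl⟩

open Classical in
theorem fib_le (x : G) (Y : Q) : (Finset.univ.filter (fun y => π y = Y ∧ Commute x y)).card ≤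
    (Finset.univ.filter (fun y => π y = 1 ∧ Commute x y)).card := by
  by_cases h : (Finset.univ.filter (fun y => π y = Y ∧ Commute x y)).Nonempty
  · obtain ⟨y0, hy0⟩ := h
    simp at hy0
    apply Finset.card_le_card_of_injOn (fun y => y0⁻¹ * y)
    · intro y hy
      simp at hy ⊢
      exact ⟨by rw [hy.1, hy0.1]; simp, hy0.2.inv_right.mul_right hy.2⟩
    · intro a _ b _ h; simpa using h
  · rw [Finset.not_nonempty_iff_eq_empty] at h
    rw [h]; simp

theorem cc_le_one (X Y : Q) : cc π X Y ≤ cc π X 1 := by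
  classical
  rw [cc_eq_sum, cc_eq_sum]
  exact Finset.sum_le_sum fun x _ => fib_le π x Y

theorem cc_le (X Y : Q) : cc π X Y ≤ cc π 1 1 :=
  (cc_le_one π X Y).trans (by rw [cc_comm]; exact cc_le_one π 1 X)

theorem fib_card (x : G) : (open Classical in (Finset.univ.filter (fun y => π y = 1 ∧ Commute x y)).card)
    = Nat.card ↥(Subgroup.centralizer {x} ⊓ π.ker) := by
  classical
  rw [← Fintype.card_subtype, Nat.card_eq_fintype_card]
  apply Fintype.card_congr
  apply Equiv.subtypeEquivRight
  intro y
  rw [Subgroup.mem_inf, Subgroup.mem_centralizer_singleton_iff, MonoidHom.mem_ker]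
  constructor
  · rintro ⟨a, b⟩; exact ⟨b.symm, a⟩
  · rintro ⟨a, b⟩; exact ⟨b, Commute.symm a⟩

theorem fib_one (hπ : Function.Surjective π) (X : Q) :
    (open Classical in (Finset.univ.filter (fun y => π y = X)).card) = Nat.card π.ker := by
  classical
  rw [MonoidHom.card_fiber_eq_of_mem_range π (hπ X) (hπ 1), ← Fintype.card_subtype,
    Nat.card_eq_fintype_card]
  apply Fintype.card_congr
  apply Equiv.subtypeEquivRight
  intro y; rw [MonoidHom.mem_ker]

/-- index bound -/
theorem cc_bound (hπ : Function.Surjective π) (X : Q) (i : ℕ)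
    (h : ∀ x, π x = X → i * Nat.card ↥(Subgroup.centralizer {x} ⊓ π.ker) ≤ Nat.card π.ker) :
    i * cc π X 1 ≤ Nat.card π.ker ^ 2 := by
  classical
  rw [cc_eq_sum, Finset.mul_sum, sq]
  calc _ ≤ ∑ x ∈ Finset.univ.filter (fun x => π x = X), Nat.card π.ker := by
        apply Finset.sum_le_sum
        intro x hx
        simp at hx
        have := fib_card π x
        refine le_trans (le_of_eq ?_) (h x hx)
        rw [← this]
    _ = _ := by
        rw [Finset.sum_const, smul_eq_mul, ← fib_one π hπ X]

open Classical in
theorem commProb_eq_pairs (H : Type) [Group H] [Fintype H] : commProb H =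
    ((Finset.univ.filter (fun p : H × H => Commute p.1 p.2)).card : ℚ) / (Nat.card H : ℚ)^2 := by
  rw [commProb_def, Nat.card_eq_fintype_card, Fintype.card_subtype]

theorem cc_one_one : (cc π 1 1 : ℚ) = commProb π.ker * (Nat.card π.ker : ℚ)^2 := by
  classical
  rw [commProb_eq_pairs, div_mul_cancel₀]
  · norm_cast
    unfold cc
    symm
    apply Finset.card_bij (fun (p : π.ker × π.ker) _ => ((p.1 : G), (p.2 : G)))
    · intro a ha; simp at ha ⊢
      exact ⟨MonoidHom.mem_ker.1 a.1.2, MonoidHom.mem_ker.1 a.2.2, ha⟩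
    · intro a ha b hb h; simp at h; ext <;> simp [h]
    · intro b hb; simp at hb
      refine ⟨(⟨b.1, MonoidHom.mem_ker.2 hb.1⟩, ⟨b.2, MonoidHom.mem_ker.2 hb.2.1⟩), ?_, rfl⟩
      simp
      exact Subtype.ext hb.2.2
  · exact pow_ne_zero _ (Nat.cast_ne_zero.2 Nat.card_pos.ne')

theorem comm_sum [Fintype Q] (hπ : Function.Surjective π) : commProb G * (Nat.card Q : ℚ)^2 =
    ∑ p : Q × Q, (cc π p.1 p.2 : ℚ) / (Nat.card π.ker : ℚ)^2 := by
  classical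
  have hc : (Nat.card G : ℚ) = Nat.card Q * Nat.card π.ker := by
    rw [← Subgroup.card_mul_index π.ker, Subgroup.index_ker, MonoidHom.range_eq_top.2 hπ]
    simp [mul_comm]
  rw [← Finset.sum_div, commProb_eq_pairs, hc]
  have h1 : (Nat.card Q : ℚ) ≠ 0 := Nat.cast_ne_zero.2 Nat.card_pos.ne'
  have h2 : (Nat.card π.ker : ℚ) ≠ 0 := Nat.cast_ne_zero.2 Nat.card_pos.ne'
  field_simp
  norm_cast
  rw [Finset.card_eq_sum_card_fiberwise (f := fun p : G × G => (π p.1, π p.2)) (t := Finset.univ)]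
  · apply Finset.sum_congr rfl
    intro p _
    unfold cc
    congr 1
    ext q
    simp [Prod.ext_iff]; tauto
  · intro _ _; simp

theorem gallagher [Fintype Q] (hπ : Function.Surjective π) :
    commProb G ≤ commProb Q * commProb π.ker := by
  classical
  have h1 : (0:ℚ) < Nat.card Q := by exact_mod_cast Nat.card_pos
  have h2 : (0:ℚ) < Nat.card π.ker := by exact_mod_cast Nat.card_pos
  rw [← mul_le_mul_iff_left₀ (pow_pos h1 2), comm_sum π hπ, commProb_eq_pairs Q]
  have : ∑ p : Q × Q, (cc π p.1 p.2 : ℚ) / (Nat.card π.ker : ℚ)^2 ≤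
      ∑ p : Q × Q, if Commute p.1 p.2 then commProb π.ker else 0 := by
    apply Finset.sum_le_sum
    intro p _
    split_ifs with h
    · rw [div_le_iff₀ (pow_pos h2 2), ← cc_one_one]
      exact_mod_cast cc_le π _ _
    · simp [cc_zero π h]
  refine this.trans (le_of_eq ?_)
  rw [← Finset.sum_filter, Finset.sum_const, nsmul_eq_mul]
  field_simp

theorem gallagher_quot [Fintype Q] (hπ : Function.Surjective π) : commProb G ≤ commProb Q :=
  (gallagher π hπ).trans (mul_le_of_le_one_right (commProb_pos Q).le (commProb_le_one _))

theorem half_bound [Fintype Q] (hπ : Function.Surjective π)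
    (h2 : ∀ X, X ≠ 1 → 2 * cc π X 1 ≤ Nat.card π.ker ^ 2)
    (X0 : Q) (hX0 : X0 ≠ 1) (h3 : 3 * cc π X0 1 ≤ Nat.card π.ker ^ 2) :
    commProb G ≤ commProb Q / 2 := by
  classical
  have p1 : (0:ℚ) < Nat.card Q := by exact_mod_cast Nat.card_pos
  have p2 : (0:ℚ) < (Nat.card π.ker : ℚ)^2 := by have := Nat.card_pos (α := π.ker); positivity
  rw [← mul_le_mul_iff_left₀ (pow_pos p1 2), comm_sum π hπ, commProb_eq_pairs Q]
  have b1 : ∀ X Y, (cc π X Y : ℚ) / (Nat.card π.ker : ℚ)^2 ≤ 1 := by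
    intro X Y
    rw [div_le_one p2]
    refine le_trans (Nat.cast_le.2 (cc_le π X Y)) ?_
    rw [cc_one_one]
    exact mul_le_of_le_one_left p2.le (commProb_le_one _)
  have b2 : ∀ X Y, X ≠ 1 → (cc π X Y : ℚ) / (Nat.card π.ker : ℚ)^2 ≤ 1/2 := by
    intro X Y h
    rw [div_le_iff₀ p2]
    have := h2 X h
    have h' := cc_le_one π X Y
    have : (2 * cc π X Y : ℚ) ≤ (Nat.card π.ker : ℚ)^2 := by exact_mod_cast (by omega)
    linarith
  have b3 : ∀ Y, (cc π X0 Y : ℚ) / (Nat.card π.ker : ℚ)^2 ≤ 1/3 := by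
    intro Y
    rw [div_le_iff₀ p2]
    have h' := cc_le_one π X0 Y
    have : (3 * cc π X0 Y : ℚ) ≤ (Nat.card π.ker : ℚ)^2 := by exact_mod_cast (by omega)
    linarith
  have : ∑ p : Q × Q, (cc π p.1 p.2 : ℚ) / (Nat.card π.ker : ℚ)^2 ≤
      ∑ p : Q × Q, ((if Commute p.1 p.2 then (1/2:ℚ) else 0) + (if p = (1,1) then (1/2:ℚ) else 0)
        - (if p = (X0,1) then (1/6:ℚ) else 0) - (if p = (1,X0) then (1/6:ℚ) else 0)
        - (if p = (X0,X0) then (1/6:ℚ) else 0)) := by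
    apply Finset.sum_le_sum
    rintro ⟨X, Y⟩ _
    by_cases h : Commute X Y
    · by_cases hX : X = 1
      · by_cases hY : Y = 1
        · subst hX; subst hY
          have := b1 1 1
          simp [hX0, hX0.symm]; norm_num; simpa using this
        · subst hX
          by_cases hY0 : Y = X0
          · subst hY0
            have := b3 1
            rw [cc_comm] at this
            simp [hX0, hX0.symm]; norm_num at this ⊢; simpa using this
          · have := b2 Y 1 hY
            rw [cc_comm] at this
            simp [hX0.symm, hY, hY0]; norm_num at this ⊢; simpa using this
      · by_cases hXX : X = X0
        · subst hXX
          by_cases hY : Y = 1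
          · subst hY
            have := b3 1
            simp [hX0, hX0.symm]; norm_num at this ⊢; simpa using this
          · by_cases hY0 : Y = X
            · subst hY0
              have := b3 Y
              simp [hX0]; norm_num at this ⊢; simpa using this
            · have := b2 X Y hX0
              simp [hX0, hY, hY0, h]; norm_num at this ⊢; simpa using this
        · have := b2 X Y hX
          simp [hX, hXX, h]; norm_num at this ⊢; simpa using this
    · rw [cc_zero π h]
      have e1 : (X, Y) ≠ (1, 1) := by
        intro e; rw [Prod.mk.injEq] at e; apply h; rw [e.1]; exact Commute.one_left _
      have e2 : (X, Y) ≠ (X0, 1) := by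
        intro e; rw [Prod.mk.injEq] at e; apply h; rw [e.2]; exact Commute.one_right _
      have e3 : (X, Y) ≠ (1, X0) := by
        intro e; rw [Prod.mk.injEq] at e; apply h; rw [e.1]; exact Commute.one_left _
      have e4 : (X, Y) ≠ (X0, X0) := by
        intro e; rw [Prod.mk.injEq] at e; apply h; rw [e.1, e.2]
      rw [if_neg e1, if_neg e2, if_neg e3, if_neg e4]
      simp [h]
  refine this.trans (le_of_eq ?_)
  rw [Finset.sum_sub_distrib, Finset.sum_sub_distrib, Finset.sum_sub_distrib,
    Finset.sum_add_distrib, ← Finset.sum_filter, Finset.sum_const, nsmul_eq_mul]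
  simp only [Finset.sum_ite_eq', Finset.mem_univ, if_true]
  field_simp
  ring

theorem third_bound [Fintype Q] (hπ : Function.Surjective π) (hQ : 2 ≤ Nat.card Q)
    (h3 : ∀ X, X ≠ 1 → 3 * cc π X 1 ≤ Nat.card π.ker ^ 2) :
    commProb G ≤ 1 / 2 := by
  classical
  have p1 : (2:ℚ) ≤ Nat.card Q := by exact_mod_cast hQ
  have p2 : (0:ℚ) < (Nat.card π.ker : ℚ)^2 := by have := Nat.card_pos (α := π.ker); positivity
  rw [← mul_le_mul_iff_left₀ (pow_pos (lt_of_lt_of_le two_pos p1) 2), comm_sum π hπ]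
  have b1 : ∀ X Y, (cc π X Y : ℚ) / (Nat.card π.ker : ℚ)^2 ≤ 1 := by
    intro X Y
    rw [div_le_one p2]
    refine le_trans (Nat.cast_le.2 (cc_le π X Y)) ?_
    rw [cc_one_one]
    exact mul_le_of_le_one_left p2.le (commProb_le_one _)
  have b3 : ∀ X Y, X ≠ 1 → (cc π X Y : ℚ) / (Nat.card π.ker : ℚ)^2 ≤ 1/3 := by
    intro X Y h
    rw [div_le_iff₀ p2]
    have := h3 X h
    have h' := cc_le_one π X Y
    have : (3 * cc π X Y : ℚ) ≤ (Nat.card π.ker : ℚ)^2 := by exact_mod_cast (by omega)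
    linarith
  have : ∑ p : Q × Q, (cc π p.1 p.2 : ℚ) / (Nat.card π.ker : ℚ)^2 ≤
      ∑ p : Q × Q, ((1/3 : ℚ) + (if p = (1,1) then (2/3:ℚ) else 0)) := by
    apply Finset.sum_le_sum
    rintro ⟨X, Y⟩ _
    by_cases hX : X = 1
    · by_cases hY : Y = 1
      · subst hX; subst hY
        have := b1 1 1
        simp; norm_num; simpa using this
      · have := b3 Y X hY
        rw [cc_comm] at this
        simp [hY]; norm_num at this ⊢; simpa using this
    · have := b3 X Y hX
      simp [hX]; norm_num at this ⊢; simpa using this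
  refine this.trans ?_
  rw [Finset.sum_add_distrib, Finset.sum_const, nsmul_eq_mul]
  simp only [Finset.sum_ite_eq', Finset.mem_univ, if_true, Finset.card_univ, Fintype.card_prod]
  rw [Nat.card_eq_fintype_card] at p1 ⊢
  push_cast
  nlinarith

/-- Lemma A -/
theorem index_bound {N V : Subgroup G} (hVN : V ≤ N) (x : G) (k : ℕ)
    (hk : k ≤ (Subgroup.centralizer {x}).relIndex V) :
    k * Nat.card ↥(Subgroup.centralizer {x} ⊓ N) ≤ Nat.card N := by
  have h1 := Subgroup.relIndex_le_of_le_right (H := Subgroup.centralizer {x}) hVN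
    (Subgroup.index_ne_zero_of_finite)
  have h2 : Nat.card ↥(Subgroup.centralizer {x} ⊓ N) * (Subgroup.centralizer {x}).relIndex N
      = Nat.card N := by
    rw [← Subgroup.inf_relIndex_right, ← Subgroup.relIndex_bot_left,
      ← Subgroup.relIndex_bot_left]
    exact Subgroup.relIndex_mul_relIndex _ _ _ bot_le inf_le_right
  rw [← h2, mul_comm]
  exact Nat.mul_le_mul_left _ (hk.trans h1)

theorem relIndex_two (V : Subgroup G) (x : G)
    (hx : x ∉ Subgroup.centralizer (V : Set G)) : 2 ≤ (Subgroup.centralizer {x}).relIndex V := by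
  have h0 : (Subgroup.centralizer {x}).relIndex V ≠ 0 := Subgroup.index_ne_zero_of_finite
  have h1 : (Subgroup.centralizer {x}).relIndex V ≠ 1 := by
    rw [Ne, Subgroup.relIndex_eq_one]
    intro h
    apply hx
    rw [Subgroup.mem_centralizer_iff]
    intro v hv
    exact Subgroup.mem_centralizer_singleton_iff.1 (h hv)
  omega

theorem relIndex_three (V : Subgroup G) [V.Normal] (hV : ∀ v ∈ V, ∀ w ∈ V, v * w = w * v) (x : G)
    (hx : x * x ∉ Subgroup.centralizer (V : Set G)) :
    3 ≤ (Subgroup.centralizer {x}).relIndex V := by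
  have h2 := relIndex_two V x (fun h => hx (mul_mem h h))
  by_contra hlt
  have he : ((Subgroup.centralizer {x}).subgroupOf V).index = 2 := by
    change (Subgroup.centralizer {x}).relIndex V = 2; omega
  apply hx
  rw [Subgroup.mem_centralizer_iff]
  intro v hv
  by_cases hvx : v * x = x * v
  · rw [← mul_assoc, hvx, mul_assoc, hvx, mul_assoc]
  · have hw : x * v * x⁻¹ ∈ V := Subgroup.Normal.conj_mem inferInstance v hv x
    have key := (Subgroup.mul_mem_iff_of_index_two he (a := (⟨v, hv⟩ : V)⁻¹) (b := ⟨x * v * x⁻¹, hw⟩)).2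
      (by
        rw [Subgroup.mem_subgroupOf, Subgroup.mem_subgroupOf, Subgroup.mem_centralizer_singleton_iff,
          Subgroup.mem_centralizer_singleton_iff]
        apply iff_of_false
        · intro h
          apply hvx
          have := (Commute.inv_left_iff (a := v) (b := x)).1 h
          exact this
        · intro h
          simp at h
          exact hvx (by nth_rw 1 [h]; group))
    have key2 := (Subgroup.mul_mem_iff_of_index_two he (a := (⟨v, hv⟩ : V)) (b := ⟨v, hv⟩)).2 Iff.rfl
    rw [Subgroup.mem_subgroupOf, Subgroup.mem_centralizer_singleton_iff] at key key2
    simp only [Subgroup.coe_mul, Subgroup.coe_inv] at key key2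
    -- c = v⁻¹ x v x⁻¹
    set c := v⁻¹ * (x * v * x⁻¹) with hc
    have hcV : c ∈ V := mul_mem (inv_mem hv) hw
    have e1 : x * v = v * c * x := by rw [hc]; group
    have hvc := hV v hv c hcV
    have e2 : x * (v * v) = v * v * (c * c) * x := by
      rw [← mul_assoc, e1, mul_assoc (v*c), e1]
      calc v * c * (v * c * x) = v * (c * v) * c * x := by group
        _ = _ := by rw [← hvc]; group
    have e3 : c * c = 1 := by
      rw [← key2] at e2
      have := mul_right_cancel e2
      simpa using this
    calc v * (x * x) = v * (c * c) * (x * x) := by rw [e3]; simp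
      _ = v * c * (c * x) * x := by group
      _ = v * c * (x * c) * x := by rw [key]
      _ = (v * c * x) * c * x := by group
      _ = (x * v) * c * x := by rw [e1]
      _ = x * (v * c * x) := by simp only [mul_assoc]
      _ = x * x * v := by rw [← e1]; simp only [mul_assoc]

theorem commProb_five_eighths (h : 5/8 < commProb G) : ∀ x y : G, x * y = y * x := by
  classical
  by_contra hne
  push Not at hne
  obtain ⟨a, b, hab⟩ := hne
  have hidx : 4 ≤ (Subgroup.center G).index := by
    by_contra hlt
    have h0 : (Subgroup.center G).index ≠ 0 := Subgroup.index_ne_zero_of_finite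
    have hcyc : IsCyclic (G ⧸ Subgroup.center G) := by
      have : (Subgroup.center G).index = 1 ∨ (Subgroup.center G).index = 2 ∨ (Subgroup.center G).index = 3 := by omega
      rcases this with e | e | e
      · have : Subsingleton (G ⧸ Subgroup.center G) := by
          rw [Subgroup.index_eq_one] at e
          exact QuotientGroup.subsingleton_iff.2 e
        infer_instance
      · have : Fact (Nat.Prime 2) := ⟨Nat.prime_two⟩
        exact isCyclic_of_prime_card (p := 2) e
      · have : Fact (Nat.Prime 3) := ⟨Nat.prime_three⟩
        exact isCyclic_of_prime_card (p := 3) e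
    exact hab ((MonoidHom.isMulCommutative_of_isCyclic_of_ker_le_center (QuotientGroup.mk' (Subgroup.center G)) (by simp)).is_comm.comm a b)
  have hcard := Subgroup.card_mul_index (Subgroup.center G)
  have hZ : 4 * Nat.card (Subgroup.center G) ≤ Nat.card G := by
    rw [← hcard, mul_comm]; exact Nat.mul_le_mul_left _ hidx
  have hpairs : 2 * (Finset.univ.filter (fun p : G × G => Commute p.1 p.2)).card ≤
      Nat.card G * (Nat.card G + Nat.card (Subgroup.center G)) := by
    have : (Finset.univ.filter (fun p : G × G => Commute p.1 p.2)).card =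
        ∑ x : G, Nat.card (Subgroup.centralizer {x}) := by
      have h1 : (Finset.univ.filter (fun p : G × G => Commute p.1 p.2)).card = cc (1 : G →* G) 1 1 := by
        unfold cc; congr 1; ext; simp
      rw [h1, cc_eq_sum]
      simp only [MonoidHom.one_apply, Finset.filter_true]
      apply Finset.sum_congr rfl
      intro x _
      have := fib_card (1 : G →* G) x
      simp only [MonoidHom.one_apply, MonoidHom.ker_one, inf_top_eq] at this
      rw [← this]
    rw [this, Finset.mul_sum]
    calc _ ≤ ∑ x : G, (Nat.card G + if x ∈ Subgroup.center G then Nat.card G else 0) := by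
          apply Finset.sum_le_sum
          intro x _
          split_ifs with hx
          · have := Subgroup.card_le_card_group (Subgroup.centralizer {x}); omega
          · have h2 := Subgroup.card_mul_index (Subgroup.centralizer {x})
            have h0 : (Subgroup.centralizer {x}).index ≠ 0 := Subgroup.index_ne_zero_of_finite
            have h1 : (Subgroup.centralizer {x}).index ≠ 1 := by
              rw [Ne, Subgroup.index_eq_one]
              intro e
              apply hx
              rw [Subgroup.mem_center_iff]
              intro g
              exact Subgroup.mem_centralizer_singleton_iff.1 (e ▸ Subgroup.mem_top g)
            have : 2 ≤ (Subgroup.centralizer {x}).index := by omega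
            rw [← h2, add_zero, mul_comm]
            exact Nat.mul_le_mul_left _ this
      _ = _ := by
          rw [Finset.sum_add_distrib, Finset.sum_const, ← Finset.sum_filter, Finset.sum_const, mul_add]
          simp only [smul_eq_mul, Finset.card_univ, ← Nat.card_eq_fintype_card]
          congr 1
          rw [mul_comm]
          congr 1
          rw [Nat.card_eq_fintype_card, ← Fintype.card_subtype]
  have hG : (0:ℚ) < Nat.card G := by exact_mod_cast Nat.card_pos
  rw [commProb_eq_pairs, lt_div_iff₀ (by positivity)] at h
  have h1 : (2 * ((Finset.univ.filter (fun p : G × G => Commute p.1 p.2)).card : ℚ)) ≤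
      Nat.card G * (Nat.card G + Nat.card (Subgroup.center G)) := by exact_mod_cast hpairs
  have h2 : (4 * Nat.card (Subgroup.center G) : ℚ) ≤ Nat.card G := by exact_mod_cast hZ
  nlinarith

end CommProb

open CategoryTheory
set_option linter.unusedSectionVars false
set_option linter.unusedSimpArgs false

section FHsec

/-- Fitting height at most `n` -/
def FH : ℕ → ∀ (G : Type) [Group G], Prop
  | 0, G, _ => Subsingleton G
  | n+1, G, _ => ∃ (H : Type) (_ : Group H) (f : G →* H), Group.IsNilpotent f.ker ∧ FH n H

theorem nilp_of_inj {A B : Type} [Group A] [Group B] (hB : Group.IsNilpotent B) (f : A →* B)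
    (hf : Function.Injective f) : Group.IsNilpotent A :=
  Subgroup.isNilpotent_of_ker_le_center f (by rw [(MonoidHom.ker_eq_bot_iff f).2 hf]; exact bot_le)

theorem FH.of_inj {n : ℕ} : ∀ {A G : Type} [Group A] [Group G], FH n A → ∀ (f : G →* A),
    Function.Injective f → FH n G := by
  cases n with
  | zero => intro A G _ _ h f hf; simp only [FH] at *; exact hf.subsingleton
  | succ n =>
    intro A G _ _ h f hf
    obtain ⟨H, _, g, h1, h2⟩ := h
    refine ⟨H, _, g.comp f, ?_, h2⟩
    refine nilp_of_inj h1 ((f.comp (g.comp f).ker.subtype).codRestrict g.ker fun x => ?_) ?_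
    · have := x.2; rw [MonoidHom.mem_ker] at this ⊢; exact this
    · intro x y hxy
      apply Subtype.ext
      apply hf
      exact congrArg Subtype.val hxy

theorem FH.prod {n : ℕ} : ∀ {A B : Type} [Group A] [Group B], FH n A → FH n B → FH n (A × B) := by
  induction n with
  | zero => intro A B _ _ hA hB; simp only [FH] at *; infer_instance
  | succ n ih =>
    intro A B _ _ hA hB
    obtain ⟨H, _, f, h1, h2⟩ := hA
    obtain ⟨K, _, g, h3, h4⟩ := hB
    refine ⟨H × K, inferInstance, f.prodMap g, ?_, ih h2 h4⟩
    have : Group.IsNilpotent (f.ker × g.ker) := inferInstance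
    refine nilp_of_inj this
      ({ toFun := fun x => (⟨x.1.1, (Prod.ext_iff.1 (MonoidHom.mem_ker.1 x.2)).1⟩,
          ⟨x.1.2, (Prod.ext_iff.1 (MonoidHom.mem_ker.1 x.2)).2⟩)
         map_one' := rfl
         map_mul' := fun x y => rfl }) ?_
    intro x y h
    simp [Prod.ext_iff] at h
    apply Subtype.ext; ext
    · exact congrArg Subtype.val h.1
    · exact congrArg Subtype.val h.2

theorem FH.of_subsingleton {n : ℕ} {G : Type} [Group G] [Subsingleton G] : FH n G := by
  induction n with
  | zero => simp only [FH]; infer_instance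
  | succ n ih => exact ⟨G, _, MonoidHom.id G, by infer_instance, ih⟩

theorem FH.of_nilp {n : ℕ} {G : Type} [Group G] (h : Group.IsNilpotent G) : FH (n+1) G :=
  ⟨PUnit, inferInstance, 1, nilp_of_inj h (Subgroup.subtype _) Subtype.val_injective,
    FH.of_subsingleton⟩

/-- the chain of the statement -/
def Chain (n : ℕ) (G : Type) [Group G] : Prop :=
  ∃ N : Fin (n+1) → Subgroup G, N 0 = ⊥ ∧ N (Fin.last n) = ⊤ ∧
    (∀ i : Fin n, N i.castSucc ≤ N i.succ) ∧ (∀ i : Fin (n+1), (N i).Normal) ∧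
    (∀ i : Fin n, ∃ _ : ((N i.castSucc).subgroupOf (N i.succ)).Normal,
      Group.IsNilpotent (↥(N i.succ) ⧸ (N i.castSucc).subgroupOf (N i.succ)))

theorem nilp_quot_comap {G H : Type} [Group G] [Group H] (f : G →* H) (A B : Subgroup H)
    (hn : (A.subgroupOf B).Normal) (h : Group.IsNilpotent (B ⧸ A.subgroupOf B)) :
    ∃ _ : ((A.comap f).subgroupOf (B.comap f)).Normal,
      Group.IsNilpotent (↥(B.comap f) ⧸ (A.comap f).subgroupOf (B.comap f)) := by
  let F : ↥(B.comap f) →* B := (f.comp (B.comap f).subtype).codRestrict B fun x => x.2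
  have e : (A.comap f).subgroupOf (B.comap f) = (A.subgroupOf B).comap F := rfl
  have hN : ((A.comap f).subgroupOf (B.comap f)).Normal := by rw [e]; infer_instance
  refine ⟨hN, nilp_of_inj h (QuotientGroup.map _ _ F (le_of_eq e)) ?_⟩
  rw [injective_iff_map_eq_one]
  intro x
  induction x using QuotientGroup.induction_on with
  | H x =>
    intro hx
    rw [QuotientGroup.map_mk, QuotientGroup.eq_one_iff] at hx
    rw [QuotientGroup.eq_one_iff]
    exact hx

theorem nilp_quot_bot {G : Type} [Group G] (B : Subgroup G) (h : Group.IsNilpotent B) :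
    ∃ _ : ((⊥ : Subgroup G).subgroupOf B).Normal,
      Group.IsNilpotent (B ⧸ (⊥ : Subgroup G).subgroupOf B) :=
  ⟨inferInstance, inferInstance⟩

theorem FH.chain {n : ℕ} : ∀ {G : Type} [Group G], FH n G → Chain n G := by
  induction n with
  | zero =>
    intro G _ h
    simp only [FH] at h
    exact ⟨fun _ => ⊥, rfl, Subsingleton.elim _ _, fun i => i.elim0, fun i => inferInstance,
      fun i => i.elim0⟩
  | succ n ih =>
    intro G _ h
    obtain ⟨H, _, f, h1, h2⟩ := h
    obtain ⟨N, n0, nl, nle, nn, nnil⟩ := ih h2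
    refine ⟨Fin.cons ⊥ (fun i => (N i).comap f), rfl, ?_, ?_, ?_, ?_⟩
    · rw [← Fin.succ_last, Fin.cons_succ, nl]; simp
    · intro i
      refine Fin.cases ?_ (fun j => ?_) i
      · simp
      · rw [Fin.cons_succ, ← Fin.succ_castSucc, Fin.cons_succ]
        exact Subgroup.comap_mono (nle j)
    · intro i
      refine Fin.cases ?_ (fun j => ?_) i
      · simp
      · rw [Fin.cons_succ]; have := nn j; infer_instance
    · intro i
      refine Fin.cases ?_ (fun j => ?_) i
      · rw [Fin.cons_succ, n0]
        exact nilp_quot_bot _ h1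
      · rw [Fin.cons_succ, ← Fin.succ_castSucc, Fin.cons_succ]
        obtain ⟨a, b⟩ := nnil j
        exact nilp_quot_comap f _ _ a b

end FHsec

section Solv
variable {G : Type} [Group G] [Fintype G]

theorem cc_idx (V : Subgroup G) [V.Normal] (hV : ∀ v ∈ V, ∀ w ∈ V, v * w = w * v) (i : ℕ)
    (X : G ⧸ Subgroup.centralizer (V : Set G))
    (h : ∀ x : G, QuotientGroup.mk' (Subgroup.centralizer (V : Set G)) x = X →
      i ≤ (Subgroup.centralizer {x}).relIndex V) :
    i * cc (QuotientGroup.mk' (Subgroup.centralizer (V : Set G))) X 1 ≤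
      Nat.card (QuotientGroup.mk' (Subgroup.centralizer (V : Set G))).ker ^ 2 := by
  apply cc_bound _ (QuotientGroup.mk'_surjective _)
  intro x hx
  apply index_bound (V := V) _ _ _ (h x hx)
  rw [QuotientGroup.ker_mk']
  intro v hv
  rw [Subgroup.mem_centralizer_iff]
  intro w hw
  exact hV w hw v hv

theorem mk_eq_one_iff (V : Subgroup G) [V.Normal] (x : G) :
    QuotientGroup.mk' (Subgroup.centralizer (V : Set G)) x = 1 ↔
      x ∈ Subgroup.centralizer (V : Set G) := by
  rw [QuotientGroup.mk'_apply, QuotientGroup.eq_one_iff]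

theorem half_V (V : Subgroup G) [V.Normal] (hV : ∀ v ∈ V, ∀ w ∈ V, v * w = w * v)
    (x : G) (hx : x * x ∉ Subgroup.centralizer (V : Set G)) :
    commProb G ≤ commProb (G ⧸ Subgroup.centralizer (V : Set G)) / 2 := by
  classical
  have hx1 : x ∉ Subgroup.centralizer (V : Set G) := fun h => hx (mul_mem h h)
  apply half_bound (QuotientGroup.mk' (Subgroup.centralizer (V : Set G)))
    (QuotientGroup.mk'_surjective _) _ (QuotientGroup.mk' _ x)
  · rw [Ne, mk_eq_one_iff]; exact hx1
  · apply cc_idx V hV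
    intro y hy
    apply relIndex_three V hV
    rw [← mk_eq_one_iff, map_mul, hy, ← map_mul, mk_eq_one_iff]
    exact hx
  · intro X hX
    apply cc_idx V hV
    intro y hy
    apply relIndex_two
    rw [← mk_eq_one_iff, hy]; exact hX

theorem exists_min_normal [Nontrivial G] [Group.IsSolvable G] : ∃ V : Subgroup G, V.Normal ∧ V ≠ ⊥ ∧
    (∀ v ∈ V, ∀ w ∈ V, v * w = w * v) ∧ ∀ W : Subgroup G, W.Normal → W ≤ V → W = ⊥ ∨ W = V := by
  classical
  obtain ⟨V, hV⟩ := (Set.toFinite {W : Subgroup G | W.Normal ∧ W ≠ ⊥}).exists_minimal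
    ⟨⊤, inferInstance, top_ne_bot⟩
  have hmin : ∀ W : Subgroup G, W.Normal → W ≤ V → W = ⊥ ∨ W = V := by
    intro W hW hle
    by_cases h : W = ⊥
    · exact Or.inl h
    · exact Or.inr (le_antisymm hle (hV.2 ⟨hW, h⟩ hle))
  have hn : V.Normal := hV.1.1
  refine ⟨V, hn, hV.1.2, ?_, hmin⟩
  have hlt := Group.IsSolvable.commutator_lt_of_ne_bot hV.1.2
  rcases hmin ⁅V, V⁆ inferInstance hlt.le with h | h
  · intro v hv w hw
    have := Subgroup.commutator_mem_commutator hv hw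
    rw [h, Subgroup.mem_bot, commutatorElement_eq_one_iff_mul_comm] at this
    exact this
  · exact absurd h hlt.ne

theorem third_V [Nontrivial G] (V : Subgroup G) [V.Normal] (hb : V ≠ ⊥)
    (hV : ∀ v ∈ V, ∀ w ∈ V, v * w = w * v)
    (hmin : ∀ W : Subgroup G, W.Normal → W ≤ V → W = ⊥ ∨ W = V)
    (hC : Subgroup.centralizer (V : Set G) ≠ ⊤)
    (hsq : ∀ x : G, x * x ∈ Subgroup.centralizer (V : Set G)) : commProb G ≤ 1 / 2 := by
  classical
  have hcomm : ∀ X Y : G ⧸ Subgroup.centralizer (V : Set G), X * Y = Y * X := by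
    have h1 : ∀ X : G ⧸ Subgroup.centralizer (V : Set G), X * X = 1 := by
      intro X
      obtain ⟨x, rfl⟩ := QuotientGroup.mk'_surjective _ X
      rw [← map_mul, mk_eq_one_iff]; exact hsq x
    intro X Y
    have hX : X⁻¹ = X := inv_eq_of_mul_eq_one_left (h1 X)
    have hY : Y⁻¹ = Y := inv_eq_of_mul_eq_one_left (h1 Y)
    have hXY : (X * Y)⁻¹ = X * Y := inv_eq_of_mul_eq_one_left (h1 _)
    rw [← hXY, mul_inv_rev, hX, hY]
  apply third_bound (QuotientGroup.mk' (Subgroup.centralizer (V : Set G)))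
    (QuotientGroup.mk'_surjective _)
  · have h0 : (Subgroup.centralizer (V : Set G)).index ≠ 0 := Subgroup.index_ne_zero_of_finite
    have h1 : (Subgroup.centralizer (V : Set G)).index ≠ 1 := by rwa [Ne, Subgroup.index_eq_one]
    change 2 ≤ (Subgroup.centralizer (V : Set G)).index
    omega
  · intro X hX
    apply cc_idx V hV
    intro x hx
    have hxC : x ∉ Subgroup.centralizer (V : Set G) := by rw [← mk_eq_one_iff, hx]; exact hX
    have h2 := relIndex_two V x hxC
    have hW : (V ⊓ Subgroup.centralizer {x}).Normal := by
      constructor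
      intro v hv g
      rw [Subgroup.mem_inf, Subgroup.mem_centralizer_singleton_iff] at hv ⊢
      refine ⟨Subgroup.Normal.conj_mem inferInstance v hv.1 g, ?_⟩
      have hc : x⁻¹ * (g⁻¹ * x * g) ∈ Subgroup.centralizer (V : Set G) := by
        rw [← mk_eq_one_iff]
        simp only [map_mul]
        rw [hcomm (_ * _) (QuotientGroup.mk' _ g), ← map_mul, ← map_mul, ← map_mul]
        simp
      have hc' := Subgroup.mem_centralizer_iff.1 hc v hv.1
      have e : v * (g⁻¹ * x * g) = (g⁻¹ * x * g) * v := by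
        have : g⁻¹ * x * g = x * (x⁻¹ * (g⁻¹ * x * g)) := by group
        rw [this, ← mul_assoc, hv.2, mul_assoc, hc', ← mul_assoc]
      calc g * v * g⁻¹ * x = g * (v * (g⁻¹ * x * g)) * g⁻¹ := by group
        _ = _ := by rw [e]; group
    have hbot : V ⊓ Subgroup.centralizer {x} = ⊥ := by
      rcases hmin _ hW inf_le_left with h | h
      · exact h
      · exfalso
        apply hxC
        rw [Subgroup.mem_centralizer_iff]
        intro v hv
        exact Subgroup.mem_centralizer_singleton_iff.1 ((inf_eq_left.1 h) hv)
    have hrel : (Subgroup.centralizer {x}).relIndex V = Nat.card V := by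
      rw [← Subgroup.inf_relIndex_right, inf_comm, hbot, Subgroup.relIndex_bot_left]
    rw [hrel] at h2 ⊢
    by_contra hlt
    have hc2 : Nat.card V = 2 := by omega
    obtain ⟨v, hv, hv1⟩ := (Subgroup.ne_bot_iff_exists_ne_one.1 hb : ∃ a : V, a ≠ 1).elim
      (fun a ha => (⟨a.1, a.2, fun h => ha (Subtype.ext h)⟩ : ∃ v ∈ V, v ≠ 1))
    have hall : ∀ w ∈ V, w = 1 ∨ w = v := by
      intro w hw
      by_contra hcon
      push Not at hcon
      rw [Nat.card_eq_fintype_card] at hc2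
      have h3 : ({⟨1, one_mem V⟩, ⟨v, hv⟩, ⟨w, hw⟩} : Finset V).card = 3 := by
        rw [Finset.card_eq_three]
        exact ⟨_, _, _, by simpa using hv1.symm, by simpa using hcon.1.symm, by simpa using hcon.2.symm, rfl⟩
      have := Finset.card_le_univ ({⟨1, one_mem V⟩, ⟨v, hv⟩, ⟨w, hw⟩} : Finset V)
      omega
    apply hxC
    rw [Subgroup.mem_centralizer_iff]
    intro w hw
    rcases hall w hw with rfl | rfl
    · simp
    · rcases hall (x * w * x⁻¹) (Subgroup.Normal.conj_mem inferInstance w hw x) with h | h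
      · exfalso; apply hv1; simpa using h
      · exact (mul_inv_eq_iff_eq_mul.1 h).symm

theorem solv_bound : ∀ (k n : ℕ) (G : Type) [Group G] [Fintype G] [Group.IsSolvable G],
    Nat.card G ≤ k → ¬ FH (n+1) G → commProb G ≤ 1 / 2 ^ (n+1) := by
  classical
  intro k
  induction k with
  | zero => intro n G _ _ _ h; have := Nat.card_pos (α := G); omega
  | succ k ih =>
    intro n G _ _ _ hk hFH
    have hnt : Nontrivial G := by
      rw [← not_subsingleton_iff_nontrivial]
      intro h; exact hFH FH.of_subsingleton
    obtain ⟨V, hVn, hVb, hV, hmin⟩ := exists_min_normal (G := G)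
    have hVC : V ≤ Subgroup.centralizer (V : Set G) := by
      intro v hv
      rw [Subgroup.mem_centralizer_iff]
      intro w hw
      exact hV w hw v hv
    have hVcard : 2 ≤ Nat.card V := by
      have := (Subgroup.one_lt_card_iff_ne_bot V).2 hVb
      omega
    have hsmall : ∀ W : Subgroup G, V ≤ W → Nat.card (G ⧸ W) ≤ k := by
      intro W hW
      have h1 := Subgroup.card_eq_card_quotient_mul_card_subgroup W
      have h2 : Nat.card V ≤ Nat.card W := Subgroup.card_le_of_le hW
      have h3 : Nat.card (G ⧸ W) * 2 ≤ Nat.card G := by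
        rw [h1]; exact Nat.mul_le_mul_left _ (by omega)
      have h4 := Nat.card_pos (α := G ⧸ W)
      omega
    by_cases hq : FH (n+1) (G ⧸ V)
    · have hnot : ¬ FH n (G ⧸ Subgroup.centralizer (V : Set G)) := by
        intro hC
        obtain ⟨H, _, f, h1, h2⟩ := hq
        apply hFH
        let F : G →* H × (G ⧸ Subgroup.centralizer (V : Set G)) :=
          (f.comp (QuotientGroup.mk' V)).prod (QuotientGroup.mk' _)
        have hF : ∀ x ∈ F.ker, f (QuotientGroup.mk' V x) = 1 ∧
            x ∈ Subgroup.centralizer (V : Set G) := by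
          intro x hx
          rw [MonoidHom.mem_ker, Prod.ext_iff] at hx
          exact ⟨hx.1, (mk_eq_one_iff V x).1 hx.2⟩
        refine ⟨_, inferInstance, F, ?_, FH.prod h2 hC⟩
        let g : F.ker →* f.ker := ((QuotientGroup.mk' V).comp F.ker.subtype).codRestrict f.ker
          fun x => (hF x.1 x.2).1
        apply Subgroup.isNilpotent_of_ker_le_center g
        intro x hx
        have hxV : (x : G) ∈ V := by
          rw [MonoidHom.mem_ker] at hx
          have := congrArg Subtype.val hx
          change QuotientGroup.mk' V (x : G) = 1 at this
          rwa [QuotientGroup.mk'_apply, QuotientGroup.eq_one_iff] at this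
        rw [Subgroup.mem_center_iff]
        intro y
        apply Subtype.ext
        exact (Subgroup.mem_centralizer_iff.1 (hF y.1 y.2).2 x.1 hxV).symm
      by_cases hsq : ∀ x : G, x * x ∈ Subgroup.centralizer (V : Set G)
      · cases n with
        | zero =>
          have := third_V V hVb hV hmin (by
            intro h
            apply hnot
            simp only [FH]
            exact QuotientGroup.subsingleton_iff.2 h) hsq
          simpa using this
        | succ n =>
          exfalso
          apply hnot
          apply FH.of_nilp
          have h1 : ∀ X : G ⧸ Subgroup.centralizer (V : Set G), X * X = 1 := by
            intro X
            obtain ⟨x, rfl⟩ := QuotientGroup.mk'_surjective _ X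
            rw [← map_mul, mk_eq_one_iff]; exact hsq x
          have hcomm : ∀ X Y : G ⧸ Subgroup.centralizer (V : Set G), X * Y = Y * X := by
            intro X Y
            have hX : X⁻¹ = X := inv_eq_of_mul_eq_one_left (h1 X)
            have hY : Y⁻¹ = Y := inv_eq_of_mul_eq_one_left (h1 Y)
            have hXY : (X * Y)⁻¹ = X * Y := inv_eq_of_mul_eq_one_left (h1 _)
            rw [← hXY, mul_inv_rev, hX, hY]
          apply Subgroup.isNilpotent_of_ker_le_center (1 : _ →* PUnit.{1})
          intro x _
          rw [Subgroup.mem_center_iff]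
          intro y
          exact hcomm y x
      · push Not at hsq
        obtain ⟨x, hx⟩ := hsq
        have hh := half_V V hV x hx
        cases n with
        | zero =>
          have := commProb_le_one (G ⧸ Subgroup.centralizer (V : Set G))
          norm_num; linarith
        | succ n =>
          have := ih n (G ⧸ Subgroup.centralizer (V : Set G)) (hsmall _ hVC) hnot
          rw [pow_succ]
          have e : (1:ℚ) / (2 ^ (n+1) * 2) = (1 / 2^(n+1)) / 2 := by field_simp
          rw [e]; linarith
    · exact (gallagher_quot (QuotientGroup.mk' V) (QuotientGroup.mk'_surjective _)).trans
        (ih n (G ⧸ V) (hsmall V le_rfl) hq)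

theorem commProb_of_degSum (h : (1/4 : ℝ) * Nat.card G < charDegSum G) : 1/16 < commProb G := by
  rw [charDegSum_eq] at h
  have h1 := deg_sum_sq_le (G := G)
  have h2 : Nat.card G < 4 * ∑ χ : Irr G, χ.dg := by
    have : (Nat.card G : ℝ) < 4 * ((∑ χ : Irr G, χ.dg : ℕ) : ℝ) := by linarith
    exact_mod_cast this
  have hp := Nat.card_pos (α := G)
  rw [commProb_def', lt_div_iff₀ (by exact_mod_cast hp)]
  have h3 : Nat.card G < 16 * Nat.card (ConjClasses G) := by
    by_contra hc
    push Not at hc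
    nlinarith
  have : (Nat.card G : ℚ) < 16 * Nat.card (ConjClasses G) := by exact_mod_cast h3
  linarith

theorem solvable_case [Group.IsSolvable G] (h : (1/4 : ℝ) * Nat.card G < charDegSum G) : Chain 4 G := by
  apply FH.chain
  by_contra hc
  have := solv_bound _ 3 G le_rfl hc
  have := commProb_of_degSum h
  norm_num at *
  linarith
end Solv

open CategoryTheory
set_option linter.unusedSectionVars false
set_option linter.unusedSimpArgs false

section Tri
variable {G : Type} [Group G] [Fintype G]

theorem cross_inv (B : Matrix (Fin 3) (Fin 3) ℂ) (u v : Fin 3 → ℂ) :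
    B.transpose.mulVec (crossProduct (B.mulVec u) (B.mulVec v)) = B.det • crossProduct u v := by
  rw [Matrix.det_fin_three]
  funext i
  fin_cases i <;> simp [Matrix.mulVec, dotProduct, Fin.sum_univ_three, cross_apply] <;> ring

theorem sub_finrank_ne {V : Type} [AddCommGroup V] [Module ℂ V] [FiniteDimensional ℂ V]
    (W : Submodule ℂ V) {v : V} (hv : v ∈ W) (h : v ≠ 0) : Module.finrank ℂ W ≠ 0 := by
  intro h0
  rw [Submodule.finrank_eq_zero] at h0
  subst h0
  exact h (by simpa using hv)

theorem avg_inv_ne {W : Type} [AddCommGroup W] [Module ℂ W] [FiniteDimensional ℂ W]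
    (R : Representation ℂ G W) {v : W} (hv : v ∈ R.invariants) (h : v ≠ 0) :
    (Nat.card G : ℂ)⁻¹ * ∑ g : G, R.character g ≠ 0 := by
  have := invertibleOfNonzero (card_ne (G := G))
  rw [Representation.card_inv_mul_sum_char_eq_finrank]
  exact_mod_cast sub_finrank_ne _ hv h

theorem avg_bilin_ne {W : Type} [AddCommGroup W] [Module ℂ W] [FiniteDimensional ℂ W]
    (σ τ : Representation ℂ G W) (c : W →ₗ[ℂ] W →ₗ[ℂ] W)
    (hc : ∀ g u v, τ g (c (σ g⁻¹ u) (σ g⁻¹ v)) = c u v) (hc0 : c ≠ 0) :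
    (Nat.card G : ℂ)⁻¹ * ∑ g : G, σ.character g⁻¹ * (σ.character g⁻¹ * τ.character g) ≠ 0 := by
  have := avg_inv_ne (W := W →ₗ[ℂ] W →ₗ[ℂ] W) (Representation.linHom σ (Representation.linHom σ τ)) (v := c) ?_ hc0
  · simpa only [Representation.char_linHom] using this
  · intro g
    apply LinearMap.ext; intro u
    apply LinearMap.ext; intro v
    exact hc g u v

theorem perfect_three (hp : commutator G = ⊤) (χ : Irr G) (hd : χ.dg = 3) :
    cip (χ.dual.1 * χ.dual.1) χ.1 ≠ 0 := by
  classical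
  obtain ⟨V, hV, hf⟩ := χ.exists_rep
  let b := Module.finBasisOfFinrankEq ℂ V (hf.trans hd)
  let A : G →* Matrix (Fin 3) (Fin 3) ℂ :=
    ((LinearMap.toMatrixAlgEquiv b : (V →ₗ[ℂ] V) →* Matrix (Fin 3) (Fin 3) ℂ)).comp V.ρ
  have hA : ∀ g, A g = LinearMap.toMatrix b b (V.ρ g) := fun g => rfl
  have hdet : ∀ g, (A g).det = 1 := by
    intro g
    rw [hA, LinearMap.det_toMatrix, perfect_det hp]
  have htr : ∀ g, (A g).trace = χ.1 g := by
    intro g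
    rw [hA, ← LinearMap.trace_eq_matrix_trace, hV]; rfl
  let σ : Representation ℂ G (Fin 3 → ℂ) :=
    { toFun := fun g => Matrix.toLin' (A g)
      map_one' := by rw [map_one, Matrix.toLin'_one]; rfl
      map_mul' := fun g h => by rw [map_mul, Matrix.toLin'_mul]; rfl }
  let τ : Representation ℂ G (Fin 3 → ℂ) :=
    { toFun := fun g => Matrix.toLin' (A g⁻¹).transpose
      map_one' := by rw [inv_one, map_one, Matrix.transpose_one, Matrix.toLin'_one]; rfl
      map_mul' := fun g h => by
        rw [mul_inv_rev, map_mul, Matrix.transpose_mul, Matrix.toLin'_mul]; rfl }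
  have hσ : ∀ g, σ.character g = χ.1 g := fun g => by
    rw [← htr]; exact Matrix.trace_toLin'_eq _
  have hτ : ∀ g, τ.character g = χ.1 g⁻¹ := fun g => by
    rw [← htr, ← Matrix.trace_transpose]; exact Matrix.trace_toLin'_eq _
  have hne : (crossProduct : (Fin 3 → ℂ) →ₗ[ℂ] (Fin 3 → ℂ) →ₗ[ℂ] (Fin 3 → ℂ)) ≠ 0 := by
    intro h
    have := congrArg (fun f => f ![1,0,0] ![0,1,0] 2) h
    simp [cross_apply] at this
  have key := avg_bilin_ne σ τ crossProduct (fun g u v => by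
    change Matrix.toLin' (A g⁻¹).transpose (crossProduct (Matrix.toLin' (A g⁻¹) u) (Matrix.toLin' (A g⁻¹) v)) = _
    simp only [Matrix.toLin'_apply]
    rw [cross_inv, hdet, one_smul]) hne
  convert key using 1
  unfold cip
  congr 1
  refine Finset.sum_congr rfl fun g _ => ?_
  rw [hσ, hτ, Pi.mul_apply, Irr.dual_apply]; ring
end Tri

open CategoryTheory
set_option linter.unusedSectionVars false
set_option linter.unusedSimpArgs false

section Main
variable {G : Type} [Group G] [Fintype G]

noncomputable def msum (s : Multiset (Irr G)) : G → ℂ := (s.map (fun χ => χ.1)).sum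

theorem msum_cons (a : Irr G) (s : Multiset (Irr G)) : msum (a ::ₘ s) = a.1 + msum s := by simp [msum]
theorem msum_zero : msum (0 : Multiset (Irr G)) = 0 := by simp [msum]
theorem msum_singleton (a : Irr G) : msum ({a} : Multiset (Irr G)) = a.1 := by simp [msum]

theorem cip_msum (s : Multiset (Irr G)) (χ : Irr G) : cip (msum s) χ.1 = s.count χ := cip_multiset s χ

theorem msum_one (s : Multiset (Irr G)) : msum s 1 = ((s.map Irr.dg).sum : ℕ) := by
  induction s using Multiset.induction with
  | empty => simp [msum]
  | cons a s ih => rw [msum_cons, Pi.add_apply, ih, a.one_eq]; simp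

theorem Irr.mul_dual_cip (χ ψ : Irr G) : _root_.cip (χ.1 * ψ.1) (Irr.triv : Irr G).1 = if ψ = χ.dual then 1 else 0 := by
  rw [cip_mul_left, Irr.triv_val, mul_one]
  exact Irr.cip ψ χ.dual

theorem cip_real {χ : Irr G} (h : χ.dual = χ) (f k : G → ℂ) : cip (χ.1 * f) k = cip f (χ.1 * k) := by
  rw [cip_mul_left]
  congr 2
  exact congrArg Irr.val h

theorem cip_irr_ne {χ ψ : Irr G} (h : χ ≠ ψ) : cip χ.1 ψ.1 = 0 := by rw [Irr.cip, if_neg h]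
theorem cip_irr_self (χ : Irr G) : cip χ.1 χ.1 = 1 := by rw [Irr.cip, if_pos rfl]

theorem simple_faithful [IsSimpleGroup G] {θ : G → ℂ} (hθ : IsChar θ) (h : cip θ 1 ≠ θ 1) {g : G}
    (hg : θ g = θ 1) : g = 1 := by
  rcases (hθ.ker_normal).eq_bot_or_eq_top with h1 | h1
  · have : g ∈ hθ.ker := hg
    rw [h1] at this; exact this
  · exfalso; apply h
    have : ∀ g, θ g = θ 1 := fun g => by
      have : g ∈ hθ.ker := by rw [h1]; trivial
      exact this
    unfold cip
    simp only [Pi.one_apply, mul_one]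
    rw [Finset.sum_congr rfl (fun g _ => this g), Finset.sum_const, Finset.card_univ, nsmul_eq_mul,
      ← Nat.card_eq_fintype_card, ← mul_assoc, inv_mul_cancel₀ card_ne, one_mul]

theorem Irr.faithful [IsSimpleGroup G] {χ : Irr G} (h : χ ≠ Irr.triv) {g : G} (hg : χ.1 g = χ.dg) : g = 1 := by
  apply simple_faithful χ.2.isChar _ (hg.trans χ.one_eq.symm)
  have := cip_irr_ne h
  rw [Irr.triv_val] at this
  rw [this, χ.one_eq]
  have := χ.dg_pos
  exact_mod_cast this.ne

theorem simple_dg_ge [IsSimpleGroup G] (hp : commutator G = ⊤) {x : G} (hx1 : x ≠ 1) (hx : x * x = 1)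
    {χ : Irr G} (h : χ ≠ Irr.triv) : 3 ≤ χ.dg := by
  have h0 := χ.dg_pos
  have h1 : χ.dg ≠ 1 := fun e => h (perfect_dg_one hp χ e)
  by_contra hlt
  have h2 : χ.dg = 2 := by omega
  obtain ⟨m, hm, hm1, hm2⟩ := χ.involution hp x (by rw [hx, χ.one_eq])
  have hm0 : m ≠ 0 := fun e => hx1 (χ.faithful h (hm2 e))
  have hm3 : m = 1 := by omega
  apply hx1
  have hc := χ.2.isChar.mul χ.dual.2.isChar
  have hxi : x⁻¹ = x := inv_eq_of_mul_eq_one_left hx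
  apply simple_faithful hc
  · have := χ.mul_dual_cip χ.dual
    rw [if_pos rfl, Irr.triv_val] at this
    rw [this, Pi.mul_apply, χ.one_eq, χ.dual.one_eq, Irr.dual_dg, h2]; norm_num
  · rw [Pi.mul_apply, Pi.mul_apply, χ.one_eq, χ.dual.one_eq, Irr.dual_dg, h2, Irr.dual_apply, hxi, hm1, h2, hm3]
    norm_num

/-- the standing hypotheses -/
structure Good (G : Type) [Group G] [Fintype G] (x : G) : Prop where
  perf : commutator G = ⊤
  ge : ∀ χ : Irr G, χ ≠ Irr.triv → 3 ≤ χ.dg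
  val : ∀ χ : Irr G, χ ≠ Irr.triv → χ.1 x = χ.dg - 4
  faith : ∀ χ : Irr G, χ ≠ Irr.triv → ∀ g, χ.1 g = χ.dg → g = 1
  ne : x ≠ 1
  sq : x * x = 1
  B : 4 * ∑ χ : Irr G, χ.dg = Nat.card G + 4

theorem exists_good [IsSimpleGroup G] (hp : commutator G = ⊤) {x : G} (hx1 : x ≠ 1) (hx : x * x = 1)
    (hB : Nat.card G < 4 * ∑ χ : Irr G, χ.dg) : Good G x := by
  classical
  have hge := fun χ h => simple_dg_ge (χ := χ) hp hx1 hx h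
  choose m hm hm1 hm2 using fun χ : Irr G => χ.involution hp x (by rw [hx, χ.one_eq])
  have hpos : ∀ χ : Irr G, χ ≠ Irr.triv → 1 ≤ m χ := fun χ h =>
    Nat.one_le_iff_ne_zero.2 fun e => hx1 (χ.faithful h (hm2 χ e))
  have hs := sum_dg_mul x
  rw [if_neg hx1] at hs
  have hs2 : ∑ χ : Irr G, (χ.dg:ℤ)^2 = 4 * ∑ χ : Irr G, (χ.dg : ℤ) * m χ := by
    have : (∑ χ : Irr G, (χ.dg:ℂ)^2) = 4 * ∑ χ : Irr G, (χ.dg : ℂ) * m χ := by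
      rw [← sub_eq_zero, ← hs, Finset.mul_sum, ← Finset.sum_sub_distrib]
      refine Finset.sum_congr rfl fun χ _ => ?_
      rw [hm1]; ring
    exact_mod_cast this
  have hsq : ∑ χ : Irr G, (χ.dg:ℤ)^2 = Nat.card G := by exact_mod_cast sum_dg_sq (G := G)
  have ht0 : m (Irr.triv : Irr G) = 0 := by
    have := hm (Irr.triv : Irr G)
    rw [Irr.triv_dg] at this; omega
  have hB' : (Nat.card G : ℤ) < 4 * ∑ χ : Irr G, (χ.dg : ℤ) := by exact_mod_cast hB
  have e1 : ∑ χ : Irr G, (χ.dg : ℤ) * (m χ - 1) < 0 := by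
    have : ∑ χ : Irr G, (χ.dg : ℤ) * (m χ - 1) = ∑ χ : Irr G, (χ.dg : ℤ) * m χ - ∑ χ : Irr G, (χ.dg : ℤ) := by
      rw [← Finset.sum_sub_distrib]; exact Finset.sum_congr rfl fun χ _ => by ring
    rw [this]; linarith
  rw [← Finset.add_sum_erase _ _ (Finset.mem_univ (Irr.triv : Irr G)), ht0, Irr.triv_dg] at e1
  have hnn : ∀ χ ∈ Finset.univ.erase (Irr.triv : Irr G), 0 ≤ (χ.dg : ℤ) * (m χ - 1) := fun χ hχ => by
    have := hpos χ (Finset.ne_of_mem_erase hχ)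
    apply mul_nonneg <;> omega
  have e2 : ∑ χ ∈ Finset.univ.erase (Irr.triv : Irr G), (χ.dg : ℤ) * (m χ - 1) = 0 := by
    have := Finset.sum_nonneg hnn
    push_cast at e1
    omega
  have e3 : ∀ χ : Irr G, χ ≠ Irr.triv → m χ = 1 := fun χ h => by
    have := (Finset.sum_eq_zero_iff_of_nonneg hnn).1 e2 χ (Finset.mem_erase.2 ⟨h, Finset.mem_univ _⟩)
    have h3 := hge χ h
    rcases mul_eq_zero.1 this with h4 | h4 <;> omega
  refine ⟨hp, hge, fun χ h => ?_, fun χ h g hg => χ.faithful h hg, hx1, hx, ?_⟩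
  · rw [hm1, e3 χ h]; norm_num
  · have : ∑ χ : Irr G, (χ.dg : ℤ) * (m χ - 1) = -1 := by
      rw [← Finset.add_sum_erase _ _ (Finset.mem_univ (Irr.triv : Irr G)), ht0, Irr.triv_dg, e2]; norm_num
    have e4 : ∑ χ : Irr G, (χ.dg : ℤ) * (m χ - 1) = ∑ χ : Irr G, (χ.dg : ℤ) * m χ - ∑ χ : Irr G, (χ.dg : ℤ) := by
      rw [← Finset.sum_sub_distrib]; exact Finset.sum_congr rfl fun χ _ => by ring
    have : 4 * ∑ χ : Irr G, (χ.dg : ℤ) = Nat.card G + 4 := by linarith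
    exact_mod_cast this

variable {x : G} 

theorem Good.msum_x (hg : Good G x) (s : Multiset (Irr G)) (hs : Irr.triv ∉ s) :
    msum s x = ((s.map Irr.dg).sum : ℕ) - 4 * s.card := by
  induction s using Multiset.induction with
  | empty => simp [msum]
  | cons a s ih =>
    rw [msum_cons, Pi.add_apply, ih (fun h => hs (Multiset.mem_cons_of_mem h)), hg.val a
      (fun h => hs (by rw [h]; exact Multiset.mem_cons_self _ _))]
    simp; ring

theorem Good.prod_ne (hg : Good G x) {χ ψ : Irr G} (h1 : χ ≠ Irr.triv) (h2 : ψ ≠ Irr.triv) (h : ψ ≠ χ.dual) :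
    ∃ t : Multiset (Irr G), χ.1 * ψ.1 = msum t ∧ (∀ a ∈ t, a ≠ Irr.triv ∧ 3 ≤ a.dg) ∧ t.card + 4 = χ.dg + ψ.dg ∧
      (t.map Irr.dg).sum = χ.dg * ψ.dg := by
  obtain ⟨t, ht⟩ := (χ.nchar.mul ψ.nchar).exists_multiset
  change _ = msum t at ht
  have htr : Irr.triv ∉ t := by
    have := χ.mul_dual_cip ψ
    rw [ht, if_neg h, cip_msum] at this
    exact Multiset.count_eq_zero.1 (by exact_mod_cast this)
  have hd : (t.map Irr.dg).sum = χ.dg * ψ.dg := by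
    have := congrFun ht 1
    rw [msum_one, Pi.mul_apply, χ.one_eq, ψ.one_eq] at this
    exact_mod_cast this.symm
  refine ⟨t, ht, fun a ha => ?_, ?_, hd⟩
  · have : a ≠ Irr.triv := fun e => htr (e ▸ ha)
    exact ⟨this, hg.ge a this⟩
  · have := congrFun ht x
    rw [hg.msum_x t htr, Pi.mul_apply, hg.val χ h1, hg.val ψ h2, hd] at this
    push_cast at this
    have h3 : (t.card : ℂ) + 4 = χ.dg + ψ.dg := by linear_combination (1/4) * this
    exact_mod_cast h3

theorem Good.prod_dual (hg : Good G x) {χ : Irr G} (h1 : χ ≠ Irr.triv)  :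
    ∃ t : Multiset (Irr G), χ.1 * χ.dual.1 = 1 + msum t ∧ (∀ a ∈ t, a ≠ Irr.triv ∧ 3 ≤ a.dg) ∧ t.card + 4 = χ.dg + χ.dg ∧
      (t.map Irr.dg).sum + 1 = χ.dg * χ.dg := by
  obtain ⟨t, ht⟩ := ((χ.nchar.mul χ.dual.nchar).sub_irr Irr.triv (by rw [Irr.mul_dual_cip, if_pos rfl]; simp)).exists_multiset
  change _ = msum t at ht
  have htr : Irr.triv ∉ t := by
    have := χ.mul_dual_cip χ.dual
    have h2 := cip_msum t Irr.triv
    rw [← ht, cip_sub_left, this, if_pos rfl, cip_irr_self, sub_self] at h2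
    exact Multiset.count_eq_zero.1 (by exact_mod_cast h2.symm)
  have hd : (t.map Irr.dg).sum + 1 = χ.dg * χ.dg := by
    have := congrFun ht 1
    rw [msum_one, Pi.sub_apply, Pi.mul_apply, χ.one_eq, χ.dual.one_eq, Irr.dual_dg, Irr.triv_val] at this
    have h3 : (χ.dg : ℂ) * χ.dg = ((t.map Irr.dg).sum : ℕ) + 1 := by rw [← this]; simp
    exact_mod_cast h3.symm
  refine ⟨t, ?_, fun a ha => ?_, ?_, hd⟩
  · rw [← ht, Irr.triv_val]; ring
  · have : a ≠ Irr.triv := fun e => htr (e ▸ ha)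
    exact ⟨this, hg.ge a this⟩
  · have := congrFun ht x
    have hd' : ((t.map Irr.dg).sum : ℕ) + 1 = (χ.dg : ℂ) * χ.dg := by exact_mod_cast hd
    have hdt : χ.dual ≠ Irr.triv := by
      intro e
      apply h1
      rw [← χ.dual_dual, e]; apply Irr.ext; funext g; simp [Irr.dual_apply, Irr.triv_val]
    rw [hg.msum_x t htr, Pi.sub_apply, Pi.mul_apply, hg.val χ h1, hg.val _ hdt, Irr.dual_dg, Irr.triv_val, Pi.one_apply] at this
    have h3 : (t.card : ℂ) + 4 = χ.dg + χ.dg := by linear_combination (1/4) * this + (1/4) * hd'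
    exact_mod_cast h3

end Main

open CategoryTheory
set_option linter.unusedSectionVars false
set_option linter.unusedSimpArgs false

section Main
variable {G : Type} [Group G] [Fintype G] {x : G}

theorem ne_of_dg {a b : Irr G} (h : a.dg ≠ b.dg) : a ≠ b := fun e => h (e ▸ rfl)

theorem ntriv_of_dg {a : Irr G} (h : a.dg ≠ 1) : a ≠ Irr.triv := ne_of_dg (by rwa [Irr.triv_dg])

theorem dual_ne_triv {a : Irr G} (h : a ≠ Irr.triv) : a.dual ≠ Irr.triv := by
  intro e
  apply h
  rw [← a.dual_dual, e]; apply Irr.ext; funext g; simp [Irr.dual_apply, Irr.triv_val]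

theorem Good.exists_three (hg : Good G x) : ∃ χ : Irr G, χ.dg = 3 := by
  classical
  by_contra hno
  push Not at hno
  have hs := sum_dg_mul x
  rw [if_neg hg.ne, ← Finset.add_sum_erase _ _ (Finset.mem_univ (Irr.triv : Irr G)), Irr.triv_dg, Irr.triv_val] at hs
  have h2 : (1:ℤ) + ∑ χ ∈ Finset.univ.erase (Irr.triv : Irr G), (χ.dg : ℤ) * (χ.dg - 4) = 0 := by
    have : (1:ℂ) + ∑ χ ∈ Finset.univ.erase (Irr.triv : Irr G), (χ.dg : ℂ) * (χ.dg - 4) = 0 := by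
      rw [← hs]; congr 1
      · simp
      · refine Finset.sum_congr rfl fun χ hχ => ?_
        rw [hg.val χ (Finset.ne_of_mem_erase hχ)]
    exact_mod_cast this
  have : 0 ≤ ∑ χ ∈ Finset.univ.erase (Irr.triv : Irr G), (χ.dg : ℤ) * (χ.dg - 4) := by
    refine Finset.sum_nonneg fun χ hχ => ?_
    have h3 := hg.ge χ (Finset.ne_of_mem_erase hχ)
    have h4 := hno χ
    apply mul_nonneg <;> omega
  omega

theorem cip_sq_dual (χ : Irr G) : cip (χ.1 * χ.1) (χ.1 * χ.1) = cip (χ.1 * χ.dual.1) (χ.1 * χ.dual.1) := by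
  unfold cip
  congr 1
  refine Finset.sum_congr rfl fun g _ => ?_
  simp only [Pi.mul_apply, Irr.dual_apply, inv_inv]; ring

theorem cip_two (a b : Irr G) : cip (a.1 + b.1) (a.1 + b.1) = if a = b then 4 else 2 := by
  simp only [cip_add_left, cip_add_right, Irr.cip]
  by_cases h : a = b
  · subst h; norm_num
  · simp [h, Ne.symm h]; norm_num

theorem Good.real (hg : Good G x) {χ : Irr G} (h : χ.dg = 3) : χ.dual = χ := by
  by_contra hne
  have ht : χ ≠ Irr.triv := ntriv_of_dg (by omega)
  obtain ⟨s, hs, hs1, hs2, hs3⟩ := hg.prod_ne ht ht (Ne.symm hne)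
  obtain ⟨t, ht1, ht2, ht3, ht4⟩ := hg.prod_dual ht
  obtain ⟨a, b, rfl⟩ := Multiset.card_eq_two.1 (show s.card = 2 by omega)
  obtain ⟨c, d, rfl⟩ := Multiset.card_eq_two.1 (show t.card = 2 by omega)
  simp [h] at hs3
  have hab : a ≠ b := ne_of_dg (by omega)
  have e := cip_sq_dual χ
  have hc := (ht2 c (by simp)).1
  have hd := (ht2 d (by simp)).1
  rw [hs, ht1] at e
  have e1 : msum {a, b} = a.1 + b.1 := by simp [msum]
  have e2 : msum {c, d} = c.1 + d.1 := by simp [msum]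
  rw [e1, e2, cip_two, if_neg hab, ← Irr.triv_val] at e
  simp only [cip_add_left, cip_add_right, Irr.cip, hc, hd, Ne.symm hc, Ne.symm hd] at e
  by_cases hcd : c = d
  · subst hcd; norm_num at e
  · simp [hcd, Ne.symm hcd] at e; norm_num at e

theorem Good.sqr (hg : Good G x) {χ : Irr G} (h : χ.dg = 3) :
    ∃ φ : Irr G, φ.dg = 5 ∧ φ.dual = φ ∧ χ.1 * χ.1 = 1 + χ.1 + φ.1 := by
  have hr := hg.real h
  have ht : χ ≠ Irr.triv := ntriv_of_dg (by omega)
  obtain ⟨t, ht1, ht2, ht3, ht4⟩ := hg.prod_dual ht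
  rw [hr] at ht1
  have h3 := perfect_three hg.perf χ h
  rw [hr, ht1, cip_add_left, cip_msum, ← Irr.triv_val, cip_irr_ne (Ne.symm ht), zero_add] at h3
  have h4 : χ ∈ t := by
    by_contra hn
    rw [Multiset.count_eq_zero.2 hn] at h3; simp at h3
  obtain ⟨t', rfl⟩ := Multiset.exists_cons_of_mem h4
  simp [h] at ht3 ht4
  obtain ⟨φ, rfl⟩ := Multiset.card_eq_one.1 (show t'.card = 1 by omega)
  simp at ht4
  have hφ : φ.dg = 5 := by omega
  rw [msum_cons, msum_singleton, ← add_assoc] at ht1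
  refine ⟨φ, hφ, ?_, ht1⟩
  by_contra hne
  have h5 : cip (χ.1 * χ.1) φ.dual.1 = cip (χ.1 * χ.1) φ.1 := by
    rw [← cip_inv_inv]
    congr 1
    · funext g
      have := congrFun (congrArg Irr.val hr) g
      rw [Irr.dual_apply] at this
      simp [this]
    · funext g; simp [Irr.dual_apply]
  rw [ht1] at h5
  have a1 : φ ≠ Irr.triv := ntriv_of_dg (by omega)
  have a2 : χ ≠ φ := ne_of_dg (by omega)
  have a3 : χ ≠ φ.dual := ne_of_dg (by rw [Irr.dual_dg]; omega)
  rw [← Irr.triv_val] at h5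
  simp only [cip_add_left, cip_irr_ne (Ne.symm a1), cip_irr_ne (dual_ne_triv a1).symm, cip_irr_ne a2, cip_irr_ne a3, cip_irr_ne (Ne.symm hne), cip_irr_self] at h5
  norm_num at h5

theorem Good.same (hg : Good G x) {χ ψ φ φ' : Irr G} (h : χ.dg = 3) (h' : ψ.dg = 3) (hφ : φ.dg = 5) (hφ' : φ'.dg = 5)
    (hs : χ.1 * χ.1 = 1 + χ.1 + φ.1) (hs' : ψ.1 * ψ.1 = 1 + ψ.1 + φ'.1) : φ = φ' := by
  by_cases hne : χ = ψ
  · subst hne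
    rw [hs] at hs'
    exact Irr.ext (add_left_cancel hs')
  by_contra hφφ
  have ht : χ ≠ Irr.triv := ntriv_of_dg (by omega)
  have ht' : ψ ≠ Irr.triv := ntriv_of_dg (by omega)
  have hft : φ ≠ Irr.triv := ntriv_of_dg (by omega)
  have hft' : φ' ≠ Irr.triv := ntriv_of_dg (by omega)
  obtain ⟨s, s1, s2, s3, s4⟩ := hg.prod_ne ht ht' (by rw [hg.real h]; exact Ne.symm hne)
  obtain ⟨a, b, rfl⟩ := Multiset.card_eq_two.1 (show s.card = 2 by omega)
  simp [h, h'] at s4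
  have hab : a ≠ b := ne_of_dg (by omega)
  have e : cip (χ.1 * ψ.1) (χ.1 * ψ.1) = cip (χ.1 * χ.1) (ψ.1 * ψ.1) := by
    rw [cip_real (hg.real h), cip_comm, ← mul_assoc, mul_comm, cip_real (hg.real h'), ]
  have e1 : msum {a, b} = a.1 + b.1 := by simp [msum]
  rw [s1, e1, cip_two, if_neg hab, hs, hs', ← Irr.triv_val] at e
  have a1 : χ ≠ φ' := ne_of_dg (by omega)
  have a2 : φ ≠ ψ := ne_of_dg (by omega)
  simp only [cip_add_left, cip_add_right, cip_irr_ne ht.symm, cip_irr_ne ht, cip_irr_ne ht', cip_irr_ne ht'.symm, cip_irr_ne hft, cip_irr_ne hft.symm, cip_irr_ne hft', cip_irr_ne hft'.symm, cip_irr_ne hne, cip_irr_ne a1, cip_irr_ne a2, cip_irr_ne hφφ, cip_irr_self] at e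
  norm_num at e

end Main

open CategoryTheory
set_option linter.unusedSectionVars false
set_option linter.unusedSimpArgs false

section Main
variable {G : Type} [Group G] [Fintype G] {x : G}

theorem three_le_sum (t : Multiset (Irr G)) (h : ∀ a ∈ t, 3 ≤ a.dg) : 3 * t.card ≤ (t.map Irr.dg).sum := by
  have := Multiset.card_nsmul_le_sum (s := t.map Irr.dg) (a := 3) (by
    intro b hb
    obtain ⟨a, ha, rfl⟩ := Multiset.mem_map.1 hb
    exact h a ha)
  simpa [mul_comm] using this

theorem Good.dich (hg : Good G x) {φ : Irr G} (hφ5 : φ.dg = 5) (hφr : φ.dual = φ)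
    {χ : Irr G} (h : χ.dg = 3) (hφ : χ.1 * χ.1 = 1 + χ.1 + φ.1) :
    (cip (φ.1 * φ.1) φ.1 = 2 ∧ ∃ ψ η : Irr G, ψ.dg = 3 ∧ η.dg = 4 ∧ ψ ≠ χ ∧ χ.1 * φ.1 = χ.1 + φ.1 + ψ.1 + η.1) ∨
    (cip (φ.1 * φ.1) χ.1 = 0 ∧ ∃ k : ℕ, 3 ≤ k ∧ Odd k ∧ cip (φ.1 * φ.1) φ.1 = k) := by
  have hr := hg.real h
  have ht : χ ≠ Irr.triv := ntriv_of_dg (by omega)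
  have hft : φ ≠ Irr.triv := ntriv_of_dg (by omega)
  have hne : χ ≠ φ := ne_of_dg (by omega)
  obtain ⟨t, t1, t2, t3, t4⟩ := hg.prod_ne ht hft (by rw [hr]; exact Ne.symm hne)
  have c1 : cip (χ.1 * φ.1) χ.1 = 1 := by
    rw [cip_real hr, hφ, ← Irr.triv_val]
    simp only [cip_add_right, cip_irr_ne hft, cip_irr_ne hne.symm, cip_irr_self]; norm_num
  rw [t1, cip_msum] at c1
  have c1' : t.count χ = 1 := by exact_mod_cast c1
  obtain ⟨t', rfl⟩ := Multiset.exists_cons_of_mem (Multiset.count_pos.1 (by omega) : χ ∈ t)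
  rw [Multiset.count_cons_self] at c1'
  have hχt : χ ∉ t' := Multiset.count_eq_zero.1 (by omega)
  simp [h, hφ5] at t3 t4
  have hnorm : cip (χ.1 * φ.1) (χ.1 * φ.1) = 1 + cip (φ.1 * φ.1) χ.1 + cip (φ.1 * φ.1) φ.1 := by
    have : cip (χ.1 * φ.1) (χ.1 * φ.1) = cip (φ.1 * φ.1) (χ.1 * χ.1) := by
      rw [cip_real hr, cip_real hφr, ← mul_assoc, mul_comm]
    rw [this, hφ]
    simp only [cip_add_right]
    congr 2
    have := φ.mul_dual_cip φ
    rw [if_pos hφr.symm] at this; exact this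
  have hy : cip (φ.1 * φ.1) χ.1 = cip (χ.1 * φ.1) φ.1 := by
    rw [cip_real hφr, mul_comm, cip_comm]
  rw [msum_cons] at t1
  by_cases hft' : φ ∈ t'
  · obtain ⟨t'', rfl⟩ := Multiset.exists_cons_of_mem hft'
    simp [hφ5] at t3 t4
    obtain ⟨a, b, rfl⟩ := Multiset.card_eq_two.1 (show t''.card = 2 by omega)
    have key : ∀ p q : Irr G, p.dg = 3 → q.dg = 4 → p ≠ χ → χ.1 * φ.1 = χ.1 + φ.1 + p.1 + q.1 → (cip (φ.1 * φ.1) φ.1 = 2 ∧ ∃ ψ η : Irr G, ψ.dg = 3 ∧ η.dg = 4 ∧ ψ ≠ χ ∧ χ.1 * φ.1 = χ.1 + φ.1 + ψ.1 + η.1) := by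
      intro p q hp hq hpχ e
      refine ⟨?_, p, q, hp, hq, hpχ, e⟩
      have b1 : p ≠ φ := ne_of_dg (by omega)
      have b2 : q ≠ φ := ne_of_dg (by omega)
      have b3 : q ≠ χ := ne_of_dg (by omega)
      have b4 : p ≠ q := ne_of_dg (by omega)
      rw [hy, e] at hnorm
      simp only [cip_add_left, cip_add_right, cip_irr_self, cip_irr_ne b1, cip_irr_ne b1.symm, cip_irr_ne b2, cip_irr_ne b2.symm,
        cip_irr_ne b3, cip_irr_ne b3.symm, cip_irr_ne b4, cip_irr_ne b4.symm, cip_irr_ne hne, cip_irr_ne hne.symm, cip_irr_ne hpχ, cip_irr_ne hpχ.symm] at hnorm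
      linear_combination -hnorm
    have e1 : msum {a, b} = a.1 + b.1 := by simp [msum]
    rw [msum_cons, e1] at t1
    simp at t4 t2 hχt
    left
    have : (a.dg = 3 ∧ b.dg = 4) ∨ (a.dg = 4 ∧ b.dg = 3) := by omega
    rcases this with ⟨h1, h2⟩ | ⟨h1, h2⟩
    · exact key a b h1 h2 (Ne.symm hχt.2.1) (by rw [t1]; ring)
    · exact key b a h2 h1 (Ne.symm hχt.2.2) (by rw [t1]; ring)
  · right
    obtain ⟨a, b, c, rfl⟩ := Multiset.card_eq_three.1 (show t'.card = 3 by omega)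
    have e1 : msum {a, b, c} = a.1 + b.1 + c.1 := by simp [msum]; ring
    rw [e1] at t1
    simp at hχt hft'
    obtain ⟨d1, d2, d3⟩ := hχt
    obtain ⟨f1, f2, f3⟩ := hft'
    have hy0 : cip (φ.1 * φ.1) χ.1 = 0 := by
      rw [hy, t1]
      simp only [cip_add_left, cip_irr_ne hne, cip_irr_ne (Ne.symm f1), cip_irr_ne (Ne.symm f2), cip_irr_ne (Ne.symm f3)]; norm_num
    refine ⟨hy0, 3 + 2 * ((if a = b then 1 else 0) + (if a = c then 1 else 0) + (if b = c then 1 else 0)), by omega, ⟨1 + ((if a = b then 1 else 0) + (if a = c then 1 else 0) + (if b = c then 1 else 0)), by ring⟩, ?_⟩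
    rw [hy0, t1] at hnorm
    have g1 : (if b = a then (1:ℂ) else 0) = if a = b then 1 else 0 := by simp only [eq_comm]
    have g2 : (if c = a then (1:ℂ) else 0) = if a = c then 1 else 0 := by simp only [eq_comm]
    have g3 : (if c = b then (1:ℂ) else 0) = if b = c then 1 else 0 := by simp only [eq_comm]
    simp only [cip_add_left, cip_add_right, cip_irr_ne d1, cip_irr_ne d2, cip_irr_ne d3, cip_irr_ne (Ne.symm d1), cip_irr_ne (Ne.symm d2), cip_irr_ne (Ne.symm d3), cip_irr_self] at hnorm
    simp only [Irr.cip a b, Irr.cip a c, Irr.cip b c, Irr.cip b a, Irr.cip c a, Irr.cip c b, g1, g2, g3] at hnorm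
    push_cast
    linear_combination -hnorm

theorem Good.chiphi (hg : Good G x) {φ : Irr G} (hφ5 : φ.dg = 5) (hφr : φ.dual = φ)
    (hφ : ∀ χ : Irr G, χ.dg = 3 → χ.1 * χ.1 = 1 + χ.1 + φ.1)
    {χ : Irr G} (h : χ.dg = 3) :
    ∃ ψ η : Irr G, ψ.dg = 3 ∧ η.dg = 4 ∧ ψ ≠ χ ∧ χ.1 * φ.1 = χ.1 + φ.1 + ψ.1 + η.1 := by
  rcases hg.dich hφ5 hφr h (hφ χ h) with h1 | ⟨h1, k, hk3, hko, hk⟩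
  · exact h1.2
  exfalso
  have hft : φ ≠ Irr.triv := ntriv_of_dg (by omega)
  obtain ⟨t, t1, t2, t3, t4⟩ := hg.prod_dual hft
  rw [hφr] at t1
  have hct : ∀ a : Irr G, a ≠ Irr.triv → cip (φ.1 * φ.1) a.1 = t.count a := fun a ha => by
    rw [t1, cip_add_left, cip_msum, ← Irr.triv_val, cip_irr_ne (Ne.symm ha), zero_add]
  have hkc : t.count φ = k := by
    have := hct φ hft
    rw [hk] at this; exact_mod_cast this.symm
  obtain ⟨r, rfl⟩ := Multiset.le_iff_exists_add.1 (Multiset.le_count_iff_replicate_le.1 hkc.ge)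
  have hr3 : ∀ a ∈ r, 3 ≤ a.dg := fun a ha => (t2 a (Multiset.mem_add.2 (Or.inr ha))).2
  have h6 := three_le_sum r hr3
  simp [hφ5] at t3 t4
  have hk' : k = 3 := by omega
  subst hk'
  obtain ⟨a, b, c, rfl⟩ := Multiset.card_eq_three.1 (show r.card = 3 by omega)
  simp at t4
  have ha := hr3 a (by simp)
  have hb := hr3 b (by simp)
  have hc := hr3 c (by simp)
  have ha3 : a.dg = 3 := by omega
  rcases hg.dich hφ5 hφr ha3 (hφ a ha3) with h7 | h7
  · rw [hk] at h7; norm_num at h7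
  · have := hct a (ntriv_of_dg (by omega))
    rw [h7.1] at this
    have h8 : Multiset.count a (Multiset.replicate 3 φ + {a, b, c}) = 0 := by exact_mod_cast this.symm
    exact Multiset.count_eq_zero.1 h8 (by simp)

end Main

open CategoryTheory
set_option linter.unusedSectionVars false
set_option linter.unusedSimpArgs false

section Main
variable {G : Type} [Group G] [Fintype G] {x : G}

theorem eq_of_cip_ne {a b : Irr G} (h : cip a.1 b.1 ≠ 0) : a = b := by
  by_contra hne; exact h (cip_irr_ne hne)

theorem mem_of_cip {t : Multiset (Irr G)} {a : Irr G} (h : cip (msum t) a.1 ≠ 0) : a ∈ t := by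
  by_contra hn
  rw [cip_msum, Multiset.count_eq_zero.2 hn] at h
  simp at h

theorem Good.table (hg : Good G x) {φ : Irr G} (hφ5 : φ.dg = 5) (hφr : φ.dual = φ)
    (hφ : ∀ χ : Irr G, χ.dg = 3 → χ.1 * χ.1 = 1 + χ.1 + φ.1)
    {χ : Irr G} (h : χ.dg = 3) :
    ∃ ψ η η' : Irr G, ψ.dg = 3 ∧ η.dg = 4 ∧ η'.dg = 4 ∧ ψ ≠ χ ∧ χ.1 * φ.1 = χ.1 + φ.1 + ψ.1 + η.1 ∧
      χ.1 * ψ.1 = φ.1 + η.1 ∧ χ.1 * η.1 = φ.1 + ψ.1 + η'.1 ∧ ∀ ω : Irr G, ω.dg = 3 → ω = χ ∨ ω = ψ := by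
  obtain ⟨ψ, η, hψ, hη, hne, e1⟩ := hg.chiphi hφ5 hφr hφ h
  have hr := hg.real h
  have ht : χ ≠ Irr.triv := ntriv_of_dg (by omega)
  have hψt : ψ ≠ Irr.triv := ntriv_of_dg (by omega)
  have hηt : η ≠ Irr.triv := ntriv_of_dg (by omega)
  have n1 : χ ≠ φ := ne_of_dg (by omega)
  have n2 : ψ ≠ φ := ne_of_dg (by omega)
  have n3 : η ≠ φ := ne_of_dg (by omega)
  have n4 : η ≠ χ := ne_of_dg (by omega)
  have n5 : η ≠ ψ := ne_of_dg (by omega)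
  -- χ ψ
  have e2 : ∃ η₁ : Irr G, η₁.dg = 4 ∧ χ.1 * ψ.1 = φ.1 + η₁.1 := by
    obtain ⟨s, s1, s2, s3, s4⟩ := hg.prod_ne ht hψt (by rw [hr]; exact hne)
    have : cip (msum s) φ.1 ≠ 0 := by
      rw [← s1, cip_real hr, e1]
      simp only [cip_add_right, cip_irr_ne hne, cip_irr_ne n2, cip_irr_ne n5.symm, cip_irr_self]; norm_num
    obtain ⟨s', rfl⟩ := Multiset.exists_cons_of_mem (mem_of_cip this)
    simp [h, hψ, hφ5] at s3 s4
    obtain ⟨a, rfl⟩ := Multiset.card_eq_one.1 (show s'.card = 1 by omega)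
    simp at s4
    exact ⟨a, by omega, by rw [s1, msum_cons, msum_singleton]⟩
  obtain ⟨η₁, hη₁, e2⟩ := e2
  have e3 : ∃ ω η₂ : Irr G, ω.dg = 3 ∧ η₂.dg = 4 ∧ χ.1 * η.1 = φ.1 + ω.1 + η₂.1 := by
    obtain ⟨s, s1, s2, s3, s4⟩ := hg.prod_ne ht hηt (by rw [hr]; exact n4)
    have : cip (msum s) φ.1 ≠ 0 := by
      rw [← s1, cip_real hr, e1]
      simp only [cip_add_right, cip_irr_ne n4, cip_irr_ne n3, cip_irr_ne n5, cip_irr_self]; norm_num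
    obtain ⟨s', rfl⟩ := Multiset.exists_cons_of_mem (mem_of_cip this)
    simp [h, hη, hφ5] at s3 s4
    obtain ⟨a, b, rfl⟩ := Multiset.card_eq_two.1 (show s'.card = 2 by omega)
    have f1 : msum {a, b} = a.1 + b.1 := by simp [msum]
    rw [msum_cons, f1] at s1
    have ha := (s2 a (by simp)).2
    have hb := (s2 b (by simp)).2
    simp at s4
    have : (a.dg = 3 ∧ b.dg = 4) ∨ (a.dg = 4 ∧ b.dg = 3) := by omega
    rcases this with ⟨h1, h2⟩ | ⟨h1, h2⟩
    · exact ⟨a, b, h1, h2, by rw [s1]; ring⟩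
    · exact ⟨b, a, h2, h1, by rw [s1]; ring⟩
  obtain ⟨ω, η₂, hω, hη₂, e3⟩ := e3
  have e4 : φ.1 * φ.1 = 1 + χ.1 + φ.1 + φ.1 + ω.1 + η₁.1 + η₂.1 := by
    linear_combination (-φ.1) * hφ χ h + χ.1 * e1 + hφ χ h + e2 + e3
  have hall : ∀ ζ : Irr G, ζ.dg = 3 → ζ = χ ∨ ζ = ω := by
    intro ζ hζ
    by_contra hcon
    push Not at hcon
    obtain ⟨p, q, hp, hq, hpz, e⟩ := hg.chiphi hφ5 hφr hφ hζ
    have : cip (φ.1 * φ.1) ζ.1 = cip (ζ.1 * φ.1) φ.1 := by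
      rw [cip_real hφr, mul_comm, cip_comm]
    have m0 : ζ ≠ Irr.triv := ntriv_of_dg (by omega)
    have m1 : ζ ≠ φ := ne_of_dg (by omega)
    have m2 : p ≠ φ := ne_of_dg (by omega)
    have m3 : q ≠ φ := ne_of_dg (by omega)
    have m4 : η₁ ≠ ζ := ne_of_dg (by omega)
    have m5 : η₂ ≠ ζ := ne_of_dg (by omega)
    rw [e, e4, ← Irr.triv_val] at this
    simp only [cip_add_left, cip_irr_ne m0.symm, cip_irr_ne m1, cip_irr_ne m1.symm, cip_irr_ne m2, cip_irr_ne m3,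
      cip_irr_ne m4, cip_irr_ne m5, cip_irr_ne (Ne.symm hcon.1), cip_irr_ne (Ne.symm hcon.2), cip_irr_self] at this
    norm_num at this
  have hψω : ψ = ω := (hall ψ hψ).resolve_left hne
  subst hψω
  have m5 : η₂ ≠ ψ := ne_of_dg (by omega)
  have hη1 : η₁ = η := by
    apply eq_of_cip_ne
    have : cip (χ.1 * ψ.1) η.1 = 1 := by
      rw [cip_real hr, e3]
      simp only [cip_add_right, cip_irr_ne n2, cip_irr_self, cip_irr_ne m5.symm]; norm_num
    rw [e2, cip_add_left, cip_irr_ne n3.symm, zero_add] at this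
    rw [this]; norm_num
  subst hη1
  exact ⟨ψ, η₁, η₂, hψ, hη, hη₂, hne, e1, e2, e3, hall⟩

theorem Good.final_table (hg : Good G x) :
    ∃ χ ψ η φ : Irr G, χ.dg = 3 ∧ ψ.dg = 3 ∧ η.dg = 4 ∧ φ.dg = 5 ∧ ψ ≠ χ ∧ χ.1 * χ.1 = 1 + χ.1 + φ.1 ∧
      χ.1 * φ.1 = χ.1 + φ.1 + ψ.1 + η.1 ∧
      χ.1 * ψ.1 = φ.1 + η.1 ∧ χ.1 * η.1 = φ.1 + ψ.1 + η.1 := by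
  obtain ⟨χ, h⟩ := hg.exists_three
  obtain ⟨φ, hφ5, hφr, hsq⟩ := hg.sqr h
  have hφ : ∀ χ : Irr G, χ.dg = 3 → χ.1 * χ.1 = 1 + χ.1 + φ.1 := by
    intro ψ hψ
    obtain ⟨φ', h1, h2, h3⟩ := hg.sqr hψ
    rw [hg.same h hψ hφ5 h1 hsq h3]; exact h3
  obtain ⟨ψ, η, η', hψ, hη, hη', hne, e1, e2, e3, hall⟩ := hg.table hφ5 hφr hφ h
  obtain ⟨χ', ζ, ζ', hχ', hζ, hζ', hne', f1, f2, f3, hall'⟩ := hg.table hφ5 hφr hφ hψ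
  obtain rfl : χ = χ' := (hall' χ h).resolve_left (Ne.symm hne)
  obtain rfl : η = ζ := by
    rw [mul_comm, e2] at f2
    exact Irr.ext (add_left_cancel f2)
  have hr := hg.real h
  have hψt : ψ ≠ Irr.triv := ntriv_of_dg (by omega)
  have n2 : ψ ≠ φ := ne_of_dg (by omega)
  have n3 : η ≠ φ := ne_of_dg (by omega)
  have n4 : η ≠ χ := ne_of_dg (by omega)
  have n5 : η ≠ ψ := ne_of_dg (by omega)
  have n6 : η' ≠ φ := ne_of_dg (by omega)
  have n7 : η' ≠ ψ := ne_of_dg (by omega)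
  have g1 : cip (φ.1 * η.1) ψ.1 = 1 := by
    rw [cip_real hφr, mul_comm, f1]
    simp only [cip_add_right, cip_irr_ne n4, cip_irr_ne n3, cip_irr_ne n5, cip_irr_self]; norm_num
  have g2 : φ.1 * η.1 = χ.1 * (φ.1 + ψ.1 + η'.1) - η.1 - (φ.1 + ψ.1 + η'.1) := by
    linear_combination (-η.1) * hφ χ h + (χ.1 - 1) * e3
  rw [g2, cip_sub_left, cip_sub_left, cip_real hr, e2] at g1
  simp only [cip_add_left, cip_add_right, cip_irr_ne n3, cip_irr_ne n3.symm, cip_irr_ne n5, cip_irr_ne n5.symm, cip_irr_ne n2, cip_irr_ne n2.symm,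
    cip_irr_ne n6, cip_irr_ne n7, cip_irr_self] at g1
  have : η' = η := by
    apply eq_of_cip_ne
    intro h0
    rw [h0] at g1; norm_num at g1
  subst this
  exact ⟨χ, ψ, η', φ, h, hψ, hη, hφ5, hne, hφ χ h, e1, e2, e3⟩

/-- a class function killed by a faithful character behaves like a multiple of the regular one -/
theorem cip_delta {f : G → ℂ} (hf : ∀ g, g ≠ 1 → f g = 0) (ζ : Irr G) :
    cip f ζ.1 * Nat.card G = f 1 * ζ.dg := by
  unfold cip
  rw [Finset.sum_eq_single 1 (fun g _ hg => by rw [hf g hg, zero_mul]) (by simp), inv_one, ζ.one_eq]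
  field_simp [card_ne (G := G)]

theorem Good.main (hg : Good G x) :
    Nat.card G = 60 ∧ ∑ χ : Irr G, χ.dg = 16 ∧ Fintype.card (Irr G) = 5 ∧
      Nat.card (Subgroup.centralizer {x}) = 4 ∧
      ∃ χ ψ : Irr G, ∀ ω : Irr G, ω.dg = 3 → ω = χ ∨ ω = ψ := by
  classical
  obtain ⟨χ, ψ, η, φ, hχ, hψ, hη, hφ, hne, e1, e2, e3, e4⟩ := hg.final_table
  have htχ : χ ≠ Irr.triv := ntriv_of_dg (by omega)
  have htψ : ψ ≠ Irr.triv := ntriv_of_dg (by omega)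
  have htη : η ≠ Irr.triv := ntriv_of_dg (by omega)
  have htφ : φ ≠ Irr.triv := ntriv_of_dg (by omega)
  have n1 : χ ≠ φ := ne_of_dg (by omega)
  have n2 : ψ ≠ φ := ne_of_dg (by omega)
  have n3 : η ≠ φ := ne_of_dg (by omega)
  have n4 : η ≠ χ := ne_of_dg (by omega)
  have n5 : η ≠ ψ := ne_of_dg (by omega)
  let ρ : G → ℂ := (Irr.triv : Irr G).1 + (3:ℂ) • χ.1 + (3:ℂ) • ψ.1 + (4:ℂ) • η.1 + (5:ℂ) • φ.1
  have hρ : ρ = (Irr.triv : Irr G).1 + (3:ℂ) • χ.1 + (3:ℂ) • ψ.1 + (4:ℂ) • η.1 + (5:ℂ) • φ.1 := rfl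
  have hρg : ∀ g, (χ.1 g - 3) * ρ g = 0 := by
    intro g
    have a1 := congrFun e1 g
    have a2 := congrFun e2 g
    have a3 := congrFun e3 g
    have a4 := congrFun e4 g
    simp only [Pi.mul_apply, Pi.add_apply, Pi.one_apply] at a1 a2 a3 a4
    simp only [hρ, Pi.add_apply, Pi.smul_apply, Irr.triv_val, Pi.one_apply, smul_eq_mul]
    linear_combination 3 * a1 + 5 * a2 + 3 * a3 + 4 * a4
  have hρ0 : ∀ g, g ≠ 1 → ρ g = 0 := by
    intro g hg1
    rcases mul_eq_zero.1 (hρg g) with h | h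
    · exact absurd (hg.faith χ htχ g (by rw [hχ]; push_cast; linear_combination h)) hg1
    · exact h
  have hρ1 : ρ 1 = 60 := by
    simp only [hρ, Pi.add_apply, Pi.smul_apply, Irr.one_eq, hχ, hψ, hη, hφ, Irr.triv_dg, smul_eq_mul]
    norm_num
  have hcard : Nat.card G = 60 := by
    have := cip_delta hρ0 Irr.triv
    rw [hρ1, Irr.triv_dg, hρ] at this
    simp only [cip_add_left, cip_smul_left, cip_irr_ne htχ, cip_irr_ne htψ, cip_irr_ne htη, cip_irr_ne htφ, cip_irr_self] at this
    norm_num at this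
    rw [Nat.card_eq_fintype_card]; exact_mod_cast this
  have hall : ∀ ζ : Irr G, ζ = Irr.triv ∨ ζ = χ ∨ ζ = ψ ∨ ζ = η ∨ ζ = φ := by
    intro ζ
    by_contra hcon
    push Not at hcon
    obtain ⟨b1, b2, b3, b4, b5⟩ := hcon
    have := cip_delta hρ0 ζ
    rw [hρ1, hρ] at this
    simp only [cip_add_left, cip_smul_left, cip_irr_ne b1.symm, cip_irr_ne b2.symm, cip_irr_ne b3.symm, cip_irr_ne b4.symm, cip_irr_ne b5.symm] at this
    norm_num at this
    exact ζ.dg_pos.ne' this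
  have huniv : (Finset.univ : Finset (Irr G)) = {Irr.triv, χ, ψ, η, φ} := by
    ext ζ; simpa using hall ζ
  have hsum : ∀ f : Irr G → ℂ, ∑ ζ : Irr G, f ζ = f Irr.triv + (f χ + (f ψ + (f η + f φ))) := by
    intro f
    rw [huniv, Finset.sum_insert (by simp [htχ.symm, htψ.symm, htη.symm, htφ.symm]),
      Finset.sum_insert (by simp [hne.symm, n4.symm, n1]), Finset.sum_insert (by simp [n5.symm, n2]),
      Finset.sum_insert (by simp [n3]), Finset.sum_singleton]
  refine ⟨hcard, ?_, ?_, ?_, χ, ψ, ?_⟩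
  · have := hg.B
    rw [hcard] at this; omega
  · have := hsum (fun _ => 1)
    norm_num at this
    exact_mod_cast this
  · have hxi : x⁻¹ = x := inv_eq_of_mul_eq_one_left hg.sq
    have := sum_mul_inv x
    rw [hsum, hxi, hg.val χ htχ, hg.val ψ htψ, hg.val η htη, hg.val φ htφ, hχ, hψ, hη, hφ, Irr.triv_val] at this
    norm_num at this
    rw [Nat.card_eq_fintype_card]; exact_mod_cast this.symm
  · intro ω hω
    rcases hall ω with rfl | rfl | rfl | rfl | rfl
    · rw [Irr.triv_dg] at hω; omega
    · left; rfl
    · right; rfl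
    · omega
    · omega
end Main

open CategoryTheory
set_option linter.unusedSectionVars false
set_option linter.unusedSimpArgs false

section Odd
variable {G : Type} [Group G] [Fintype G] {x : G}

theorem odd_half_sum (ho : Odd (Nat.card G)) (f : G → ℂ) (hf : ∀ g, f g⁻¹ = f g) :
    ∃ t : Finset G, ∑ g : G, f g = f 1 + 2 * ∑ g ∈ t, f g := by
  classical
  let e := Fintype.equivFin G
  have h1 : ∀ g : G, e g = e g⁻¹ → g = 1 := by
    intro g hg
    have h2 : g = g⁻¹ := e.injective hg
    have h3 : g ^ 2 = 1 := by rw [pow_two]; nth_rw 2 [h2]; simp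
    have h4 := orderOf_dvd_of_pow_eq_one h3
    have h5 : orderOf g ∣ Nat.card G := orderOf_dvd_natCard g
    have h6 : orderOf g ∣ 1 := by
      have : Nat.Coprime 2 (Nat.card G) := by rw [Nat.coprime_two_left]; exact ho
      rw [← this]; exact Nat.dvd_gcd h4 h5
    exact orderOf_eq_one_iff.1 (Nat.dvd_one.1 h6)
  refine ⟨Finset.univ.filter (fun g => e g < e g⁻¹), ?_⟩
  have hA : ∑ g ∈ Finset.univ.filter (fun g => e g⁻¹ < e g), f g = ∑ g ∈ Finset.univ.filter (fun g => e g < e g⁻¹), f g := by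
    refine Finset.sum_bij' (fun g _ => g⁻¹) (fun g _ => g⁻¹) ?_ ?_ ?_ ?_ ?_
    · intro g hg; simpa using hg
    · intro g hg; simpa using hg
    · intro g _; simp
    · intro g _; simp
    · intro g _; exact (hf g).symm
  rw [← Finset.sum_filter_add_sum_filter_not Finset.univ (fun g => e g < e g⁻¹)]
  have hB : Finset.univ.filter (fun g => ¬ e g < e g⁻¹) = insert 1 (Finset.univ.filter (fun g => e g⁻¹ < e g)) := by
    ext g
    simp only [Finset.mem_filter, Finset.mem_univ, true_and, Finset.mem_insert, not_lt]
    constructor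
    · intro h
      rcases h.lt_or_eq with h | h
      · right; exact h
      · left; exact h1 g h.symm
    · rintro (rfl | h)
      · simp
      · exact h.le
  rw [hB, Finset.sum_insert (by simp), hA]; ring

theorem parity (ho : Odd (Nat.card G)) {f : G → ℂ} (hn : NChar f) (hf : ∀ g, f g⁻¹ = f g) {n d : ℕ}
    (hc : cip f 1 = n) (hd : f 1 = d) : n % 2 = d % 2 := by
  obtain ⟨t, ht⟩ := odd_half_sum ho f hf
  have h1 : (Nat.card G : ℂ) * n = d + 2 * ∑ g ∈ t, f g := by
    rw [← hc, ← hd, ← ht]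
    unfold cip
    simp only [Pi.one_apply, mul_one]
    rw [← mul_assoc, mul_inv_cancel₀ card_ne, one_mul]
  have hi : IsIntegral ℤ (∑ g ∈ t, f g) := IsIntegral.sum _ fun g _ => hn.isIntegral g
  have h2 : (∑ g ∈ t, f g) = algebraMap ℚ ℂ (((Nat.card G : ℚ) * n - d) / 2) := by
    simp only [eq_ratCast]
    push_cast
    linear_combination (-1/2) * h1
  rw [h2, isIntegral_algebraMap_iff (algebraMap ℚ ℂ).injective] at hi
  obtain ⟨z, hz⟩ := IsIntegrallyClosed.isIntegral_iff.1 hi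
  have h3 : (Nat.card G : ℤ) * n - d = 2 * z := by
    have : ((Nat.card G : ℚ) * n - d) = 2 * z := by
      have : (z : ℚ) = ((Nat.card G : ℚ) * n - d) / 2 := hz
      rw [this]; ring
    exact_mod_cast this
  obtain ⟨c, hc⟩ := ho
  rw [hc] at h3
  push_cast at h3
  have : (n : ℤ) - d = 2 * (z - c * n) := by linear_combination h3
  omega

theorem odd_dg (ho : Odd (Nat.card G)) (χ : Irr G) : χ.dg % 2 = 1 := by
  have := parity ho (χ.nchar.mul χ.dual.nchar) (fun g => by simp [Irr.dual_apply, mul_comm]) (n := 1) (d := χ.dg * χ.dg)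
    (by have := χ.mul_dual_cip χ.dual
        rw [if_pos rfl, Irr.triv_val] at this
        rw [this]; simp) (by rw [Pi.mul_apply, χ.one_eq, χ.dual.one_eq, Irr.dual_dg]; push_cast; ring)
  rcases Nat.mod_two_eq_zero_or_one χ.dg with h | h
  · rw [Nat.mul_mod, h] at this; simp at this
  · exact h

theorem odd_not_real (ho : Odd (Nat.card G)) {χ : Irr G} (h : χ ≠ Irr.triv) : χ.dual ≠ χ := by
  intro e
  have := parity ho χ.nchar (fun g => by rw [← Irr.dual_apply, e]) (n := 0) (d := χ.dg)
    (by have := cip_irr_ne h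
        rw [Irr.triv_val] at this; rw [this]; simp) χ.one_eq
  have := odd_dg ho χ
  omega

theorem odd_dg_ge (hp : commutator G = ⊤) (ho : Odd (Nat.card G)) {χ : Irr G} (h : χ ≠ Irr.triv) : 5 ≤ χ.dg := by
  have hge : ∀ a : Irr G, a ≠ Irr.triv → 3 ≤ a.dg := fun a ha => by
    have h1 := odd_dg ho a
    have h2 : a.dg ≠ 1 := fun e => ha (perfect_dg_one hp a e)
    omega
  by_contra hlt
  have h3 : χ.dg = 3 := by
    have := hge χ h
    have := odd_dg ho χ
    omega
  obtain ⟨t, ht⟩ := ((χ.nchar.mul χ.dual.nchar).sub_irr Irr.triv (by rw [Irr.mul_dual_cip, if_pos rfl]; simp)).exists_multiset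
  change _ = msum t at ht
  have htr : Irr.triv ∉ t := by
    have := χ.mul_dual_cip χ.dual
    have h2 := cip_msum t Irr.triv
    rw [← ht, cip_sub_left, this, if_pos rfl, cip_irr_self, sub_self] at h2
    exact Multiset.count_eq_zero.1 (by exact_mod_cast h2.symm)
  have hd : (t.map Irr.dg).sum + 1 = χ.dg * χ.dg := by
    have := congrFun ht 1
    rw [msum_one, Pi.sub_apply, Pi.mul_apply, χ.one_eq, χ.dual.one_eq, Irr.dual_dg, Irr.triv_val] at this
    have h3 : (χ.dg : ℂ) * χ.dg = ((t.map Irr.dg).sum : ℕ) + 1 := by rw [← this]; simp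
    exact_mod_cast h3.symm
  have ht3 : ∀ a ∈ t, 3 ≤ a.dg := fun a ha => hge a (fun e => htr (e ▸ ha))
  have hdual : ∀ a ∈ t, a.dual ∈ t := by
    intro a ha
    apply mem_of_cip
    have : cip (msum t) a.dual.1 = cip (msum t) a.1 := by
      rw [← cip_inv_inv, ← ht]
      congr 1
      · funext g; simp [Irr.dual_apply, mul_comm, Irr.triv_val]
      · funext g; simp [Irr.dual_apply]
    rw [this, cip_msum]
    exact_mod_cast (Multiset.count_pos.2 ha).ne'
  have h4 := three_le_sum t ht3
  have key : ∀ a b : Irr G, a.dg = 5 → b.dg = 3 → t = {a, b} → False := by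
    intro a b ha hb e
    have := hdual a (by simp [e])
    rw [e] at this
    simp at this
    rcases this with h | h
    · exact odd_not_real ho (ntriv_of_dg (by omega)) h
    · have := congrArg Irr.dg h
      rw [Irr.dual_dg] at this; omega
  have hc : t.card = 0 ∨ t.card = 1 ∨ t.card = 2 := by rw [h3] at hd; omega
  rw [h3] at hd
  rcases hc with hc | hc | hc
  · rw [Multiset.card_eq_zero.1 hc] at hd; simp at hd
  · obtain ⟨a, rfl⟩ := Multiset.card_eq_one.1 hc
    have := odd_dg ho a
    simp at hd; omega
  · obtain ⟨a, b, rfl⟩ := Multiset.card_eq_two.1 hc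
    have h5 := odd_dg ho a
    have h6 := odd_dg ho b
    have h7 := ht3 a (by simp)
    have h8 := ht3 b (by simp)
    simp at hd
    have : (a.dg = 5 ∧ b.dg = 3) ∨ (a.dg = 3 ∧ b.dg = 5) := by omega
    rcases this with ⟨h1, h2⟩ | ⟨h1, h2⟩
    · exact key a b h1 h2 rfl
    · exact key b a h2 h1 (by rw [Multiset.pair_comm])

theorem card_gt_one_irr (h : 1 < Nat.card G) : ∃ χ : Irr G, χ ≠ Irr.triv := by
  classical
  by_contra hcon
  push Not at hcon
  have : (Finset.univ : Finset (Irr G)) = {Irr.triv} := by ext a; simp [hcon a]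
  have h2 := sum_dg_sq (G := G)
  rw [this, Finset.sum_singleton, Irr.triv_dg] at h2
  omega

theorem sum_erase_triv (f : Irr G → ℕ) : ∑ χ : Irr G, f χ = f Irr.triv + ∑ χ ∈ Finset.univ.erase Irr.triv, f χ :=
  (Finset.add_sum_erase _ _ (Finset.mem_univ _)).symm

theorem card_erase_triv : (Finset.univ.erase (Irr.triv : Irr G)).card + 1 = Fintype.card (Irr G) := by
  rw [Finset.card_erase_of_mem (Finset.mem_univ _), Finset.card_univ]
  have : 0 < Fintype.card (Irr G) := Fintype.card_pos_iff.2 ⟨Irr.triv⟩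
  omega

theorem perfect_even (hp : commutator G = ⊤) (h1 : 1 < Nat.card G) (hk : Nat.card G < 16 * Fintype.card (Irr G)) :
    ¬ Odd (Nat.card G) := by
  intro ho
  have hs := sum_dg_sq (G := G)
  rw [sum_erase_triv, Irr.triv_dg] at hs
  have h2 : (Finset.univ.erase (Irr.triv : Irr G)).card * 25 ≤ ∑ χ ∈ Finset.univ.erase (Irr.triv : Irr G), χ.dg ^ 2 := by
    rw [← smul_eq_mul]
    apply Finset.card_nsmul_le_sum
    intro a ha
    have := odd_dg_ge hp ho (Finset.ne_of_mem_erase ha)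
    nlinarith
  have h3 := card_erase_triv (G := G)
  obtain ⟨χ, hχ⟩ := card_gt_one_irr h1
  have h4 := odd_not_real ho hχ
  have h5 : 2 ≤ (Finset.univ.erase (Irr.triv : Irr G)).card := by
    rw [← Finset.card_pair h4]
    apply Finset.card_le_card
    intro a ha
    simp at ha
    rcases ha with rfl | rfl
    · simp [dual_ne_triv hχ]
    · simp [hχ]
  omega

theorem exists_invol (he : ¬ Odd (Nat.card G)) : ∃ x : G, x ≠ 1 ∧ x * x = 1 := by
  rw [Nat.not_odd_iff_even] at he
  obtain ⟨x, hx⟩ := exists_prime_orderOf_dvd_card' (G := G) 2 he.two_dvd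
  refine ⟨x, fun h => ?_, ?_⟩
  · rw [h, orderOf_one] at hx; omega
  · rw [← pow_two, ← hx, pow_orderOf_eq_one]

theorem simple_tenth [IsSimpleGroup G] (hp : commutator G = ⊤) {x : G} (hx1 : x ≠ 1) (hx : x * x = 1) :
    10 * Fintype.card (Irr G) ≤ Nat.card G := by
  have hge := fun χ h => simple_dg_ge (χ := χ) hp hx1 hx h
  by_cases hB : Nat.card G < 4 * ∑ χ : Irr G, χ.dg
  · obtain ⟨a, b, c, d⟩ := (exists_good hp hx1 hx hB).main
    omega
  push Not at hB
  have hk := card_erase_triv (G := G)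
  have hs := sum_dg_sq (G := G)
  rw [sum_erase_triv, Irr.triv_dg] at hB hs
  have h2 : (Finset.univ.erase (Irr.triv : Irr G)).card * 3 ≤ ∑ χ ∈ Finset.univ.erase (Irr.triv : Irr G), χ.dg := by
    rw [← smul_eq_mul]
    apply Finset.card_nsmul_le_sum
    intro a ha
    exact hge a (Finset.ne_of_mem_erase ha)
  by_cases h4 : 3 ≤ (Finset.univ.erase (Irr.triv : Irr G)).card
  · omega
  have h5 : 1 < Nat.card G := by
    have : Nontrivial G := ⟨x, 1, hx1⟩
    exact Finite.one_lt_card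
  have : (Finset.univ.erase (Irr.triv : Irr G)).card = 0 ∨ (Finset.univ.erase (Irr.triv : Irr G)).card = 1 ∨ (Finset.univ.erase (Irr.triv : Irr G)).card = 2 := by omega
  rcases this with h | h | h
  · rw [Finset.card_eq_zero.1 h] at hs
    simp at hs; rw [Nat.card_eq_fintype_card] at h5; omega
  · rw [h] at hk
    obtain ⟨a, ha⟩ := Finset.card_eq_one.1 h
    rw [ha, Finset.sum_singleton] at hs hB
    rw [← hs, ← hk]
    rw [← hs] at hB
    nlinarith
  · rw [h] at hk
    obtain ⟨a, b, hab, ha⟩ := Finset.card_eq_two.1 h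
    rw [ha, Finset.sum_pair hab] at hs hB
    have ha3 := hge a (by have : a ∈ Finset.univ.erase (Irr.triv : Irr G) := by rw [ha]; simp
                          exact Finset.ne_of_mem_erase this)
    have hb3 := hge b (by have : b ∈ Finset.univ.erase (Irr.triv : Irr G) := by rw [ha]; simp
                          exact Finset.ne_of_mem_erase this)
    rw [← hs, ← hk]
    rw [← hs] at hB
    by_contra hlt
    have a1 : a.dg ≤ 5 := by nlinarith
    have b1 : b.dg ≤ 5 := by nlinarith
    interval_cases a.dg <;> interval_cases b.dg <;> omega
end Odd

open CategoryTheory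
set_option linter.unusedSectionVars false
set_option linter.unusedSimpArgs false

section CovS
variable {D : Type} [Group D]

theorem perfect_top (hp : commutator D = ⊤) (K : Subgroup D) (h : ∀ g h : D, g * h * g⁻¹ * h⁻¹ ∈ K) : K = ⊤ := by
  rw [eq_top_iff, ← hp, commutator_def, Subgroup.commutator_le]
  exact fun g _ k _ => h g k

theorem perfect_quot (hp : commutator D = ⊤) (N : Subgroup D) [N.Normal] : commutator (D ⧸ N) = ⊤ := by
  have := map_commutator_eq D (QuotientGroup.mk' N)
  rw [MonoidHom.range_eq_top.2 (QuotientGroup.mk'_surjective N), hp,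
    Subgroup.map_top_of_surjective _ (QuotientGroup.mk'_surjective N)] at this
  exact this.symm

structure Cov (D : Type) [Group D] (N : Subgroup D) : Prop where
  perf : commutator D = ⊤
  cen : N ≤ Subgroup.center D
  max : ∀ K : Subgroup D, K.Normal → ¬ K ≤ N → K = ⊤

theorem exists_cov [Fintype D] [Nontrivial D] (hp : commutator D = ⊤) (hc : 1/16 < commProb D) :
    ∃ (N : Subgroup D) (_ : N.Normal), Cov D N ∧ IsSimpleGroup (D ⧸ N) ∧ ∃ x, x ∉ N ∧ x * x ∈ N := by
  classical
  obtain ⟨N, hN⟩ := (Set.toFinite {W : Subgroup D | W.Normal ∧ W ≠ ⊤}).exists_maximal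
    ⟨⊥, inferInstance, bot_ne_top⟩
  obtain ⟨hNn, hNt⟩ := hN.1
  have hmax : ∀ K : Subgroup D, K.Normal → N ≤ K → K = N ∨ K = ⊤ := by
    intro K hK hle
    by_cases h : K = ⊤
    · right; exact h
    · left; exact le_antisymm (hN.2 (show K.Normal ∧ K ≠ ⊤ from ⟨hK, h⟩) hle) hle
  have hnt : Nontrivial (D ⧸ N) := QuotientGroup.nontrivial_iff.2 hNt
  have hsimp : IsSimpleGroup (D ⧸ N) := by
    refine ⟨fun H hH => ?_⟩
    have hle : N ≤ H.comap (QuotientGroup.mk' N) := by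
      intro n hn
      rw [Subgroup.mem_comap, QuotientGroup.mk'_apply, (QuotientGroup.eq_one_iff n).2 hn]; exact one_mem _
    rcases hmax _ (hH.comap _) hle with h | h
    · left
      rw [eq_bot_iff]
      intro q hq
      obtain ⟨g, rfl⟩ := QuotientGroup.mk'_surjective N q
      have : g ∈ N := by rw [← h]; exact hq
      rw [Subgroup.mem_bot, QuotientGroup.mk'_apply, (QuotientGroup.eq_one_iff g).2 this]
    · right
      rw [eq_top_iff]
      intro q _
      obtain ⟨g, rfl⟩ := QuotientGroup.mk'_surjective N q
      have : g ∈ H.comap (QuotientGroup.mk' N) := by rw [h]; trivial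
      exact this
  have hpq := perfect_quot hp N
  have hgal := gallagher (QuotientGroup.mk' N) (QuotientGroup.mk'_surjective N)
  rw [QuotientGroup.ker_mk'] at hgal
  have hq : commProb D ≤ commProb (D ⧸ N) := gallagher_quot (QuotientGroup.mk' N) (QuotientGroup.mk'_surjective N)
  have hq0 : (0:ℚ) < Nat.card (D ⧸ N) := by exact_mod_cast Nat.card_pos
  have hk16 : Nat.card (D ⧸ N) < 16 * Fintype.card (Irr (D ⧸ N)) := by
    have h1 : 1/16 < commProb (D ⧸ N) := lt_of_lt_of_le hc hq
    rw [commProb_def', lt_div_iff₀ hq0, ← card_irr] at h1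
    have : (Nat.card (D ⧸ N) : ℚ) < 16 * Fintype.card (Irr (D ⧸ N)) := by linarith
    exact_mod_cast this
  obtain ⟨X, hX1, hX2⟩ := exists_invol (perfect_even hpq Finite.one_lt_card hk16)
  have hten : commProb (D ⧸ N) ≤ 1/10 := by
    have h1 := simple_tenth hpq hX1 hX2
    rw [commProb_def', div_le_iff₀ hq0, ← card_irr]
    have : (10:ℚ) * Fintype.card (Irr (D ⧸ N)) ≤ Nat.card (D ⧸ N) := by exact_mod_cast h1
    linarith
  have hNc : 5/8 < commProb N := by
    by_contra hle
    push Not at hle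
    have := commProb_pos (D ⧸ N)
    have h0 := commProb_pos N
    nlinarith
  have hcomm := commProb_five_eighths hNc
  have hV : ∀ v ∈ N, ∀ w ∈ N, v * w = w * v := fun v hv w hw =>
    congrArg Subtype.val (hcomm ⟨v, hv⟩ ⟨w, hw⟩)
  have hNC : N ≤ Subgroup.centralizer (N : Set D) := fun v hv => by
    rw [Subgroup.mem_centralizer_iff]
    exact fun w hw => hV w hw v hv
  have hcen : N ≤ Subgroup.center D := by
    rcases hmax (Subgroup.centralizer (N : Set D)) inferInstance hNC with h | h
    · exfalso
      have : ∃ y, y * y ∉ N := by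
        by_contra hcon
        push Not at hcon
        apply hNt
        apply perfect_top hp
        have hsq : ∀ q : D ⧸ N, q * q = 1 := by
          intro q
          obtain ⟨g, rfl⟩ := QuotientGroup.mk'_surjective N q
          rw [← map_mul, QuotientGroup.mk'_apply, (QuotientGroup.eq_one_iff _).2 (hcon g)]
        intro a b
        rw [← QuotientGroup.eq_one_iff]
        have e1 : ∀ q : D ⧸ N, q⁻¹ = q := fun q => inv_eq_of_mul_eq_one_left (hsq q)
        rw [QuotientGroup.mk_mul, QuotientGroup.mk_mul, QuotientGroup.mk_mul, QuotientGroup.mk_inv, QuotientGroup.mk_inv, e1 (a : D ⧸ N), e1 (b : D ⧸ N), mul_assoc]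
        exact hsq _
      obtain ⟨y, hy⟩ := this
      have h2 := half_V N hV y (by rw [h]; exact hy)
      have h3 : commProb (D ⧸ Subgroup.centralizer (N : Set D)) ≤ commProb (D ⧸ N) :=
        gallagher_quot (QuotientGroup.quotientMulEquivOfEq h).toMonoidHom (QuotientGroup.quotientMulEquivOfEq h).surjective
      linarith
    · intro n hn
      rw [Subgroup.mem_center_iff]
      intro g
      have : g ∈ Subgroup.centralizer (N : Set D) := by rw [h]; trivial
      exact ((Subgroup.mem_centralizer_iff.1 this) n hn).symm
  refine ⟨N, hNn, ⟨hp, hcen, ?_⟩, hsimp, ?_⟩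
  · intro K hK hKN
    have h1 : K ⊔ N = ⊤ := by
      rcases hmax (K ⊔ N) inferInstance le_sup_right with h | h
      · exact absurd (h ▸ le_sup_left) hKN
      · exact h
    apply perfect_top hp
    intro g k
    have hg : g ∈ K ⊔ N := by rw [h1]; trivial
    obtain ⟨a, ha, n, hn, rfl⟩ := Subgroup.mem_sup_of_normal_right.1 hg
    rw [← QuotientGroup.eq_one_iff]
    have hn' := Subgroup.mem_center_iff.1 (hcen hn) k
    have e1 : ((a * n : D) : D ⧸ K) = (n : D ⧸ K) := by
      rw [QuotientGroup.mk_mul, (QuotientGroup.eq_one_iff a).2 ha, one_mul]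
    rw [QuotientGroup.mk_mul, QuotientGroup.mk_mul, QuotientGroup.mk_mul, QuotientGroup.mk_inv, QuotientGroup.mk_inv, e1,
      ← QuotientGroup.mk_mul, ← hn', QuotientGroup.mk_mul]
    simp
  · obtain ⟨x, rfl⟩ := QuotientGroup.mk'_surjective N X
    refine ⟨x, fun h => hX1 ?_, ?_⟩
    · rw [QuotientGroup.mk'_apply, (QuotientGroup.eq_one_iff x).2 h]
    · rw [← map_mul, QuotientGroup.mk'_apply, QuotientGroup.eq_one_iff] at hX2
      exact hX2
end CovS

open CategoryTheory
set_option linter.unusedSectionVars false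
set_option linter.unusedSimpArgs false

section Blocks
variable {D : Type} [Group D] [Fintype D] {N : Subgroup D}

/-- central character on `N` -/
noncomputable def lam (N : Subgroup D) (χ : Irr D) : N → ℂ := fun z => χ.1 z / χ.dg

theorem Irr.dg_ne (χ : Irr D) : (χ.dg : ℂ) ≠ 0 := by exact_mod_cast χ.dg_pos.ne'

theorem lam_apply (χ : Irr D) (z : N) : χ.1 z = lam N χ z * χ.dg := by
  unfold lam; rw [div_mul_cancel₀ _ χ.dg_ne]

theorem lam_act (hc : N ≤ Subgroup.center D) (χ : Irr D) (z : N) :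
    (∀ g, χ.1 (z * g) = lam N χ z * χ.1 g) ∧ (commutator D = ⊤ → lam N χ z ^ χ.dg = 1) := by
  obtain ⟨V, hV, hd, c, hz⟩ := central_scalar χ z (hc z.2)
  have h1 : ∀ g, χ.1 (z * g) = c * χ.1 g := by
    intro g
    rw [hV]
    show LinearMap.trace ℂ V (V.ρ (z * g)) = c * LinearMap.trace ℂ V (V.ρ g)
    rw [map_mul, hz, smul_mul_assoc, one_mul, map_smul, smul_eq_mul]
  have h2 : lam N χ z = c := by
    have := h1 1
    rw [mul_one, lam_apply, χ.one_eq] at this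
    exact mul_right_cancel₀ χ.dg_ne this
  rw [h2]
  refine ⟨h1, fun hp => ?_⟩
  have := perfect_det hp V z
  rw [hz, LinearMap.det_smul, map_one, mul_one, hd] at this
  exact this

theorem lam_one (χ : Irr D) : lam N χ 1 = 1 := by
  unfold lam
  rw [Subgroup.coe_one, χ.one_eq, div_self χ.dg_ne]

theorem lam_mul (hc : N ≤ Subgroup.center D) (χ : Irr D) (z w : N) :
    lam N χ (z * w) = lam N χ z * lam N χ w := by
  have h := (lam_act hc χ z).1 w
  rw [← Subgroup.coe_mul, lam_apply, lam_apply, ← mul_assoc] at h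
  exact mul_right_cancel₀ χ.dg_ne h

theorem lam_inv_mul (hc : N ≤ Subgroup.center D) (χ : Irr D) (z : N) :
    lam N χ z⁻¹ * lam N χ z = 1 := by
  rw [← lam_mul hc, inv_mul_cancel, lam_one]

theorem lam_triv : lam N (Irr.triv : Irr D) = 1 := by
  funext z; simp [lam]

theorem cip_scal (hc : N ≤ Subgroup.center D) (z : N) {f : D → ℂ} {c : ℂ} (hf : ∀ g, f (z * g) = c * f g)
    (w : Irr D) (h : cip f w.1 ≠ 0) : lam N w z = c := by
  have h1 : cip f w.1 = c * lam N w z⁻¹ * cip f w.1 := by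
    conv_lhs => unfold cip
    rw [← Equiv.sum_comp (Equiv.mulLeft (z : D))]
    conv_rhs => unfold cip
    rw [mul_left_comm]
    congr 1
    rw [Finset.mul_sum]
    refine Finset.sum_congr rfl fun g _ => ?_
    have h2 : ((z : D) * g)⁻¹ = ((z⁻¹ : N) : D) * g⁻¹ := by
      rw [mul_inv_rev, Subgroup.coe_inv]
      exact Subgroup.mem_center_iff.1 (inv_mem (hc z.2)) _
    rw [Equiv.coe_mulLeft, hf, h2, (lam_act hc w z⁻¹).1]; ring
  have h2 : c * lam N w z⁻¹ = 1 := by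
    by_contra hne
    apply h
    have : (1 - c * lam N w z⁻¹) * cip f w.1 = 0 := by linear_combination h1
    rcases mul_eq_zero.1 this with h3 | h3
    · exact absurd (by linear_combination -h3) hne
    · exact h3
  have h3 := lam_inv_mul hc w z
  calc lam N w z = (c * lam N w z⁻¹) * lam N w z := by rw [h2, one_mul]
    _ = c * (lam N w z⁻¹ * lam N w z) := by ring
    _ = c := by rw [h3, mul_one]

theorem lam_constituent (hc : N ≤ Subgroup.center D) (a b w : Irr D) (h : cip (a.1 * b.1) w.1 ≠ 0) :
    lam N w = lam N a * lam N b := by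
  -- use `a (z g) * b (z g) = lam a z * lam b z * ...`
  funext z
  refine cip_scal hc z ?_ w h
  intro g
  simp only [Pi.mul_apply]
  rw [(lam_act hc a z).1, (lam_act hc b z).1]; ring

theorem block_aux (hc : N ≤ Subgroup.center D) (χ₀ : Irr D) (g : D) [Fintype N] [DecidableEq (N → ℂ)] [DecidableEq D] :
    (Nat.card N : ℂ) * ∑ χ : Irr D with lam N χ = lam N χ₀, χ.dg * χ.1 g =
      ∑ z : N, lam N χ₀ z⁻¹ * (if (z : D) * g = 1 then (Nat.card D : ℂ) else 0) := by
  classical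
  have h1 : ∀ z : N, lam N χ₀ z⁻¹ * (if (z : D) * g = 1 then (Nat.card D : ℂ) else 0) =
      ∑ χ : Irr D, (lam N χ₀ z⁻¹ * lam N χ z) * (χ.dg * χ.1 g) := by
    intro z
    have := sum_dg_mul ((z : D) * g)
    rw [← this, Finset.mul_sum]
    refine Finset.sum_congr rfl fun χ _ => ?_
    rw [(lam_act hc χ z).1]; ring
  rw [Finset.sum_congr rfl (fun z _ => h1 z), Finset.sum_comm, Finset.sum_filter, Finset.mul_sum]
  refine Finset.sum_congr rfl fun χ _ => ?_
  rw [← Finset.sum_mul]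
  split_ifs with h
  · congr 1
    rw [Finset.sum_congr rfl (fun z _ => by rw [h, lam_inv_mul hc]), Finset.sum_const, Finset.card_univ]
    simp
  · have hcomm : ∀ z w : N, z * w = w * z := fun z w =>
      Subtype.ext (by
        rw [Subgroup.coe_mul, Subgroup.coe_mul]
        exact Subgroup.mem_center_iff.1 (hc w.2) _)
    let f : N →* ℂ :=
      { toFun := fun z => lam N χ₀ z⁻¹ * lam N χ z
        map_one' := by rw [inv_one, lam_one, lam_one, mul_one]
        map_mul' := fun z w => by
          rw [mul_inv_rev, lam_mul hc, lam_mul hc]; ring }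
    have hf : f ≠ 1 := by
      intro hf
      apply h
      funext z
      have h2 : lam N χ₀ z⁻¹ * lam N χ z = 1 := congrArg (fun F : N →* ℂ => F z) hf
      have h3 := lam_inv_mul hc χ₀ z
      have h4 : lam N χ₀ z⁻¹ ≠ 0 := left_ne_zero_of_mul_eq_one h2
      exact mul_left_cancel₀ h4 (h2.trans h3.symm)
    have := sum_hom_units_eq_zero f hf
    have h5 : ∑ z : N, lam N χ₀ z⁻¹ * lam N χ z = 0 := this
    rw [h5, mul_zero, zero_mul]

theorem block_off (hc : N ≤ Subgroup.center D) (χ₀ : Irr D) {g : D} (hg : g ∉ N) [DecidableEq (N → ℂ)] :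
    ∑ χ : Irr D with lam N χ = lam N χ₀, (χ.dg : ℂ) * χ.1 g = 0 := by
  classical
  have h := block_aux hc χ₀ g
  rw [Finset.sum_eq_zero (s := (Finset.univ : Finset N))] at h
  · rcases mul_eq_zero.1 h with h | h
    · exact absurd h (by exact_mod_cast Nat.card_pos.ne')
    · exact h
  · intro z _
    rw [if_neg, mul_zero]
    intro e
    apply hg
    rw [eq_inv_of_mul_eq_one_right e]
    exact inv_mem z.2

theorem block_sq (hc : N ≤ Subgroup.center D) (χ₀ : Irr D) [DecidableEq (N → ℂ)] :
    ∑ χ : Irr D with lam N χ = lam N χ₀, χ.dg ^ 2 = Nat.card (D ⧸ N) := by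
  classical
  have h := block_aux hc χ₀ 1
  rw [Finset.sum_eq_single (1 : N)] at h
  · simp only [Subgroup.coe_one, mul_one, if_true, inv_one, lam_one, one_mul, Irr.one_eq] at h
    have h2 : Nat.card N * ∑ χ : Irr D with lam N χ = lam N χ₀, χ.dg ^ 2 = Nat.card D := by
      have : (Nat.card N : ℂ) * ∑ χ : Irr D with lam N χ = lam N χ₀, (χ.dg : ℂ) ^ 2 = Nat.card D := by
        rw [← h]; simp only [pow_two]
      exact_mod_cast this
    rw [Subgroup.card_eq_card_quotient_mul_card_subgroup N, mul_comm] at h2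
    exact Nat.eq_of_mul_eq_mul_right Nat.card_pos h2
  · intro z _ hz
    rw [if_neg, mul_zero]
    rw [mul_one]
    exact fun e => hz (Subtype.ext e)
  · simp

/-- block contribution -/
noncomputable def blk (N : Subgroup D) (l : N → ℂ) : ℤ :=
  open Classical in ∑ χ : Irr D with lam N χ = l, (χ.dg : ℤ) * (4 - χ.dg)

theorem blk_total [DecidableEq (N → ℂ)] : ∑ l ∈ Finset.univ.image (fun χ : Irr D => lam N χ), blk N l =
    4 * ((∑ χ : Irr D, χ.dg : ℕ) : ℤ) - Nat.card D := by
  classical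
  have h1 : (Nat.card D : ℤ) = ∑ χ : Irr D, (χ.dg : ℤ) ^ 2 := by exact_mod_cast (sum_dg_sq (G := D)).symm
  have h2 := Finset.sum_fiberwise_of_maps_to (s := (Finset.univ : Finset (Irr D)))
    (t := Finset.univ.image (fun χ : Irr D => lam N χ)) (g := fun χ => lam N χ)
    (fun χ h => Finset.mem_image_of_mem _ h) (fun χ => (χ.dg : ℤ) * (4 - χ.dg))
  rw [h1]
  push_cast
  rw [Finset.mul_sum, ← Finset.sum_sub_distrib]
  unfold blk
  convert h2 using 1
  · refine Finset.sum_congr rfl fun l _ => ?_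
    refine Finset.sum_congr ?_ fun _ _ => rfl
    ext; simp
  · refine Finset.sum_congr rfl fun χ _ => ?_
    ring

theorem Cov.ker_le (hD : Cov D N) {χ : Irr D} (h : χ ≠ Irr.triv) {g : D} (hg : χ.1 g = χ.dg) : g ∈ N := by
  by_contra hgN
  have h1 := hD.max χ.2.isChar.ker χ.2.isChar.ker_normal (fun hle => hgN (hle (hg.trans χ.one_eq.symm)))
  have h2 : ∀ g, χ.1 g = χ.1 1 := fun g => by
    have : g ∈ χ.2.isChar.ker := by rw [h1]; trivial
    exact this
  apply h
  have h3 : cip χ.1 (Irr.triv : Irr D).1 ≠ 0 := by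
    rw [Irr.triv_val]
    unfold cip
    simp only [Pi.one_apply, mul_one]
    rw [Finset.sum_congr rfl (fun g _ => h2 g), Finset.sum_const, Finset.card_univ, nsmul_eq_mul,
      ← Nat.card_eq_fintype_card, ← mul_assoc, inv_mul_cancel₀ card_ne, one_mul, χ.one_eq]
    exact χ.dg_ne
  exact eq_of_cip_ne h3

theorem block_nonpos (hD : Cov D N) (χ₀ : Irr D) (hl : lam N χ₀ ≠ 1) {y : D} (hy : y ∉ N) (hyy : y * y ∈ N)
    (h1 : lam N χ₀ ⟨y * y, hyy⟩ = 1) : blk N (lam N χ₀) ≤ 0 := by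
  classical
  have hoff := block_off hD.cen χ₀ hy
  have key : ∀ χ : Irr D, lam N χ = lam N χ₀ → ∃ k : ℤ, χ.1 y = k ∧ (χ.dg : ℤ) * (4 - χ.dg) ≤ - ((χ.dg : ℤ) * k) := by
    intro χ h
    have hnt : χ ≠ Irr.triv := by rintro rfl; exact hl (h ▸ lam_triv)
    have hv : χ.1 (y * y) = χ.dg := by
      have := lam_apply χ ⟨y * y, hyy⟩
      rw [h, h1, one_mul] at this
      exact this
    obtain ⟨m, hm1, hm2, hm3⟩ := χ.involution hD.perf y hv
    have hm : m ≠ 0 := fun e => hy (hD.ker_le hnt (hm3 e))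
    refine ⟨χ.dg - 4 * m, by rw [hm2]; push_cast; ring, ?_⟩
    have : (1:ℤ) ≤ m := by omega
    have h0 : (0:ℤ) ≤ χ.dg := by positivity
    nlinarith
  choose! k hk1 hk2 using key
  have h2 : ∑ χ : Irr D with lam N χ = lam N χ₀, (χ.dg : ℤ) * k χ = 0 := by
    have : ∑ χ : Irr D with lam N χ = lam N χ₀, (χ.dg : ℂ) * k χ = 0 := by
      rw [← hoff]
      refine Finset.sum_congr rfl fun χ hχ => ?_
      rw [hk1 χ (Finset.mem_filter.1 hχ).2]
    exact_mod_cast this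
  unfold blk
  calc _ ≤ ∑ χ : Irr D with lam N χ = lam N χ₀, -((χ.dg : ℤ) * k χ) := by
        refine Finset.sum_le_sum fun χ hχ => hk2 χ (Finset.mem_filter.1 hχ).2
    _ = 0 := by rw [Finset.sum_neg_distrib, h2, neg_zero]
end Blocks

open CategoryTheory
set_option linter.unusedSectionVars false
set_option linter.unusedSimpArgs false

section Infl
variable {D : Type} [Group D] [Fintype D] {N : Subgroup D} [hN : N.Normal] [Fintype (D ⧸ N)]

theorem sum_quot (F : D ⧸ N → ℂ) :
    (Nat.card D : ℂ)⁻¹ * ∑ g : D, F (g : D ⧸ N) = (Nat.card (D ⧸ N) : ℂ)⁻¹ * ∑ q, F q := by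
  have h1 : ∑ q : D ⧸ N, ∑ g : D, F (q * (g : D ⧸ N)) = (Nat.card (D ⧸ N) : ℂ) * ∑ g : D, F (g : D ⧸ N) := by
    have : ∀ q : D ⧸ N, ∑ g : D, F (q * (g : D ⧸ N)) = ∑ g : D, F (g : D ⧸ N) := by
      intro q
      obtain ⟨h, rfl⟩ := QuotientGroup.mk'_surjective N q
      exact Equiv.sum_comp (Equiv.mulLeft h) (fun g => F (g : D ⧸ N))
    rw [Finset.sum_congr rfl (fun q _ => this q), Finset.sum_const, Finset.card_univ, nsmul_eq_mul,
      ← Nat.card_eq_fintype_card]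
  have h2 : ∑ q : D ⧸ N, ∑ g : D, F (q * (g : D ⧸ N)) = (Nat.card D : ℂ) * ∑ q, F q := by
    rw [Finset.sum_comm]
    have : ∀ g : D, ∑ q : D ⧸ N, F (q * (g : D ⧸ N)) = ∑ q, F q := by
      intro g
      exact Equiv.sum_comp (Equiv.mulRight (g : D ⧸ N)) F
    rw [Finset.sum_congr rfl (fun q _ => this q), Finset.sum_const, Finset.card_univ, nsmul_eq_mul,
      ← Nat.card_eq_fintype_card]
  have h3 : (Nat.card D : ℂ) ≠ 0 := card_ne
  have h4 : (Nat.card (D ⧸ N) : ℂ) ≠ 0 := card_ne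
  field_simp
  linear_combination (h2.symm.trans h1).symm

theorem cip_infl (f h : D ⧸ N → ℂ) :
    cip (fun g : D => f (g : D ⧸ N)) (fun g : D => h (g : D ⧸ N)) = cip f h := 
  sum_quot (fun q => f q * h q⁻¹)

/-- inflation -/
noncomputable def infl (ψ : Irr (D ⧸ N)) : Irr D :=
  ⟨fun g => ψ.1 (g : D ⧸ N), isIrrChar_iff.2 ⟨ψ.2.isChar.comp (QuotientGroup.mk' N), by
    rw [cip_infl]; exact cip_irr_self ψ⟩⟩

theorem infl_dg (ψ : Irr (D ⧸ N)) : (infl ψ).dg = ψ.dg := by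
  have h1 := (infl ψ).one_eq
  have h2 : (infl ψ).1 1 = ψ.1 1 := rfl
  rw [h2, ψ.one_eq] at h1
  exact_mod_cast h1.symm

theorem infl_inj : Function.Injective (infl : Irr (D ⧸ N) → Irr D) := by
  intro a b h
  apply Irr.ext
  funext q
  obtain ⟨g, rfl⟩ := QuotientGroup.mk'_surjective N q
  exact congrFun (congrArg Irr.val h) g

theorem infl_lam (ψ : Irr (D ⧸ N)) : lam N (infl ψ) = 1 := by
  funext z
  have : (infl ψ).1 z = ψ.1 1 := by
    show ψ.1 ((z : D) : D ⧸ N) = _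
    rw [(QuotientGroup.eq_one_iff _).2 z.2]
  unfold lam
  rw [this, infl_dg, ψ.one_eq, div_self ψ.dg_ne]; rfl

theorem infl_image (hc : N ≤ Subgroup.center D) [DecidableEq (N → ℂ)] [DecidableEq (Irr D)] :
    (Finset.univ.image (infl : Irr (D ⧸ N) → Irr D)) = Finset.univ.filter (fun χ : Irr D => lam N χ = 1) := by
  have hsub : (Finset.univ.image (infl : Irr (D ⧸ N) → Irr D)) ⊆ Finset.univ.filter (fun χ : Irr D => lam N χ = 1) := by
    intro χ h
    obtain ⟨ψ, _, rfl⟩ := Finset.mem_image.1 h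
    exact Finset.mem_filter.2 ⟨Finset.mem_univ _, infl_lam ψ⟩
  refine Finset.Subset.antisymm hsub ?_
  intro χ hχ
  by_contra hno
  have h1 := block_sq hc (Irr.triv : Irr D)
  rw [lam_triv] at h1
  have h2 := sum_dg_sq (G := D ⧸ N)
  have h3 : ∑ χ ∈ (Finset.univ.image (infl : Irr (D ⧸ N) → Irr D)), χ.dg ^ 2 = ∑ χ : Irr (D ⧸ N), χ.dg ^ 2 := by
    rw [Finset.sum_image (fun a _ b _ h => infl_inj h)]
    simp only [infl_dg]
  have h4 := Finset.sum_lt_sum_of_subset hsub hχ hno (f := fun χ : Irr D => χ.dg ^ 2) (pow_pos χ.dg_pos 2) (fun _ _ _ => Nat.zero_le _)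
  omega

theorem exists_infl (hc : N ≤ Subgroup.center D) {χ : Irr D} (h : lam N χ = 1) : ∃ ψ : Irr (D ⧸ N), infl ψ = χ := by
  classical
  have : χ ∈ Finset.univ.filter (fun χ : Irr D => lam N χ = 1) := Finset.mem_filter.2 ⟨Finset.mem_univ _, h⟩
  rw [← infl_image hc] at this
  obtain ⟨ψ, _, h⟩ := Finset.mem_image.1 this
  exact ⟨ψ, h⟩

theorem blk_one (hc : N ≤ Subgroup.center D) :
    blk N 1 = 4 * ((∑ χ : Irr (D ⧸ N), χ.dg : ℕ) : ℤ) - Nat.card (D ⧸ N) := by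
  classical
  have h1 : (Nat.card (D ⧸ N) : ℤ) = ∑ χ : Irr (D ⧸ N), (χ.dg : ℤ) ^ 2 := by
    exact_mod_cast (sum_dg_sq (G := D ⧸ N)).symm
  rw [h1]
  unfold blk
  have h2 := infl_image (N := N) hc
  push_cast
  rw [Finset.mul_sum, ← Finset.sum_sub_distrib]
  have h3 : ∑ χ ∈ (Finset.univ.image (infl : Irr (D ⧸ N) → Irr D)), (χ.dg : ℤ) * (4 - χ.dg) =
      ∑ χ : Irr (D ⧸ N), (4 * (χ.dg : ℤ) - χ.dg ^ 2) := by
    rw [Finset.sum_image (fun a _ b _ h => infl_inj h)]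
    refine Finset.sum_congr rfl fun χ _ => ?_
    rw [infl_dg]; ring
  rw [← h3, h2]
end Infl

open CategoryTheory
set_option linter.unusedSectionVars false
set_option linter.unusedSimpArgs false

section McKay
variable {D : Type} [Group D] [Fintype D]

theorem two_real (hp : commutator D = ⊤) (ψ : Irr D) (h2 : ψ.dg = 2) : ψ.dual = ψ := by
  obtain ⟨V, hV, hd⟩ := ψ.exists_rep
  apply Irr.ext
  funext g
  rw [Irr.dual_apply, hV]
  show LinearMap.trace ℂ V (V.ρ g⁻¹) = LinearMap.trace ℂ V (V.ρ g)
  have hb : Module.finrank ℂ V = 2 := hd.trans h2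
  let b : Module.Basis (Fin 2) ℂ V := Module.finBasisOfFinrankEq ℂ V hb
  rw [LinearMap.trace_eq_matrix_trace ℂ b, LinearMap.trace_eq_matrix_trace ℂ b]
  set A := LinearMap.toMatrix b b (V.ρ g) with hA
  have hdet : A.det = 1 := by rw [hA, LinearMap.det_toMatrix]; exact perfect_det hp V g
  have hAB : LinearMap.toMatrix b b (V.ρ g⁻¹) * A = 1 := by
    rw [hA, ← LinearMap.toMatrix_mul, ← map_mul, inv_mul_cancel, map_one, LinearMap.toMatrix_one]
  have hadj : LinearMap.toMatrix b b (V.ρ g⁻¹) = A.adjugate := by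
    have h1 := A.mul_adjugate
    rw [hdet, one_smul] at h1
    calc _ = LinearMap.toMatrix b b (V.ρ g⁻¹) * (A * A.adjugate) := by rw [h1, mul_one]
      _ = _ := by rw [← mul_assoc, hAB, one_mul]
  rw [hadj, Matrix.adjugate_fin_two, Matrix.trace_fin_two, Matrix.trace_fin_two]
  simp [add_comm]

theorem split_off {f : D → ℂ} (hf : NChar f) (χ : Irr D) (h : cip f χ.1 ≠ 0) :
    ∃ t : Multiset (Irr D), f = χ.1 + msum t := by
  obtain ⟨t, ht⟩ := (hf.sub_irr χ h).exists_multiset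
  exact ⟨t, by rw [show msum t = f - χ.1 from ht.symm]; abel⟩

theorem split_off_mul (a b χ : Irr D) (h : cip (a.1 * b.1) χ.1 ≠ 0) :
    ∃ t : Multiset (Irr D), a.1 * b.1 = χ.1 + msum t ∧ a.dg * b.dg = χ.dg + (t.map Irr.dg).sum := by
  obtain ⟨t, ht⟩ := split_off (a.nchar.mul b.nchar) χ h
  refine ⟨t, ht, ?_⟩
  have := congrFun ht 1
  rw [Pi.mul_apply, Pi.add_apply, msum_one, a.one_eq, b.one_eq, χ.one_eq] at this
  exact_mod_cast this

theorem msum_deg_zero {t : Multiset (Irr D)} (h : (t.map Irr.dg).sum = 0) : t = 0 := by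
  induction t using Multiset.induction with
  | empty => rfl
  | cons a s ih =>
    rw [Multiset.map_cons, Multiset.sum_cons] at h
    have := a.dg_pos
    omega

theorem card_le_deg {t : Multiset (Irr D)} : t.card ≤ (t.map Irr.dg).sum := by
  induction t using Multiset.induction with
  | empty => simp
  | cons a s ih =>
    rw [Multiset.map_cons, Multiset.sum_cons, Multiset.card_cons]
    have := a.dg_pos
    omega

theorem msum_deg_one {t : Multiset (Irr D)} (h : (t.map Irr.dg).sum = 1) : ∃ a, t = {a} ∧ a.dg = 1 := by
  have h1 := card_le_deg (t := t)
  have h2 : t.card ≠ 0 := by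
    intro e; rw [Multiset.card_eq_zero] at e; subst e; simp at h
  obtain ⟨a, rfl⟩ := Multiset.card_eq_one.1 (show t.card = 1 by omega)
  exact ⟨a, rfl, by simpa using h⟩

theorem msum_deg_two {t : Multiset (Irr D)} (h : (t.map Irr.dg).sum = 2) (h1 : ∀ a ∈ t, a.dg ≠ 1) :
    ∃ a, t = {a} ∧ a.dg = 2 := by
  have h0 := card_le_deg (t := t)
  have h2 : t.card ≠ 0 := by
    intro e; rw [Multiset.card_eq_zero] at e; subst e; simp at h
  rcases (show t.card = 1 ∨ t.card = 2 by omega) with hc | hc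
  · obtain ⟨a, rfl⟩ := Multiset.card_eq_one.1 hc
    exact ⟨a, rfl, by simpa using h⟩
  · obtain ⟨a, b, rfl⟩ := Multiset.card_eq_two.1 hc
    exfalso
    have := h1 a (by simp)
    have := h1 b (by simp)
    have := a.dg_pos
    have := b.dg_pos
    simp at h
    omega

structure Chn (ψ : Irr D) (n : ℕ) (v : ℕ → Irr D) : Prop where
  one : v 1 = Irr.triv
  two : v 2 = ψ
  deg : ∀ i, 1 ≤ i → i ≤ n → (v i).dg = i
  mul : ∀ i, 2 ≤ i → i < n → ψ.1 * (v i).1 = (v (i-1)).1 + (v (i+1)).1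

structure Branch (ψ : Irr D) (v : ℕ → Irr D) (a b u : Irr D) : Prop where
  ch : Chn ψ 6 v
  da : a.dg = 3
  db : b.dg = 4
  du : u.dg = 2
  ne : a ≠ v 3
  m6 : ψ.1 * (v 6).1 = (v 5).1 + a.1 + b.1
  ma : ψ.1 * a.1 = (v 6).1
  mb : ψ.1 * b.1 = (v 6).1 + u.1
  mu : ψ.1 * u.1 = b.1

theorem two_le_sum (k : ℕ) (t : Multiset (Irr D)) (h : ∀ a ∈ t, k ≤ 2 * a.dg) : k * t.card ≤ 2 * (t.map Irr.dg).sum := by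
  induction t using Multiset.induction with
  | empty => simp
  | cons a s ih =>
    rw [Multiset.map_cons, Multiset.sum_cons, Multiset.card_cons]
    have := h a (by simp)
    have := ih (fun b hb => h b (by simp [hb]))
    nlinarith

theorem cip_mem_ne {t : Multiset (Irr D)} {a : Irr D} (h : a ∈ t) : cip (msum t) a.1 ≠ 0 := by
  rw [cip_msum]
  have := Multiset.count_pos.2 h
  exact_mod_cast this.ne'

theorem chain_step (hp : commutator D = ⊤) {ψ : Irr D} (h2 : ψ.dg = 2) {n : ℕ} (hn : 2 ≤ n) {v : ℕ → Irr D}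
    (hv : Chn ψ n v) : (∃ v', Chn ψ (n+1) v') ∨ ∃ a b u, Branch ψ v a b u := by
  have hr := two_real hp ψ h2
  have hone : ∀ u : Irr D, u.dg = 1 → u = Irr.triv := perfect_dg_one hp
  have hvne : ∀ i j, 1 ≤ i → i ≤ n → 1 ≤ j → j ≤ n → i ≠ j → v i ≠ v j := by
    intro i j h1 h2 h3 h4 h e
    have := hv.deg i h1 h2
    rw [e, hv.deg j h3 h4] at this
    exact h this.symm
  have hvc : ∀ i j, 1 ≤ i → i ≤ n → 1 ≤ j → j ≤ n → cip (v i).1 (v j).1 = if i = j then 1 else 0 := by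
    intro i j h1 h2 h3 h4
    split_ifs with h
    · rw [h]; exact cip_irr_self _
    · exact cip_irr_ne (hvne i j h1 h2 h3 h4 h)
  have hcj : ∀ j, 1 ≤ j → j < n → cip (ψ.1 * (v n).1) (v j).1 = if j + 1 = n then 1 else 0 := by
    intro j h1 h3
    rw [cip_real hr]
    rcases (show j = 1 ∨ 2 ≤ j by omega) with rfl | hj
    · rw [hv.one, Irr.triv_val, mul_one, ← hv.two, hvc n 2 (by omega) le_rfl (by omega) hn]
      congr 1; simp [eq_comm]
    · rw [hv.mul j hj h3, cip_add_right, hvc n (j-1) (by omega) le_rfl (by omega) (by omega),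
        hvc n (j+1) (by omega) le_rfl (by omega) (by omega), if_neg (by omega), zero_add]
      congr 1; simp [eq_comm]
  obtain ⟨s, hs, hsd⟩ := split_off_mul ψ (v n) (v (n-1)) (by
    rw [hcj (n-1) (by omega) (by omega), if_pos (by omega)]; exact one_ne_zero)
  rw [h2, hv.deg n (by omega) le_rfl, hv.deg (n-1) (by omega) (by omega)] at hsd
  have hnot : ∀ j, 1 ≤ j → j < n → v j ∉ s := by
    intro j h1 h3 hmem
    apply cip_mem_ne hmem
    have h4 := hcj j h1 h3
    rw [hs, cip_add_left, hvc (n-1) j (by omega) (by omega) h1 (by omega)] at h4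
    by_cases hj : j + 1 = n
    · rw [if_pos (by omega), if_pos hj] at h4
      linear_combination h4
    · rw [if_neg (by omega), if_neg hj] at h4
      linear_combination h4
  have hu1 : ∀ u ∈ s, u.dg ≠ 1 := by
    intro u hu h1
    apply hnot 1 le_rfl (by omega)
    rw [hv.one, ← hone u h1]; exact hu
  have hc : ∀ u ∈ s, cip (ψ.1 * u.1) (v n).1 ≠ 0 := by
    intro u hu h
    rw [cip_real hr, cip_comm, hs, cip_add_left] at h
    have h3 := cip_mem_ne hu
    rw [cip_msum] at h h3
    rw [Irr.cip] at h
    split_ifs at h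
    · norm_cast at h; omega
    · rw [zero_add] at h; exact h3 h
  have hge : ∀ u ∈ s, n ≤ 2 * u.dg := by
    intro u hu
    obtain ⟨t, _, ht⟩ := split_off_mul ψ u (v n) (hc u hu)
    rw [h2, hv.deg n (by omega) le_rfl] at ht
    omega
  have hcard : s.card ≠ 0 := by
    intro e; rw [Multiset.card_eq_zero] at e; subst e; simp at hsd; omega
  by_cases hc1 : s.card = 1
  · left
    obtain ⟨a, rfl⟩ := Multiset.card_eq_one.1 hc1
    rw [msum_singleton] at hs
    simp at hsd
    refine ⟨fun i => if i = n + 1 then a else v i, ?_, ?_, ?_, ?_⟩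
    · rw [if_neg (by omega)]; exact hv.one
    · rw [if_neg (by omega)]; exact hv.two
    · intro i h1 h3
      split_ifs with h
      · omega
      · exact hv.deg i h1 (by omega)
    · intro i h1 h3
      rw [if_neg (by omega), if_neg (by omega)]
      by_cases hi : i = n
      · subst hi; rw [if_pos rfl]; exact hs
      · rw [if_neg (by omega)]; exact hv.mul i h1 (by omega)
  right
  have hbd := two_le_sum n s hge
  have hbd2 := two_le_sum 4 s (fun u hu => by have := hu1 u hu; have := u.dg_pos; omega)
  have hn3 : 3 ≤ n := by
    by_contra h
    have : n = 2 := by omega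
    subst this
    omega
  have hc2 : s.card = 2 := by
    by_contra h
    have h3 : 3 ≤ s.card := by omega
    have : n * 3 ≤ n * s.card := Nat.mul_le_mul_left _ h3
    omega
  have hut : ∀ u ∈ s, ∀ t, ψ.1 * u.1 = (v n).1 + msum t → Irr.triv ∉ t := by
    intro u hu t ht hmem
    have h3 := cip_mem_ne hmem
    have h4 := Irr.mul_dual_cip ψ u
    rw [ht, cip_add_left, cip_msum] at h4
    rw [cip_msum] at h3
    have h5 : u ≠ ψ.dual := by
      rw [hr]; rintro rfl
      exact hnot 2 (by omega) (by omega) (hv.two ▸ hu)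
    rw [if_neg h5, Irr.cip] at h4
    split_ifs at h4
    · norm_cast at h4; omega
    · rw [zero_add] at h4; exact h3 h4
  have hut1 : ∀ u ∈ s, ∀ t, ψ.1 * u.1 = (v n).1 + msum t → ∀ e ∈ t, e.dg ≠ 1 := by
    intro u hu t ht e he h1
    apply hut u hu t ht
    rw [← hone e h1]; exact he
  have hodd : ∀ u ∈ s, 2 * u.dg ≠ n + 1 := by
    intro u hu h
    obtain ⟨t, ht1, ht⟩ := split_off_mul ψ u (v n) (hc u hu)
    rw [h2, hv.deg n (by omega) le_rfl] at ht
    obtain ⟨e, rfl, he⟩ := msum_deg_one (show (t.map Irr.dg).sum = 1 by omega)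
    exact hut1 u hu _ ht1 e (by simp) he
  have hab : ∃ a b, s = {a, b} ∧ a.dg ≤ b.dg := by
    obtain ⟨a, b, h⟩ := Multiset.card_eq_two.1 hc2
    rcases le_total a.dg b.dg with h1 | h1
    · exact ⟨a, b, h, h1⟩
    · exact ⟨b, a, by rw [h]; exact Multiset.pair_comm a b, h1⟩
  obtain ⟨a, b, rfl, hle⟩ := hab
  have ha : a ∈ ({a, b} : Multiset (Irr D)) := by simp
  have hb : b ∈ ({a, b} : Multiset (Irr D)) := by simp
  have hga := hge a ha
  have hgb := hge b hb
  have hoa := hodd a ha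
  have hsum : a.dg + b.dg = n + 1 := by simp at hsd; omega
  have hda : 2 * a.dg = n := by omega
  have hdb : 2 * b.dg = n + 2 := by omega
  have hma : ψ.1 * a.1 = (v n).1 := by
    obtain ⟨t, ht1, ht⟩ := split_off_mul ψ a (v n) (hc a ha)
    rw [h2, hv.deg n (by omega) le_rfl] at ht
    have := msum_deg_zero (show (t.map Irr.dg).sum = 0 by omega)
    rw [ht1, this, msum_zero, add_zero]
  obtain ⟨t, ht1, ht⟩ := split_off_mul ψ b (v n) (hc b hb)
  rw [h2, hv.deg n (by omega) le_rfl] at ht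
  obtain ⟨u, rfl, hdu⟩ := msum_deg_two (show (t.map Irr.dg).sum = 2 by omega) (hut1 b hb t ht1)
  rw [msum_singleton] at ht1
  have hub : cip (ψ.1 * u.1) b.1 ≠ 0 := by
    rw [cip_real hr, ht1, cip_add_right, cip_irr_self, Irr.cip]
    split_ifs <;> norm_num
  obtain ⟨t, ht3, ht4⟩ := split_off_mul ψ u b hub
  rw [h2, hdu] at ht4
  have h6 : n = 6 := by
    by_contra h6
    have h4 : n = 4 := by omega
    subst h4
    obtain ⟨e, rfl, he⟩ := msum_deg_one (show (t.map Irr.dg).sum = 1 by omega)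
    have := hone e he
    subst this
    rw [msum_singleton] at ht3
    have hu : u = ψ := by
      have h5 := Irr.mul_dual_cip ψ u
      rw [hr] at h5
      by_contra hne
      rw [if_neg hne, ht3, cip_add_left, cip_irr_self, Irr.cip] at h5
      split_ifs at h5 <;> norm_num at h5
    subst hu
    have h7 := hv.mul 2 (by omega) (by omega)
    rw [hv.two, ht3] at h7
    simp only [Nat.reduceSub, Nat.reduceAdd] at h7
    rw [hv.one, add_comm, add_left_cancel_iff] at h7
    exact hnot 3 (by omega) (by omega) (by rw [← Irr.ext h7]; exact hb)
  subst h6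
  refine ⟨a, b, u, hv, by omega, by omega, hdu, ?_, ?_, hma, ht1, ?_⟩
  · rintro rfl
    exact hnot 3 (by omega) (by omega) ha
  · rw [hs]
    show _ = _
    rw [show ({a, b} : Multiset (Irr D)) = a ::ₘ {b} from rfl, msum_cons, msum_singleton, add_assoc]
  · have := msum_deg_zero (show (t.map Irr.dg).sum = 0 by omega)
    rw [ht3, this, msum_zero, add_zero]

theorem exists_branch (hp : commutator D = ⊤) {ψ : Irr D} (h2 : ψ.dg = 2) : ∃ v a b u, Branch ψ v a b u := by
  by_contra hno
  have hall : ∀ n, 2 ≤ n → ∃ v, Chn ψ n v := by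
    intro n hn
    induction n, hn using Nat.le_induction with
    | base =>
      refine ⟨fun i => if i = 1 then Irr.triv else ψ, by simp, by simp, ?_, ?_⟩
      · intro i h1 h3
        rcases (show i = 1 ∨ i = 2 by omega) with rfl | rfl <;> simp [h2]
      · intro i h1 h3; omega
    | succ n hn ih =>
      obtain ⟨v, hv⟩ := ih
      rcases chain_step hp h2 hn hv with h | ⟨a, b, u, h⟩
      · exact h
      · exact absurd ⟨v, a, b, u, h⟩ hno
  obtain ⟨v, hv⟩ := hall (Nat.card D + 2) (by omega)
  have h1 := sum_dg_sq (G := D)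
  have h3 := Finset.single_le_sum (f := fun χ : Irr D => χ.dg ^ 2) (fun _ _ => Nat.zero_le _) (Finset.mem_univ (v (Nat.card D + 2)))
  rw [h1, hv.deg _ (by omega) le_rfl] at h3
  nlinarith

theorem mckay {N : Subgroup D} (hD : Cov D N) {ψ : Irr D} (h2 : ψ.dg = 2) : 0 < blk N 1 := by
  classical
  obtain ⟨v, a, b, u, hb⟩ := exists_branch hD.perf h2
  have hr := two_real hD.perf ψ h2
  have hv := hb.ch
  have m2 : ψ.1 * ψ.1 = 1 + (v 3).1 := by
    have := hv.mul 2 (by omega) (by omega)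
    simp only [Nat.reduceSub, Nat.reduceAdd] at this
    rw [hv.two, hv.one, Irr.triv_val] at this
    exact this
  have m3 : ψ.1 * (v 3).1 = ψ.1 + (v 4).1 := by
    have := hv.mul 3 (by omega) (by omega)
    simp only [Nat.reduceSub, Nat.reduceAdd] at this
    rwa [hv.two] at this
  have m4 : ψ.1 * (v 4).1 = (v 3).1 + (v 5).1 := hv.mul 4 (by omega) (by omega)
  have m5 : ψ.1 * (v 5).1 = (v 4).1 + (v 6).1 := hv.mul 5 (by omega) (by omega)
  have d3 := hv.deg 3 (by omega) (by omega)
  have d4 := hv.deg 4 (by omega) (by omega)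
  have d5 := hv.deg 5 (by omega) (by omega)
  have d6 := hv.deg 6 (by omega) (by omega)
  have cpos : ∀ c w x y : Irr D, c.1 * w.1 = x.1 + y.1 → cip (c.1 * w.1) x.1 ≠ 0 ∧ cip (c.1 * w.1) y.1 ≠ 0 := by
    intro c w x y h
    rw [h, cip_add_left, cip_add_left, cip_irr_self, cip_irr_self, Irr.cip, Irr.cip]
    constructor <;> split_ifs <;> norm_num
  have hc := hD.cen
  have l1 : lam N ψ * lam N ψ = 1 := by
    have := lam_constituent hc ψ ψ Irr.triv (cpos ψ ψ Irr.triv (v 3) (by rw [m2, Irr.triv_val])).1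
    rw [← this, lam_triv]
  have l3 : lam N (v 3) = 1 := by
    rw [lam_constituent hc ψ ψ (v 3) (cpos ψ ψ Irr.triv (v 3) (by rw [m2, Irr.triv_val])).2, l1]
  have l4 : lam N (v 4) = lam N ψ := by
    rw [lam_constituent hc ψ (v 3) (v 4) (cpos _ _ _ _ m3).2, l3, mul_one]
  have l5 : lam N (v 5) = 1 := by
    rw [lam_constituent hc ψ (v 4) (v 5) (cpos _ _ _ _ m4).2, l4, l1]
  have l6 : lam N (v 6) = lam N ψ := by
    rw [lam_constituent hc ψ (v 5) (v 6) (cpos _ _ _ _ m5).2, l5, mul_one]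
  have la : lam N a = 1 := by
    rw [lam_constituent hc ψ (v 6) a, l6, l1]
    rw [cip_real hr, hb.ma, cip_irr_self]; exact one_ne_zero
  have lb : lam N b = 1 := by
    rw [lam_constituent hc ψ (v 6) b, l6, l1]
    rw [cip_real hr, hb.mb, cip_add_right, cip_irr_self, Irr.cip]
    split_ifs <;> norm_num
  let R : D → ℂ := fun g => 1 + 3 * (v 3).1 g + 5 * (v 5).1 g + 3 * a.1 g + 4 * b.1 g
  have hR0 : ∀ g, g ∉ N → R g = 0 := by
    intro g hg
    have e2 := congrFun m2 g
    have e3 := congrFun m3 g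
    have e4 := congrFun m4 g
    have e5 := congrFun m5 g
    have e6 := congrFun hb.m6 g
    have ea := congrFun hb.ma g
    have eb := congrFun hb.mb g
    have eu := congrFun hb.mu g
    simp only [Pi.mul_apply, Pi.add_apply, Pi.one_apply] at e2 e3 e4 e5 e6 ea eb eu
    have key : (ψ.1 g * ψ.1 g - 4) * R g = 0 := by
      simp only [R]
      linear_combination (3 + 1) * e2 + 3 * ψ.1 g * e3 + 8 * e4 + 5 * ψ.1 g * e5 + 12 * e6 + 3 * ψ.1 g * ea + 4 * ψ.1 g * eb + 4 * eu
    rcases mul_eq_zero.1 key with h | h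
    · exfalso
      apply hg
      apply hD.ker_le (χ := v 3) (ntriv_of_dg (by omega))
      rw [d3]
      push_cast
      linear_combination h - e2
    · exact h
  have hR1 : ∀ g, g ∈ N → R g = 60 := by
    intro g hg
    have h3 : (v 3).1 g = 3 := by have := lam_apply (v 3) ⟨g, hg⟩; rw [l3, d3] at this; simpa using this
    have h5 : (v 5).1 g = 5 := by have := lam_apply (v 5) ⟨g, hg⟩; rw [l5, d5] at this; simpa using this
    have ha : a.1 g = 3 := by have := lam_apply a ⟨g, hg⟩; rw [la, hb.da] at this; simpa using this
    have hb : b.1 g = 4 := by have := lam_apply b ⟨g, hg⟩; rw [lb, hb.db] at this; simpa using this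
    simp only [R, h3, h5, ha, hb]; norm_num
  have hcipR : cip R (Irr.triv : Irr D).1 = 1 := by
    have hRe : R = (Irr.triv : Irr D).1 + (3:ℂ) • (v 3).1 + (5:ℂ) • (v 5).1 + (3:ℂ) • a.1 + (4:ℂ) • b.1 := by
      funext g; simp [R]
    have t1 : v 3 ≠ Irr.triv := ntriv_of_dg (by omega)
    have t2 : v 5 ≠ Irr.triv := ntriv_of_dg (by omega)
    have t3 : a ≠ Irr.triv := ntriv_of_dg (by rw [hb.da]; omega)
    have t4 : b ≠ Irr.triv := ntriv_of_dg (by rw [hb.db]; omega)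
    rw [hRe]
    simp only [cip_add_left, cip_smul_left, cip_irr_self, cip_irr_ne t1, cip_irr_ne t2, cip_irr_ne t3, cip_irr_ne t4]
    norm_num
  have hS : Nat.card (D ⧸ N) = 60 := by
    have h1 : ∑ g : D, R g = 60 * Nat.card N := by
      have : ∀ g, R g = if g ∈ N then 60 else 0 := by
        intro g
        split_ifs with h
        · exact hR1 g h
        · exact hR0 g h
      rw [Finset.sum_congr rfl (fun g _ => this g), ← Finset.sum_filter, Finset.sum_const, nsmul_eq_mul, mul_comm]
      congr 2
      rw [Nat.card_eq_fintype_card, Fintype.card_subtype]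
    unfold cip at hcipR
    simp only [Irr.triv_apply, mul_one] at hcipR
    rw [h1] at hcipR
    have h3 : (Nat.card D : ℂ) ≠ 0 := card_ne
    have h4 : (60 * Nat.card N : ℂ) = Nat.card D := by
      field_simp at hcipR
      exact hcipR
    have h5 : 60 * Nat.card N = Nat.card D := by exact_mod_cast h4
    rw [Subgroup.card_eq_card_quotient_mul_card_subgroup N] at h5
    exact (Nat.eq_of_mul_eq_mul_right Nat.card_pos h5).symm
  have hsq := block_sq hc (Irr.triv : Irr D)
  rw [lam_triv, hS] at hsq
  let T : Finset (Irr D) := {Irr.triv, v 3, v 5, a, b}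
  have hTs : ∑ χ ∈ T, χ.dg = 16 := by
    have t1 : (Irr.triv : Irr D) ≠ v 3 := ne_of_dg (by simp; omega)
    have t2 : (Irr.triv : Irr D) ≠ v 5 := ne_of_dg (by simp; omega)
    have t3 : (Irr.triv : Irr D) ≠ a := ne_of_dg (by simp [hb.da])
    have t4 : (Irr.triv : Irr D) ≠ b := ne_of_dg (by simp [hb.db])
    have t5 : v 3 ≠ v 5 := ne_of_dg (by omega)
    have t6 : v 3 ≠ b := ne_of_dg (by rw [hb.db]; omega)
    have t7 : v 5 ≠ a := ne_of_dg (by rw [hb.da]; omega)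
    have t8 : v 5 ≠ b := ne_of_dg (by rw [hb.db]; omega)
    have t9 : a ≠ b := ne_of_dg (by rw [hb.db, hb.da]; omega)
    simp only [T]
    rw [Finset.sum_insert (by simp [t1, t2, t3, t4]), Finset.sum_insert (by simp [t5, t6, hb.ne.symm]),
      Finset.sum_insert (by simp [t7, t8]), Finset.sum_insert (by simp [t9]), Finset.sum_singleton,
      d3, d5, hb.da, hb.db, Irr.triv_dg]; norm_num
  have hsub : T ⊆ Finset.univ.filter (fun χ : Irr D => lam N χ = 1) := by
    intro χ hχ
    simp only [T, Finset.mem_insert, Finset.mem_singleton] at hχ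
    rw [Finset.mem_filter]
    refine ⟨Finset.mem_univ _, ?_⟩
    rcases hχ with rfl | rfl | rfl | rfl | rfl
    exacts [lam_triv, l3, l5, la, lb]
  have hge := Finset.sum_le_sum_of_subset (f := fun χ : Irr D => χ.dg) hsub
  rw [hTs] at hge
  have : blk N 1 = 4 * ((∑ χ : Irr D with lam N χ = 1, χ.dg : ℕ) : ℤ) - ((∑ χ : Irr D with lam N χ = 1, χ.dg ^ 2 : ℕ) : ℤ) := by
    unfold blk
    push_cast
    rw [Finset.mul_sum, ← Finset.sum_sub_distrib]
    refine Finset.sum_congr ?_ fun χ _ => by ring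
    ext; simp
  rw [this, hsq]
  omega
end McKay

open CategoryTheory
set_option linter.unusedSectionVars false
set_option linter.unusedSimpArgs false

section CovMain
variable {D : Type} [Group D] [Fintype D] {N : Subgroup D}

theorem blk_one_pos (hD : Cov D N) {x : D} (hx : x ∉ N) (hxx : x * x ∈ N)
    (hB : Nat.card D < 4 * ∑ χ : Irr D, χ.dg) : 0 < blk N 1 := by
  classical
  by_contra hle
  have htot := blk_total (N := N)
  have hpos : 0 < ∑ l ∈ Finset.univ.image (fun χ : Irr D => lam N χ), blk N l := by
    rw [htot]
    have : (Nat.card D : ℤ) < 4 * ((∑ χ : Irr D, χ.dg : ℕ) : ℤ) := by exact_mod_cast hB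
    omega
  obtain ⟨l, hl, hlp⟩ := Finset.exists_lt_of_sum_lt (s := Finset.univ.image (fun χ : Irr D => lam N χ))
    (f := fun _ => (0:ℤ)) (g := fun l => blk N l) (by simpa using hpos)
  obtain ⟨χ₀, _, rfl⟩ := Finset.mem_image.1 hl
  have hl1 : lam N χ₀ ≠ 1 := by
    intro e
    simp only [e] at hlp
    exact hle hlp
  have hex : ∃ χ : Irr D, lam N χ = lam N χ₀ ∧ χ.dg < 4 := by
    by_contra hno
    push Not at hno
    have : blk N (lam N χ₀) ≤ 0 := by
      unfold blk
      apply Finset.sum_nonpos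
      intro χ hχ
      have h4 := hno χ (Finset.mem_filter.1 hχ).2
      have h5 : (4:ℤ) ≤ χ.dg := by exact_mod_cast h4
      nlinarith
    exact absurd hlp (not_lt.2 this)
  obtain ⟨χ, hχ, hd⟩ := hex
  have h0 := χ.dg_pos
  rcases (show χ.dg = 1 ∨ χ.dg = 2 ∨ χ.dg = 3 by omega) with h | h | h
  · have := perfect_dg_one hD.perf χ h
    subst this
    exact hl1 (hχ ▸ lam_triv)
  · exact hle (mckay hD h)
  · have hx2 : x * x * x ∉ N := fun h' => hx ((N.mul_mem_cancel_left hxx).1 h')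
    have he : x * x * x * (x * x * x) = (x * x) * (x * x) * (x * x) := by group
    have hx3 : x * x * x * (x * x * x) ∈ N := by
      rw [he]; exact N.mul_mem (N.mul_mem hxx hxx) hxx
    have := block_nonpos hD χ₀ hl1 hx2 hx3 (by
      have h3 := (lam_act hD.cen χ ⟨x * x, hxx⟩).2 hD.perf
      rw [h, hχ] at h3
      have : (⟨x * x * x * (x * x * x), hx3⟩ : N) = ⟨x * x, hxx⟩ * ⟨x * x, hxx⟩ * ⟨x * x, hxx⟩ := Subtype.ext he
      rw [this, lam_mul hD.cen, lam_mul hD.cen, ← h3]; ring)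
    exact absurd hlp (not_lt.2 this)

/-- the degree-three part of the square of a degree-two character -/
theorem two_sq (hp : commutator D = ⊤) {ψ : Irr D} (h2 : ψ.dg = 2) :
    ∃ c : Irr D, c.dg = 3 ∧ ψ.1 * ψ.1 = 1 + c.1 := by
  obtain ⟨v, a, b, u, hb⟩ := exists_branch hp h2
  refine ⟨v 3, hb.ch.deg 3 (by omega) (by omega), ?_⟩
  have := hb.ch.mul 2 (by omega) (by omega)
  simp only [Nat.reduceSub, Nat.reduceAdd] at this
  rw [hb.ch.two, hb.ch.one, Irr.triv_val] at this
  exact this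

theorem two_sq_lam (hc : N ≤ Subgroup.center D) {ψ c : Irr D} (h3 : c.dg = 3) (h : ψ.1 * ψ.1 = 1 + c.1) :
    lam N ψ * lam N ψ = 1 ∧ lam N c = 1 := by
  have hne : c ≠ Irr.triv := ntriv_of_dg (by omega)
  have h1 : lam N (Irr.triv : Irr D) = lam N ψ * lam N ψ := by
    apply lam_constituent hc
    rw [h, ← Irr.triv_val, cip_add_left, cip_irr_self, cip_irr_ne hne]; norm_num
  have h4 : lam N c = lam N ψ * lam N ψ := by
    apply lam_constituent hc
    rw [h, ← Irr.triv_val, cip_add_left, cip_irr_self, cip_irr_ne hne.symm]; norm_num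
  rw [h4, ← h1, lam_triv]; simp

theorem two_inj (hD : Cov D N) (hge : ∀ χ : Irr D, lam N χ = 1 → χ ≠ Irr.triv → 3 ≤ χ.dg)
    {ψ φ c : Irr D} (hψ : ψ.dg = 2) (hφ : φ.dg = 2) (hl : lam N ψ = lam N φ) (hc : c.dg = 3)
    (h1 : ψ.1 * ψ.1 = 1 + c.1) (h2 : φ.1 * φ.1 = 1 + c.1) : ψ = φ := by
  have r1 := two_real hD.perf ψ hψ
  have r2 := two_real hD.perf φ hφ
  have hcne : c ≠ Irr.triv := ntriv_of_dg (by omega)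
  have hnorm : cip (ψ.1 * φ.1) (ψ.1 * φ.1) = 2 := by
    rw [cip_real r1, ← mul_assoc, mul_comm, cip_comm, cip_comm, mul_comm, h1, mul_comm (1 + c.1) φ.1, ← cip_real r2, h2,
      ← Irr.triv_val]
    simp only [cip_add_left, cip_add_right, cip_irr_self, cip_irr_ne hcne, cip_irr_ne hcne.symm]
    norm_num
  obtain ⟨t, ht⟩ := (ψ.nchar.mul φ.nchar).exists_multiset
  change _ = msum t at ht
  have htd : (t.map Irr.dg).sum = 4 := by
    have := congrFun ht 1
    rw [Pi.mul_apply, msum_one, ψ.one_eq, φ.one_eq, hψ, hφ] at this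
    have h3 : 2 * 2 = (t.map Irr.dg).sum := by exact_mod_cast this
    omega
  by_contra hne
  have hnt : Irr.triv ∉ t := by
    intro hmem
    apply cip_mem_ne hmem
    rw [← ht, Irr.mul_dual_cip, if_neg]
    rw [r1]; exact Ne.symm hne
  have hlt : ∀ a ∈ t, lam N a = 1 := by
    intro a ha
    rw [lam_constituent hD.cen ψ φ a (by rw [ht]; exact cip_mem_ne ha), ← hl, (two_sq_lam hD.cen hc h1).1]
  have h3 := three_le_sum t (fun a ha => hge a (hlt a ha) (fun e => hnt (e ▸ ha)))
  have h0 : t.card ≠ 0 := by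
    intro e; rw [Multiset.card_eq_zero] at e; subst e; simp at htd
  obtain ⟨a, rfl⟩ := Multiset.card_eq_one.1 (show t.card = 1 by omega)
  rw [ht, msum_singleton, cip_irr_self] at hnorm
  norm_num at hnorm

theorem block_neg (hD : Cov D N) (hge : ∀ χ : Irr D, lam N χ = 1 → χ ≠ Irr.triv → 3 ≤ χ.dg)
    (hS : Nat.card (D ⧸ N) = 60) {c₁ c₂ : Irr D} (h3 : ∀ c : Irr D, lam N c = 1 → c.dg = 3 → c = c₁ ∨ c = c₂)
    (χ₀ : Irr D) (hl : lam N χ₀ ≠ 1) : blk N (lam N χ₀) ≤ -4 := by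
  classical
  obtain ⟨z, hz⟩ := Function.ne_iff.1 hl
  rw [Pi.one_apply] at hz
  set m := orderOf (lam N χ₀ z) with hm
  have hdvd : ∀ χ : Irr D, lam N χ = lam N χ₀ → m ∣ χ.dg := by
    intro χ h
    apply orderOf_dvd_of_pow_eq_one
    rw [← h]
    exact (lam_act hD.cen χ z).2 hD.perf
  have hm1 : m ≠ 1 := by
    intro e
    exact hz (orderOf_eq_one_iff.1 e)
  have hsq := block_sq hD.cen χ₀
  rw [hS] at hsq
  have hmm : m ^ 2 ∣ 60 := by
    rw [← hsq]
    apply Finset.dvd_sum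
    intro χ hχ
    exact pow_dvd_pow_of_dvd (hdvd χ (Finset.mem_filter.1 hχ).2) 2
  have hm2 : m = 2 := by
    have h1 := Nat.le_of_dvd (by norm_num) hmm
    have h2 : m < 8 := by nlinarith
    clear_value m
    clear hsq hdvd hm
    interval_cases m <;> revert hmm hm1 <;> decide
  have hdeg : ∀ χ : Irr D, lam N χ = lam N χ₀ → χ.dg = 2 ∨ χ.dg = 4 ∨ χ.dg = 6 := by
    intro χ h
    have h1 := hdvd χ h
    rw [hm2] at h1
    have h2 := Finset.single_le_sum (f := fun χ : Irr D => χ.dg ^ 2) (fun _ _ => Nat.zero_le _)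
      (show χ ∈ Finset.univ.filter (fun χ : Irr D => lam N χ = lam N χ₀) from Finset.mem_filter.2 ⟨Finset.mem_univ χ, h⟩)
    have h4 : χ.dg ^ 2 ≤ 60 := h2.trans hsq.le
    have h5 : χ.dg < 8 := by nlinarith
    have := χ.dg_pos
    omega
  set F := Finset.univ.filter (fun χ : Irr D => lam N χ = lam N χ₀) with hF
  have hn2 : (F.filter (fun χ => χ.dg = 2)).card ≤ 2 := by
    have hch : ∀ ψ : Irr D, ψ.dg = 2 → ∃ c : Irr D, c.dg = 3 ∧ ψ.1 * ψ.1 = 1 + c.1 := fun ψ h => two_sq hD.perf h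
    choose! f hf1 hf2 using hch
    have h1 : (F.filter (fun χ => χ.dg = 2)).card ≤ ({c₁, c₂} : Finset (Irr D)).card := by
      refine Finset.card_le_card_of_injOn f ?_ ?_
      · intro ψ hψ
        have hψ2 := (Finset.mem_filter.1 hψ).2
        have := h3 (f ψ) (two_sq_lam hD.cen (hf1 ψ hψ2) (hf2 ψ hψ2)).2 (hf1 ψ hψ2)
        simpa using this
      · intro ψ hψ φ hφ he
        have hψ2 := (Finset.mem_filter.1 hψ)
        have hφ2 := (Finset.mem_filter.1 hφ)
        refine two_inj hD hge hψ2.2 hφ2.2 ?_ (hf1 ψ hψ2.2) (hf2 ψ hψ2.2) (by rw [he]; exact hf2 φ hφ2.2)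
        exact (Finset.mem_filter.1 hψ2.1).2.trans (Finset.mem_filter.1 hφ2.1).2.symm
    exact h1.trans Finset.card_le_two
  have e1 : ((F.filter (fun χ => χ.dg = 2)).card : ℤ) * 4 + (F.filter (fun χ => χ.dg = 4)).card * 16 +
      (F.filter (fun χ => χ.dg = 6)).card * 36 = 60 := by
    have : ((∑ χ ∈ F, χ.dg ^ 2 : ℕ) : ℤ) = 60 := by rw [hsq]; rfl
    rw [← this]
    simp only [Finset.card_filter]
    push_cast
    rw [Finset.sum_mul, Finset.sum_mul, Finset.sum_mul, ← Finset.sum_add_distrib, ← Finset.sum_add_distrib]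
    refine Finset.sum_congr rfl fun χ hχ => ?_
    rcases hdeg χ (Finset.mem_filter.1 hχ).2 with h | h | h <;> rw [h] <;> norm_num
  have e2 : blk N (lam N χ₀) = ((F.filter (fun χ => χ.dg = 2)).card : ℤ) * 4 - (F.filter (fun χ => χ.dg = 6)).card * 12 := by
    unfold blk
    simp only [Finset.card_filter]
    push_cast
    rw [Finset.sum_mul, Finset.sum_mul, ← Finset.sum_sub_distrib]
    refine Finset.sum_congr (by ext; simp [hF]) fun χ hχ => ?_
    rcases hdeg χ (Finset.mem_filter.1 hχ).2 with h | h | h <;> rw [h] <;> norm_num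
  rw [e2]
  omega

theorem cov_bot [N.Normal] [IsSimpleGroup (D ⧸ N)] (hD : Cov D N) {x : D} (hx : x ∉ N) (hxx : x * x ∈ N)
    (hB : Nat.card D < 4 * ∑ χ : Irr D, χ.dg) : N = ⊥ := by
  classical
  haveI : Fintype (D ⧸ N) := Fintype.ofFinite _
  have hpos := blk_one_pos hD hx hxx hB
  rw [blk_one hD.cen] at hpos
  have hg : Good (D ⧸ N) (x : D ⧸ N) := by
    apply exists_good (perfect_quot hD.perf N)
    · exact fun e => hx ((QuotientGroup.eq_one_iff x).1 e)
    · rw [← QuotientGroup.mk_mul]; exact (QuotientGroup.eq_one_iff _).2 hxx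
    · have : (Nat.card (D ⧸ N) : ℤ) < 4 * ((∑ χ : Irr (D ⧸ N), χ.dg : ℕ) : ℤ) := by omega
      exact_mod_cast this
  obtain ⟨h60, h16, _, _, c₁, c₂, h3⟩ := hg.main
  have hb1 : blk N 1 = 4 := by rw [blk_one hD.cen, h60, h16]; norm_num
  have hneg := block_neg hD (by
    intro χ h hne
    obtain ⟨ψ, rfl⟩ := exists_infl hD.cen h
    rw [infl_dg]
    apply hg.ge
    rintro rfl
    apply hne
    apply Irr.ext
    funext g
    rfl) h60 (c₁ := infl c₁) (c₂ := infl c₂) (by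
    intro χ h hd
    obtain ⟨ψ, rfl⟩ := exists_infl hD.cen h
    rw [infl_dg] at hd
    rcases h3 ψ hd with e | e
    · left; rw [e]
    · right; rw [e])
  have hall : ∀ χ : Irr D, lam N χ = 1 := by
    by_contra hno
    push Not at hno
    obtain ⟨χ₀, hχ₀⟩ := hno
    have htot := blk_total (N := N)
    have h1 : (1 : N → ℂ) ∈ Finset.univ.image (fun χ : Irr D => lam N χ) :=
      Finset.mem_image.2 ⟨Irr.triv, Finset.mem_univ _, lam_triv⟩
    rw [← Finset.add_sum_erase _ _ h1, hb1] at htot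
    have h2 : lam N χ₀ ∈ (Finset.univ.image (fun χ : Irr D => lam N χ)).erase 1 :=
      Finset.mem_erase.2 ⟨hχ₀, Finset.mem_image.2 ⟨χ₀, Finset.mem_univ _, rfl⟩⟩
    rw [← Finset.add_sum_erase _ _ h2] at htot
    have h4 := hneg χ₀ hχ₀
    have h5 : ∑ l ∈ ((Finset.univ.image (fun χ : Irr D => lam N χ)).erase 1).erase (lam N χ₀), blk N l ≤ 0 := by
      apply Finset.sum_nonpos
      intro l hl
      have hl2 := Finset.mem_erase.1 (Finset.mem_of_mem_erase hl)
      obtain ⟨χ, _, rfl⟩ := Finset.mem_image.1 hl2.2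
      have := hneg χ hl2.1
      omega
    have : (Nat.card D : ℤ) < 4 * ((∑ χ : Irr D, χ.dg : ℕ) : ℤ) := by exact_mod_cast hB
    omega
  rw [eq_bot_iff]
  intro z hz
  rw [Subgroup.mem_bot]
  by_contra hne
  have h1 := sum_dg_mul z
  rw [if_neg hne] at h1
  have h2 := sum_dg_mul (1 : D)
  rw [if_pos rfl] at h2
  have h4 : ∀ χ : Irr D, χ.1 z = χ.1 1 := fun χ => by
    have := lam_apply χ ⟨z, hz⟩
    rw [hall χ, Pi.one_apply, one_mul] at this
    rw [χ.one_eq]; exact this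
  simp only [h4] at h1
  rw [h2] at h1
  exact card_ne (by exact_mod_cast h1)

/-- perfect groups satisfying the bound are simple of order 60, with small involution centralizers -/
theorem perfect_main [Nontrivial D] (hp : commutator D = ⊤) (hB : Nat.card D < 4 * ∑ χ : Irr D, χ.dg)
    (hc : 1/16 < commProb D) :
    IsSimpleGroup D ∧ Nat.card D = 60 ∧ Nat.card (ConjClasses D) = 5 ∧ (∃ x : D, x ≠ 1 ∧ x * x = 1) ∧
      ∀ x : D, x ≠ 1 → x * x = 1 → Nat.card (Subgroup.centralizer {x}) = 4 := by
  obtain ⟨N, hN, hD, hs, x, hx, hxx⟩ := exists_cov hp hc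
  have hb := cov_bot hD hx hxx hB
  subst hb
  have hsD : IsSimpleGroup D := by
    refine ⟨fun H hH => ?_⟩
    by_cases h : H ≤ ⊥
    · left; exact le_bot_iff.1 h
    · right; exact hD.max H hH h
  rw [Subgroup.mem_bot] at hx hxx
  have hm := (exists_good hp hx hxx hB).main
  refine ⟨hsD, hm.1, ?_, ⟨x, hx, hxx⟩, fun y hy hyy => (exists_good hp hy hyy hB).main.2.2.2.1⟩
  rw [← card_irr]; exact hm.2.2.1
end CovMain

open CategoryTheory
set_option linter.unusedSectionVars false
set_option linter.unusedSimpArgs false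

section Sixty
variable {D : Type} [Group D] [Fintype D]

theorem sylow_perm_inj (hs : IsSimpleGroup D) (hn : 1 < Nat.card (Sylow 2 D)) :
    Function.Injective (MulAction.toPermHom D (Sylow 2 D)) := by
  have : Fact (Nat.Prime 2) := ⟨Nat.prime_two⟩
  rw [← MonoidHom.ker_eq_bot_iff]
  rcases hs.eq_bot_or_eq_top_of_normal _ (MonoidHom.normal_ker (MulAction.toPermHom D (Sylow 2 D)))
    with h | h
  · exact h
  · exfalso
    have : Nontrivial (Sylow 2 D) := Finite.one_lt_card_iff_nontrivial.1 hn
    obtain ⟨P, Q, hPQ⟩ := exists_pair_ne (Sylow 2 D)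
    obtain ⟨g, hg⟩ := MulAction.exists_smul_eq D P Q
    have hg' : g ∈ (MulAction.toPermHom D (Sylow 2 D)).ker := by rw [h]; trivial
    rw [MonoidHom.mem_ker] at hg'
    have := congrArg (fun e : Equiv.Perm (Sylow 2 D) => e P) hg'
    simp only [MulAction.toPermHom_apply, MulAction.toPerm_apply, Equiv.Perm.one_apply] at this
    exact hPQ (this.symm.trans hg)

theorem card_sylow_two (hs : IsSimpleGroup D) (hc : Nat.card D = 60) : Nat.card (Sylow 2 D) = 5 := by
  have : Fact (Nat.Prime 2) := ⟨Nat.prime_two⟩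
  obtain ⟨P⟩ : Nonempty (Sylow 2 D) := inferInstance
  have hf : Nat.factorization 60 2 = 2 := by
    rw [show 60 = 2^2 * 15 by norm_num, Nat.factorization_mul (by norm_num) (by norm_num),
      Nat.Prime.factorization_pow Nat.prime_two]
    simp [Nat.factorization_eq_zero_of_not_dvd (show ¬ 2 ∣ 15 by norm_num)]
  have hP : Nat.card P = 4 := by
    rw [P.card_eq_multiplicity, hc, hf]; norm_num
  have hi : (P : Subgroup D).index = 15 := by
    have := (P : Subgroup D).card_mul_index
    rw [hc] at this
    have h4 : Nat.card (P : Subgroup D) = 4 := hP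
    rw [h4] at this; omega
  have hd : Nat.card (Sylow 2 D) ∣ 15 := hi ▸ P.card_dvd_index
  have hne : ∀ H : Subgroup D, H.Normal → Nat.card H ≠ 1 → Nat.card H ≠ 60 → False := by
    intro H hH h1 h2
    rcases hs.eq_bot_or_eq_top_of_normal H hH with h | h
    · rw [h] at h1; exact h1 (by simp)
    · rw [h] at h2; exact h2 (by rw [Subgroup.card_top, hc])
  have hmem : Nat.card (Sylow 2 D) ∈ Nat.divisors 15 := Nat.mem_divisors.2 ⟨hd, by norm_num⟩
  rw [show Nat.divisors 15 = {1, 3, 5, 15} by decide] at hmem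
  simp only [Finset.mem_insert, Finset.mem_singleton] at hmem
  rcases hmem with h | h | h | h
  · exfalso
    have : Subsingleton (Sylow 2 D) := (Nat.card_eq_one_iff_unique.1 h).1
    exact hne P P.normal_of_subsingleton (by rw [show Nat.card (P : Subgroup D) = 4 from hP]; norm_num)
      (by rw [show Nat.card (P : Subgroup D) = 4 from hP]; norm_num)
  · exfalso
    have hj := sylow_perm_inj hs (by omega)
    have h2 := Subgroup.card_dvd_of_injective _ hj
    rw [hc, Nat.card_perm, h] at h2
    revert h2; decide
  · exact h
  · exfalso
    have hN : Subgroup.normalizer ((P : Subgroup D) : Set D) = (P : Subgroup D) := by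
      symm
      apply Subgroup.eq_of_le_of_card_ge Subgroup.le_normalizer
      have h1 := (Subgroup.normalizer ((P : Subgroup D) : Set D)).card_mul_index
      have h2 : (Subgroup.normalizer ((P : Subgroup D) : Set D)).index = 15 := by
        rw [← h]; exact P.card_eq_index_normalizer.symm
      rw [hc, h2] at h1
      have h4 : Nat.card (P : Subgroup D) = 4 := hP
      omega
    have hcm := IsPGroup.isMulCommutative_of_card_eq_prime_sq (p := 2) (G := P)
      (by rw [hP]; norm_num)
    have hle : Subgroup.normalizer ((P : Subgroup D) : Set D) ≤
        Subgroup.centralizer ((P : Subgroup D) : Set D) := by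
      rw [hN]
      intro a ha b hb
      exact congrArg Subtype.val (hcm.is_comm.comm ⟨b, hb⟩ ⟨a, ha⟩)
    have hk := (MonoidHom.ker_transferSylow_isComplement' P hle).card_mul_card
    rw [hc, show Nat.card (P : Subgroup D) = 4 from hP] at hk
    exact hne _ (MonoidHom.normal_ker (MonoidHom.transferSylow P hle)) (by omega) (by omega)
end Sixty

theorem card_partition_five : Nat.card (Nat.Partition 5) ≤ 7 := by
  have hle : ∀ (p : Nat.Partition 5) (i : ℕ), i ∈ p.parts → i ≤ 5 := fun p i hi => by
    have := Multiset.single_le_sum (fun x _ => Nat.zero_le x) i hi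
    rwa [p.parts_sum] at this
  have hsum : ∀ p : Nat.Partition 5, p.parts.count 1 + 2 * p.parts.count 2 + 3 * p.parts.count 3
      + 4 * p.parts.count 4 + 5 * p.parts.count 5 = 5 := by
    intro p
    have h1 := Finset.sum_multiset_count_of_subset p.parts (Finset.range 6) (by
      intro i hi
      rw [Multiset.mem_toFinset] at hi
      have := hle p i hi
      simp; omega)
    rw [p.parts_sum] at h1
    simp only [Finset.sum_range_succ, Finset.sum_range_zero, smul_eq_mul] at h1
    omega
  let T : Finset (ℕ × ℕ × ℕ × ℕ) := (Finset.range 3 ×ˢ Finset.range 2 ×ˢ Finset.range 2 ×ˢ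
    Finset.range 2).filter (fun q => 2 * q.1 + 3 * q.2.1 + 4 * q.2.2.1 + 5 * q.2.2.2 ≤ 5)
  let f : Nat.Partition 5 → T := fun p => ⟨(p.parts.count 2, p.parts.count 3, p.parts.count 4,
    p.parts.count 5), by
      have := hsum p
      simp only [T, Finset.mem_filter, Finset.mem_product, Finset.mem_range]
      omega⟩
  have hf : Function.Injective f := by
    intro p q hpq
    have h0 := congrArg Subtype.val hpq
    simp only [f, Prod.mk.injEq] at h0
    have hp := hsum p
    have hq := hsum q
    ext i
    by_cases hi : i ≤ 5
    · interval_cases i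
      · rw [Multiset.count_eq_zero_of_notMem, Multiset.count_eq_zero_of_notMem]
        · exact fun h => absurd (q.parts_pos h) (by norm_num)
        · exact fun h => absurd (p.parts_pos h) (by norm_num)
      all_goals omega
    · rw [Multiset.count_eq_zero_of_notMem (fun h => hi (hle p i h)),
        Multiset.count_eq_zero_of_notMem (fun h => hi (hle q i h))]
  have h7 : Nat.card T = 7 := by
    rw [Nat.card_eq_fintype_card, Fintype.card_coe]; decide
  exact h7 ▸ Nat.card_le_card_of_injective f hf

theorem conjClasses_S5 : Nat.card (ConjClasses (Equiv.Perm (Fin 5))) ≤ 7 := by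
  have h : Function.Injective (fun c : ConjClasses (Equiv.Perm (Fin 5)) =>
      Quotient.lift (s := IsConj.setoid _) (fun σ : Equiv.Perm (Fin 5) => σ.partition)
        (fun a b hab => Equiv.Perm.partition_eq_of_isConj.1 hab) c) := by
    intro a b
    refine Quotient.inductionOn₂ a b ?_
    intro x y hxy
    exact Quotient.sound (Equiv.Perm.partition_eq_of_isConj.2 hxy)
  have := Nat.card_le_card_of_injective _ h
  refine this.trans ?_
  rw [Fintype.card_fin]
  exact card_partition_five

section Final
variable {G : Type} [Group G] [Fintype G]

theorem final_A5 (hG : 1/16 < commProb G) (D : Subgroup G) [hDn : D.Normal] (hs : IsSimpleGroup D)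
    (hc : Nat.card D = 60) (hcc : Nat.card (ConjClasses D) = 5) :
    ∃ (Z : Type) (_ : CommGroup Z), Nonempty (G ≃* alternatingGroup (Fin 5) × Z) := by
  classical
  have : Fintype D := Fintype.ofFinite D
  have h5 := card_sylow_two hs hc
  let ε : Sylow 2 D ≃ Fin 5 := Finite.equivFinOfCardEq h5
  let φ : G →* Equiv.Perm (Fin 5) := (ε.permCongrHom.toMonoidHom.comp
    (MulAction.toPermHom (MulAut D) (Sylow 2 D))).comp MulAut.conjNormal
  have hinj : Function.Injective (φ.comp D.subtype) := by
    have hj := sylow_perm_inj hs (by omega)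
    intro a b hab
    apply hj
    apply ε.permCongrHom.injective
    have e1 : ∀ d : D, φ (d : G) = ε.permCongrHom (MulAction.toPermHom D (Sylow 2 D) d) := by
      intro d
      have : MulAut.conjNormal (d : G) = MulAut.conj d := MulAut.conjNormal_val
      change ε.permCongrHom (MulAction.toPermHom (MulAut D) (Sylow 2 D) (MulAut.conjNormal (d : G))) = _
      rw [this]
      congr 1
      ext1 P
      exact Sylow.smul_def.symm
    have := (e1 a).symm.trans (Eq.trans hab (e1 b))
    exact this
  have hS5 : Nat.card (Equiv.Perm (Fin 5)) = 120 := by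
    rw [Nat.card_perm, Nat.card_eq_fintype_card, Fintype.card_fin]; decide
  have hDr : (φ.comp D.subtype).range = alternatingGroup (Fin 5) := by
    apply Equiv.Perm.eq_alternatingGroup_of_index_eq_two
    have h1 := (φ.comp D.subtype).range.card_mul_index
    have h2 : Nat.card (φ.comp D.subtype).range = 60 := by
      rw [← hc]; exact (Nat.card_congr (MonoidHom.ofInjective hinj).toEquiv).symm
    rw [h2, hS5] at h1; omega
  have hle : alternatingGroup (Fin 5) ≤ φ.range := by
    rw [← hDr]
    rintro _ ⟨d, rfl⟩
    exact ⟨d, rfl⟩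
  have hnsurj : ¬ Function.Surjective φ := by
    intro hsur
    have h1 := gallagher_quot φ hsur
    rw [commProb_def' (Equiv.Perm (Fin 5)), hS5] at h1
    have h2 : (Nat.card (ConjClasses (Equiv.Perm (Fin 5))) : ℚ) ≤ 7 := by exact_mod_cast conjClasses_S5
    push_cast at h1
    linarith
  have hin : ∀ g, φ g ∈ alternatingGroup (Fin 5) := by
    intro g
    by_contra hg
    apply hnsurj
    intro σ
    by_cases hσ : σ ∈ alternatingGroup (Fin 5)
    · exact hle hσ
    · have : σ * (φ g)⁻¹ ∈ alternatingGroup (Fin 5) := by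
        rw [Equiv.Perm.mem_alternatingGroup] at *
        rw [map_mul, map_inv]
        rcases Int.units_eq_one_or (Equiv.Perm.sign σ) with h | h
        · exact absurd h hσ
        · rcases Int.units_eq_one_or (Equiv.Perm.sign (φ g)) with h' | h'
          · exact absurd h' hg
          · rw [h, h']; rfl
      obtain ⟨x, hx⟩ := hle this
      exact ⟨x * g, by rw [map_mul, hx]; group⟩
  let ψ : G →* alternatingGroup (Fin 5) := φ.codRestrict _ hin
  have hψ : Function.Surjective ψ := by
    rintro ⟨σ, hσ⟩
    obtain ⟨x, hx⟩ := hle hσ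
    exact ⟨x, Subtype.ext hx⟩
  let ψD : D →* alternatingGroup (Fin 5) := ψ.comp D.subtype
  have hψD : Function.Bijective ψD := by
    constructor
    · intro a b hab
      exact hinj (congrArg Subtype.val hab)
    · rintro ⟨σ, hσ⟩
      rw [← hDr] at hσ
      obtain ⟨x, hx⟩ := hσ
      exact ⟨x, Subtype.ext hx⟩
  let e : D ≃* alternatingGroup (Fin 5) := MulEquiv.ofBijective ψD hψD
  have hA5 : commProb (alternatingGroup (Fin 5)) ≤ 5 / 60 := by
    have := gallagher_quot (e.symm : alternatingGroup (Fin 5) →* D) e.symm.surjective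
    rw [commProb_def' D, hcc, hc] at this
    exact_mod_cast this
  have : Fintype ψ.ker := Fintype.ofFinite _
  have hK : 5/8 < commProb ψ.ker := by
    have h1 := gallagher ψ hψ
    have h2 : 0 ≤ commProb ψ.ker := (commProb_pos ψ.ker).le
    nlinarith
  have hKc := commProb_five_eighths hK
  have hcomm : ∀ (d : D) (k : ψ.ker), (d : G) * k = k * d := by
    intro d k
    have hdisj : Disjoint D ψ.ker := by
      rw [Subgroup.disjoint_def]
      intro x hx hk
      have : (⟨x, hx⟩ : D) = 1 := hψD.1 (by rw [map_one]; exact hk)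
      exact congrArg Subtype.val this
    exact Subgroup.commute_of_normal_of_disjoint D ψ.ker hDn inferInstance hdisj d k d.2 k.2
  let θ : alternatingGroup (Fin 5) × ψ.ker →* G :=
    MonoidHom.noncommCoprod (D.subtype.comp (e.symm : alternatingGroup (Fin 5) →* D)) ψ.ker.subtype
      (fun a k => hcomm (e.symm a) k)
  have hθ0 : ∀ a k, θ (a, k) = (e.symm a : G) * k := fun a k => rfl
  have hψe : ∀ a, ψ (e.symm a : G) = a := fun a => e.apply_symm_apply a
  have hθ : Function.Bijective θ := by
    constructor
    · rw [injective_iff_map_eq_one]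
      rintro ⟨a, k⟩ h
      rw [hθ0] at h
      have h1 := congrArg ψ h
      rw [map_mul, hψe, MonoidHom.mem_ker.1 k.2, mul_one, map_one] at h1
      subst h1
      simp only [map_one, OneMemClass.coe_one, one_mul] at h
      ext1
      · rfl
      · exact Subtype.ext h
    · intro g
      refine ⟨(ψ g, ⟨(e.symm (ψ g) : G)⁻¹ * g, ?_⟩), ?_⟩
      · rw [MonoidHom.mem_ker, map_mul, map_inv, hψe, inv_mul_cancel]
      · rw [hθ0]; group
  exact ⟨ψ.ker, { (inferInstance : Group ψ.ker) with mul_comm := hKc }, ⟨(MulEquiv.ofBijective θ hθ).symm⟩⟩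

theorem final_nonsolv (hns : ¬ Group.IsSolvable G) (h : (1 / 4 : ℝ) * Nat.card G < charDegSum G) :
    ∃ (Z : Type) (_ : CommGroup Z), Nonempty (G ≃* alternatingGroup (Fin 5) × Z) := by
  classical
  obtain ⟨n, hn⟩ : ∃ n, derivedSeries G (n+1) = derivedSeries G n := by
    let S := Set.range (fun n => Nat.card (derivedSeries G n))
    have hne : S.Nonempty := ⟨_, 0, rfl⟩
    obtain ⟨n, hn⟩ := Nat.sInf_mem hne
    refine ⟨n, Subgroup.eq_of_le_of_card_ge (derivedSeries_antitone G (Nat.le_succ n)) ?_⟩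
    have : Nat.card (derivedSeries G n) = sInf S := hn
    rw [this]
    exact Nat.sInf_le ⟨n+1, rfl⟩
  have hbot : derivedSeries G n ≠ ⊥ := fun hb => hns ⟨⟨n, hb⟩⟩
  have hnorm : (derivedSeries G n).Normal := derivedSeries_normal G n
  rw [derivedSeries_succ] at hn
  generalize derivedSeries G n = D at hn hbot hnorm
  have : Fintype D := Fintype.ofFinite D
  have : Nontrivial D := (Subgroup.nontrivial_iff_ne_bot D).2 hbot
  have hp : commutator D = ⊤ := by
    apply Subgroup.map_injective D.subtype_injective
    rw [commutator_def, Subgroup.map_commutator, ← MonoidHom.range_eq_map, Subgroup.range_subtype]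
    exact hn
  have hB : Nat.card D < 4 * ∑ χ : Irr D, χ.dg := by
    have h1 := h
    rw [charDegSum_eq] at h1
    have h2 : Nat.card G < 4 * ∑ χ : Irr G, χ.dg := by
      have : (Nat.card G : ℝ) < ((4 * ∑ χ : Irr G, χ.dg : ℕ) : ℝ) := by
        push_cast at h1 ⊢; linarith
      exact_mod_cast this
    have h3 := heredity D
    have h4 := D.card_mul_index
    by_contra hcon
    push Not at hcon
    have h5 := Nat.mul_le_mul_right D.index hcon
    nlinarith
  have hcD : 1/16 < commProb D := by
    apply commProb_of_degSum
    rw [charDegSum_eq]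
    have : (Nat.card D : ℝ) < ((4 * ∑ χ : Irr D, χ.dg : ℕ) : ℝ) := by exact_mod_cast hB
    push_cast at this ⊢; linarith
  obtain ⟨hs, hc, hcc, -, -⟩ := perfect_main hp hB hcD
  exact final_A5 (commProb_of_degSum h) D hs hc hcc
end Final

/-- If `T(G) > (1/4)·|G|` then either `G` is solvable of Fitting height at most 4, i.e. there
is a chain `⊥ = N₀ ≤ N₁ ≤ N₂ ≤ N₃ ≤ N₄ = ⊤` of normal subgroups of `G` with all successive
quotients nilpotent, or `G ≅ A₅ × Z` for some abelian group `Z`. -/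
theorem degree_sum_solvable (G : Type) [Group G] [Fintype G]
    (h : charDegSum G > (1 / 4 : ℝ) * Nat.card G) :
    (IsSolvable G ∧ ∃ N : Fin 5 → Subgroup G,
      N 0 = ⊥ ∧ N (Fin.last 4) = ⊤ ∧
      (∀ i : Fin 4, N i.castSucc ≤ N i.succ) ∧
      (∀ i : Fin 5, (N i).Normal) ∧
      (∀ i : Fin 4, ∃ _ : ((N i.castSucc).subgroupOf (N i.succ)).Normal,
        Group.IsNilpotent (↥(N i.succ) ⧸ (N i.castSucc).subgroupOf (N i.succ)))) ∨
    (∃ (Z : Type) (_ : CommGroup Z),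
      Nonempty (G ≃* alternatingGroup (Fin 5) × Z)) := by
  by_cases hs : Group.IsSolvable G
  · left
    exact ⟨hs, solvable_case h⟩
  · right
    exact final_nonsolv hs h
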